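/- Assume in addition that F is uniformly elliptic (θ > 0) and that H satisfies the uniform convexity condition. Then there exist a convex eigenfunction u* (a convex continuous viscosity solution of max{λ* + F(D²u) − f(x), H(Du)} = 0 on ℝⁿ with u*(x)/ℓ(x) → 1 as |x| → ∞) and a constant C ≥ 0 such that 0 ≤ u*(x + h) − 2u*(x) + u*(x − h) ≤ C|h|² for all x, h ∈ ℝⁿ; equivalently, u* has essentially bounded second derivatives, D²u* ∈ L^∞(ℝⁿ; Sₙ(ℝ)). -/

import Mathlib

open scoped RealInnerProductSpace
open Filter

/-- The Hessian matrix of `φ` at `x`, with entries the second derivatives in the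
coordinate directions. -/
noncomputable def hessianMatrix {n : ℕ} (φ : EuclideanSpace ℝ (Fin n) → ℝ)
    (x : EuclideanSpace ℝ (Fin n)) : Matrix (Fin n) (Fin n) ℝ :=
  Matrix.of fun i j =>
    iteratedFDeriv ℝ 2 φ x ![EuclideanSpace.single i (1 : ℝ), EuclideanSpace.single j (1 : ℝ)]

/-- `u` is a viscosity subsolution of `max {lam + F(D²u) - f, H(Du)} = 0` on `ℝⁿ`. -/
def IsSubsolutionEig {n : ℕ} (F : Matrix (Fin n) (Fin n) ℝ → ℝ)
    (H f : EuclideanSpace ℝ (Fin n) → ℝ) (lam : ℝ)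
    (u : EuclideanSpace ℝ (Fin n) → ℝ) : Prop :=
  ∀ φ : EuclideanSpace ℝ (Fin n) → ℝ, ContDiff ℝ 2 φ →
    ∀ x₀, IsLocalMax (fun x => u x - φ x) x₀ →
      max (lam + F (hessianMatrix φ x₀) - f x₀) (H (gradient φ x₀)) ≤ 0

/-- `v` is a viscosity supersolution of `max {lam + F(D²v) - f, H(Dv)} = 0` on `ℝⁿ`. -/
def IsSupersolutionEig {n : ℕ} (F : Matrix (Fin n) (Fin n) ℝ → ℝ)
    (H f : EuclideanSpace ℝ (Fin n) → ℝ) (lam : ℝ)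
    (v : EuclideanSpace ℝ (Fin n) → ℝ) : Prop :=
  ∀ φ : EuclideanSpace ℝ (Fin n) → ℝ, ContDiff ℝ 2 φ →
    ∀ x₀, IsLocalMin (fun x => v x - φ x) x₀ →
      0 ≤ max (lam + F (hessianMatrix φ x₀) - f x₀) (H (gradient φ x₀))

namespace CE

section Basic
variable {E : Type*} [NormedAddCommGroup E] [InnerProductSpace ℝ E]

/-- self-adjointness -/
def Sy (A : E →L[ℝ] E) : Prop := ∀ x y : E, ⟪A x, y⟫ = ⟪x, A y⟫

/-- a quadratic polynomial touches `w` from below -/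
def TB (w : E → ℝ) (x p : E) (A : E →L[ℝ] E) : Prop :=
  ∀ᶠ z in nhds (0 : E), w x + ⟪p, z⟫ + 1 / 2 * ⟪A z, z⟫ ≤ w (x + z)

/-- a quadratic polynomial touches `w` from above -/
def TA (w : E → ℝ) (x p : E) (A : E →L[ℝ] E) : Prop :=
  ∀ᶠ z in nhds (0 : E), w (x + z) ≤ w x + ⟪p, z⟫ + 1 / 2 * ⟪A z, z⟫

/-- second order Taylor expansion -/
def Tay (w : E → ℝ) (x p : E) (A : E →L[ℝ] E) : Prop :=
  ∀ η > 0, ∀ᶠ z in nhds (0 : E),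
    |w (x + z) - w x - ⟪p, z⟫ - 1 / 2 * ⟪A z, z⟫| ≤ η * ‖z‖ ^ 2

/-- structural properties of the elliptic operator -/
structure EllF (F : (E →L[ℝ] E) → ℝ) (θ CF : ℝ) : Prop where
  hθ : 0 < θ
  hC : 0 ≤ CF
  zero : F 0 = 0
  mono : ∀ A B, Sy A → Sy B → (∀ z, ⟪A z, z⟫ ≤ ⟪B z, z⟫) → F B ≤ F A
  shift : ∀ A, Sy A → ∀ c : ℝ, 0 ≤ c → F A - CF * c ≤ F (A + c • ContinuousLinearMap.id ℝ E)
  conc : ∀ A B, Sy A → Sy B → ∀ s t : ℝ, 0 ≤ s → 0 ≤ t → s * F A + t * F B ≤ F (s • A + t • B)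
  neg : ∀ A, Sy A → ∀ c d : ℝ, 0 ≤ c → (∀ z, ⟪A z, z⟫ ≤ c * ‖z‖ ^ 2) →
    ∀ v, v ≠ 0 → ⟪A v, v⟫ ≤ -d * ‖v‖ ^ 2 → -CF * c + θ * d ≤ F A
  up : ∀ A, Sy A → (∀ z, 0 ≤ ⟪A z, z⟫) → ∀ ξ, ‖ξ‖ = 1 → F A ≤ -θ * ⟪A ξ, ξ⟫

/-- structural properties of the gradient constraint and its support function -/
structure Gau (H ℓ : E → ℝ) (R : ℝ) : Prop where
  cont : Continuous H
  conv : ConvexOn ℝ Set.univ H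
  neg0 : H 0 < 0
  R0 : 0 < R
  bdd : ∀ p, H p ≤ 0 → ‖p‖ ≤ R
  sup : ∀ v, IsGreatest {r : ℝ | ∃ p, H p ≤ 0 ∧ ⟪p, v⟫ = r} (ℓ v)

/-- the gradient constraint in integrated form -/
def KL (ℓ w : E → ℝ) : Prop := ∀ x v, w (x + v) ≤ w x + ℓ v

/-- viscosity supersolution, with quadratic test functions -/
def Sup (F : (E →L[ℝ] E) → ℝ) (H g w : E → ℝ) : Prop :=
  ∀ x p A, Sy A → TB w x p A → H p < 0 → g x ≤ F A

/-- viscosity subsolution (second order part), with quadratic test functions -/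
def Sub (F : (E →L[ℝ] E) → ℝ) (g w : E → ℝ) : Prop :=
  ∀ x p A, Sy A → TA w x p A → F A ≤ g x

theorem Sy.smul {A : E →L[ℝ] E} (hA : Sy A) (c : ℝ) : Sy (c • A) := by
  intro x y
  simp [inner_smul_left, inner_smul_right, hA x y]

theorem Sy.add {A B : E →L[ℝ] E} (hA : Sy A) (hB : Sy B) : Sy (A + B) := by
  intro x y
  simp [inner_add_left, inner_add_right, hA x y, hB x y]

theorem Sy.id : Sy (ContinuousLinearMap.id ℝ E) := by
  intro x y; simp

theorem Sy.zero : Sy (0 : E →L[ℝ] E) := by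
  intro x y; simp

theorem inner_shift (A : E →L[ℝ] E) (c : ℝ) (z : E) :
    ⟪(A + c • ContinuousLinearMap.id ℝ E) z, z⟫ = ⟪A z, z⟫ + c * ‖z‖ ^ 2 := by
  simp [inner_add_left, inner_smul_left]

theorem abs_quad_le (A : E →L[ℝ] E) (z : E) : |⟪A z, z⟫| ≤ ‖A‖ * ‖z‖ ^ 2 := by
  calc |⟪A z, z⟫| ≤ ‖A z‖ * ‖z‖ := abs_real_inner_le_norm _ _
    _ ≤ (‖A‖ * ‖z‖) * ‖z‖ := by gcongr; exact A.le_opNorm z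
    _ = _ := by ring

theorem EllF.lip {F : (E →L[ℝ] E) → ℝ} {θ CF : ℝ} (hF : EllF F θ CF) {A B : E →L[ℝ] E}
    (hA : Sy A) (hB : Sy B) {c : ℝ} (hc : 0 ≤ c) (h : ∀ z, ⟪A z, z⟫ ≤ ⟪B z, z⟫ + c * ‖z‖ ^ 2) :
    F B - CF * c ≤ F A :=
  (hF.shift B hB c hc).trans (hF.mono _ _ hA (hB.add (Sy.id.smul c)) fun z => by
    rw [inner_shift]; exact h z)

theorem EllF.psd {F : (E →L[ℝ] E) → ℝ} {θ CF : ℝ} (hF : EllF F θ CF) {A : E →L[ℝ] E}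
    (hA : Sy A) (h : ∀ z, 0 ≤ ⟪A z, z⟫) : F A ≤ 0 := by
  have := hF.mono 0 A Sy.zero hA (fun z => by simpa using h z)
  rwa [hF.zero] at this

namespace Gau
variable {H ℓ : E → ℝ} {R : ℝ}

theorem ge (hG : Gau H ℓ R) {p : E} (hp : H p ≤ 0) (v : E) : ⟪p, v⟫ ≤ ℓ v := (hG.sup v).2 ⟨p, hp, rfl⟩

theorem att (hG : Gau H ℓ R) (v : E) : ∃ p, H p ≤ 0 ∧ ⟪p, v⟫ = ℓ v := (hG.sup v).1

theorem le (hG : Gau H ℓ R) (v : E) : ℓ v ≤ R * ‖v‖ := by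
  obtain ⟨p, hp, h⟩ := hG.att v
  rw [← h]
  refine (real_inner_le_norm p v).trans ?_
  gcongr
  exact hG.bdd p hp

theorem subadd (hG : Gau H ℓ R) (v w : E) : ℓ (v + w) ≤ ℓ v + ℓ w := by
  obtain ⟨p, hp, h⟩ := hG.att (v + w)
  rw [← h, inner_add_right]
  exact add_le_add (hG.ge hp v) (hG.ge hp w)

theorem zero (hG : Gau H ℓ R) : ℓ 0 = 0 := by
  obtain ⟨p, hp, h⟩ := hG.att 0
  rw [← h]; simp

theorem smul_le (hG : Gau H ℓ R) {t : ℝ} (ht : 0 ≤ t) (v : E) : ℓ (t • v) ≤ t * ℓ v := by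
  obtain ⟨p, hp, h⟩ := hG.att (t • v)
  rw [← h, inner_smul_right]
  exact mul_le_mul_of_nonneg_left (hG.ge hp v) ht

theorem le_smul (hG : Gau H ℓ R) {t : ℝ} (ht : 0 ≤ t) (v : E) : t * ℓ v ≤ ℓ (t • v) := by
  obtain ⟨p, hp, h⟩ := hG.att v
  rw [← h, ← real_inner_smul_right]
  exact hG.ge hp _

theorem nonneg (hG : Gau H ℓ R) (v : E) : 0 ≤ ℓ v := by
  simpa using hG.ge hG.neg0.le v

theorem lower (hG : Gau H ℓ R) : ∃ c > 0, ∀ v, c * ‖v‖ ≤ ℓ v := by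
  have : ∀ᶠ p in nhds (0 : E), H p < 0 := hG.cont.continuousAt.eventually_lt_const hG.neg0
  obtain ⟨r, hr, h⟩ := Metric.eventually_nhds_iff_ball.1 this
  refine ⟨r / 2, by positivity, fun v => ?_⟩
  by_cases hv : v = 0
  · subst hv; simp [hG.zero]
  have hv' : 0 < ‖v‖ := norm_pos_iff.2 hv
  have := hG.ge (p := (r / 2 / ‖v‖) • v) (h _ (by
    rw [mem_ball_zero_iff, norm_smul, Real.norm_of_nonneg (by positivity)]
    field_simp; linarith)).le v
  rw [real_inner_smul_left, real_inner_self_eq_norm_sq] at this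
  calc r / 2 * ‖v‖ = r / 2 / ‖v‖ * ‖v‖ ^ 2 := by field_simp
    _ ≤ _ := this

theorem mem [FiniteDimensional ℝ E] (hG : Gau H ℓ R) {p : E} (h : ∀ v, ⟪p, v⟫ ≤ ℓ v) : H p ≤ 0 := by
  by_contra hp
  have hconv : Convex ℝ {p | H p ≤ 0} := by
    have := hG.conv.convex_le 0
    simpa using this
  have hcl : IsClosed {p | H p ≤ 0} := isClosed_le hG.cont continuous_const
  obtain ⟨f, a, h1, h2⟩ := geometric_hahn_banach_point_closed hconv hcl hp
  set v := (InnerProductSpace.toDual ℝ E).symm f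
  have hv : ∀ q, f q = ⟪v, q⟫ := fun q => by simp [v]
  obtain ⟨q, hq, hq'⟩ := hG.att (-v)
  have h3 := h2 q hq
  have h4 := h (-v)
  rw [← hq', inner_neg_right, inner_neg_right, real_inner_comm, real_inner_comm v q, ← hv, ← hv] at h4
  linarith

theorem scale (hG : Gau H ℓ R) {p : E} (hp : H p ≤ 0) {ρ : ℝ} (h0 : 0 ≤ ρ) (h1 : ρ ≤ 1) :
    H (ρ • p) ≤ (1 - ρ) * H 0 := by
  have := hG.conv.2 (Set.mem_univ p) (Set.mem_univ 0) h0 (sub_nonneg.2 h1) (by ring)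
  simp only [smul_zero, add_zero, smul_eq_mul] at this
  nlinarith

/-- a vector maximal in direction `v` is not interior -/
theorem not_int (hG : Gau H ℓ R) {p v : E} (hv : v ≠ 0) (h : ℓ v ≤ ⟪p, v⟫) : 0 ≤ H p := by
  by_contra hp
  push Not at hp
  have h1 : Tendsto (fun t : ℝ => H (p + t • v)) (nhds 0) (nhds (H p)) := by
    have : Continuous fun t : ℝ => H (p + t • v) := hG.cont.comp (by fun_prop)
    simpa using this.tendsto 0
  have h2 := (h1.eventually_lt_const hp)
  obtain ⟨r, hr, h3⟩ := Metric.eventually_nhds_iff_ball.1 h2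
  have h4 := hG.ge (h3 (r / 2) (by simp [abs_of_pos hr]; linarith)).le v
  rw [inner_add_left, real_inner_smul_left, real_inner_self_eq_norm_sq] at h4
  have : 0 < ‖v‖ := norm_pos_iff.2 hv
  have : 0 < r / 2 * ‖v‖ ^ 2 := by positivity
  linarith

theorem kl_self (hG : Gau H ℓ R) : KL ℓ ℓ := fun x v => hG.subadd x v

theorem kl_abs (hG : Gau H ℓ R) {w : E → ℝ} (hw : KL ℓ w) (x y : E) : |w x - w y| ≤ R * ‖x - y‖ := by
  have h1 := hw y (x - y)
  have h2 := hw x (y - x)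
  have h3 := hG.le (x - y)
  have h4 := hG.le (y - x)
  rw [norm_sub_rev] at h4
  simp only [add_sub_cancel] at h1 h2
  rw [abs_le]; constructor <;> linarith

theorem kl_cont (hG : Gau H ℓ R) {w : E → ℝ} (hw : KL ℓ w) : Continuous w := by
  have : LipschitzWith R.toNNReal w := LipschitzWith.of_dist_le_mul fun x y => by
    rw [Real.dist_eq, dist_eq_norm, Real.coe_toNNReal _ hG.R0.le]
    exact hG.kl_abs hw x y
  exact this.continuous

theorem convexOn (hG : Gau H ℓ R) : ConvexOn ℝ Set.univ ℓ := by
  refine ⟨convex_univ, fun x _ y _ a b ha hb _ => ?_⟩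
  exact (hG.subadd _ _).trans (add_le_add (hG.smul_le ha x) (hG.smul_le hb y))

end Gau

/-- first-order consequence of a quadratic bound along a ray -/
theorem ray_le {a b c : ℝ} (h : ∀ᶠ t in nhdsWithin (0 : ℝ) (Set.Ioi 0), t * a ≤ t * b + c * t ^ 2) :
    a ≤ b := by
  have h1 : ∀ᶠ t in nhdsWithin (0 : ℝ) (Set.Ioi 0), a ≤ b + c * t := by
    filter_upwards [h, self_mem_nhdsWithin] with t ht ht0
    have ht0 : 0 < t := ht0
    have : t * a ≤ t * (b + c * t) := by linarith [ht]
    exact le_of_mul_le_mul_left this ht0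
  have h2 : Tendsto (fun t : ℝ => b + c * t) (nhdsWithin (0 : ℝ) (Set.Ioi 0)) (nhds b) := by
    have : Continuous fun t : ℝ => b + c * t := by fun_prop
    have := this.tendsto 0
    simp only [mul_zero, add_zero] at this
    exact this.mono_left nhdsWithin_le_nhds
  exact ge_of_tendsto h2 h1

theorem tendsto_ray (v : E) :
    Tendsto (fun t : ℝ => t • v) (nhdsWithin (0 : ℝ) (Set.Ioi 0)) (nhds (0 : E)) := by
  have : Continuous fun t : ℝ => t • v := by fun_prop
  have := this.tendsto 0
  simp only [zero_smul] at this
  exact this.mono_left nhdsWithin_le_nhds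

theorem KL.grad_TB [FiniteDimensional ℝ E] {H ℓ w : E → ℝ} {R : ℝ} (hG : Gau H ℓ R) (hw : KL ℓ w)
    {x p : E} {A : E →L[ℝ] E} (h : TB w x p A) : H p ≤ 0 := by
  refine hG.mem fun v => ?_
  apply ray_le (c := -(1 / 2 * ⟪A v, v⟫))
  filter_upwards [(tendsto_ray v).eventually h, self_mem_nhdsWithin] with t ht ht0
  have h1 := hw x (t • v)
  have h2 := hG.smul_le (le_of_lt ht0) v
  simp only [map_smul, inner_smul_left, inner_smul_right] at ht
  simp at ht
  nlinarith

theorem KL.grad_TA [FiniteDimensional ℝ E] {H ℓ w : E → ℝ} {R : ℝ} (hG : Gau H ℓ R) (hw : KL ℓ w)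
    {x p : E} {A : E →L[ℝ] E} (h : TA w x p A) : H p ≤ 0 := by
  refine hG.mem fun v => ?_
  apply ray_le (c := (1 / 2 * ⟪A v, v⟫))
  filter_upwards [(tendsto_ray (-v)).eventually h, self_mem_nhdsWithin] with t ht ht0
  have h1 := hw (x + t • (-v)) (t • v)
  have h2 := hG.smul_le (le_of_lt ht0) v
  simp only [map_smul, map_neg, inner_smul_left, inner_smul_right, inner_neg_left, inner_neg_right] at ht
  simp at ht h1
  nlinarith

/-- a supersolution can be tested by lower second order jets -/
theorem Sup.jet {F : (E →L[ℝ] E) → ℝ} {θ CF : ℝ} (hF : EllF F θ CF) {H g w : E → ℝ}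
    (hw : Sup F H g w) {x p : E} {A : E →L[ℝ] E} (hA : Sy A)
    (h : ∀ η > 0, ∀ᶠ z in nhds (0 : E),
      w x + ⟪p, z⟫ + 1 / 2 * ⟪A z, z⟫ - η * ‖z‖ ^ 2 ≤ w (x + z)) (hp : H p < 0) : g x ≤ F A := by
  apply le_of_forall_pos_le_add
  intro ε hε
  set η := ε / (2 * (CF + 1)) with hη
  have hC := hF.hC
  have hη0 : 0 < η := by positivity
  have hA' : Sy (A + (-(2 * η)) • ContinuousLinearMap.id ℝ E) := hA.add (Sy.id.smul _)
  have h1 := hw x p _ hA' (by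
    filter_upwards [h η hη0] with z hz
    rw [inner_shift]; linarith) hp
  have h2 := hF.lip hA hA' (c := 2 * η) (by positivity) (fun z => by rw [inner_shift]; linarith)
  have h3 : CF * (2 * η) ≤ ε := by
    rw [hη]; field_simp; nlinarith
  linarith

theorem Sub.jet {F : (E →L[ℝ] E) → ℝ} {θ CF : ℝ} (hF : EllF F θ CF) {g w : E → ℝ}
    (hw : Sub F g w) {x p : E} {A : E →L[ℝ] E} (hA : Sy A)
    (h : ∀ η > 0, ∀ᶠ z in nhds (0 : E),
      w (x + z) ≤ w x + ⟪p, z⟫ + 1 / 2 * ⟪A z, z⟫ + η * ‖z‖ ^ 2) : F A ≤ g x := by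
  apply le_of_forall_pos_le_add
  intro ε hε
  set η := ε / (2 * (CF + 1)) with hη
  have hC := hF.hC
  have hη0 : 0 < η := by positivity
  have hA' : Sy (A + (2 * η) • ContinuousLinearMap.id ℝ E) := hA.add (Sy.id.smul _)
  have h1 := hw x p _ hA' (by
    filter_upwards [h η hη0] with z hz
    rw [inner_shift]; linarith)
  have h2 := hF.shift A hA (2 * η) (by positivity)
  have h3 : CF * (2 * η) ≤ ε := by
    rw [hη]; field_simp; nlinarith
  linarith

/-- comparison of quadratic forms from small vectors to all vectors -/
theorem quad_of_small {A B : E →L[ℝ] E} {c : ℝ}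
    (h : ∀ᶠ z in nhds (0 : E), ⟪A z, z⟫ ≤ ⟪B z, z⟫ + c * ‖z‖ ^ 2) (z : E) :
    ⟪A z, z⟫ ≤ ⟪B z, z⟫ + c * ‖z‖ ^ 2 := by
  obtain ⟨t, ht, ht0⟩ := (((tendsto_ray z).eventually h).and self_mem_nhdsWithin).exists
  have ht0 : 0 < t := ht0
  simp only [map_smul, inner_smul_left, inner_smul_right, norm_smul, Real.norm_of_nonneg ht0.le] at ht
  simp at ht
  have : t ^ 2 * ⟪A z, z⟫ ≤ t ^ 2 * (⟪B z, z⟫ + c * ‖z‖ ^ 2) := by linarith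
  exact le_of_mul_le_mul_left this (by positivity)

end Basic
end CE

namespace CE

section Tay
variable {E : Type*} [NormedAddCommGroup E] [InnerProductSpace ℝ E]

/-- the real inner product as a bilinear map -/
noncomputable def J : E →L[ℝ] E →L[ℝ] ℝ :=
  (innerₗ E).mkContinuous₂ 1 (fun x y => by simpa using norm_inner_le_norm (𝕜 := ℝ) x y)

theorem J_apply (x y : E) : J x y = ⟪x, y⟫ := by simp [J]

theorem taylor {g : E → ℝ} {P : E → E} {A : E →L[ℝ] E} {x : E}
    (h1 : ∀ᶠ y in nhds x, HasFDerivAt g (J (P y)) y) (h2 : HasFDerivAt P A x) :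
    Sy A ∧ Tay g x (P x) A := by
  have hs : Sy A := by
    intro v w
    have h3 : HasFDerivAt (fun y => J (P y)) ((J (E := E)).comp A) x := (J (E := E)).hasFDerivAt.comp x h2
    have := second_derivative_symmetric_of_eventually h1 h3 v w
    simpa [J_apply, real_inner_comm] using this
  refine ⟨hs, fun η hη => ?_⟩
  have h3 : ∀ᶠ y in nhds x, ‖P y - P x - A (y - x)‖ ≤ η * ‖y - x‖ := h2.isLittleO.def hη
  have h4 : ∀ᶠ z in nhds (0:E), HasFDerivAt g (J (P (x + z))) (x + z) ∧
      ‖P (x + z) - P x - A z‖ ≤ η * ‖z‖ := by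
    have ht : Tendsto (fun z => x + z) (nhds (0:E)) (nhds x) := by
      have : Continuous fun z : E => x + z := by fun_prop
      simpa using this.tendsto 0
    filter_upwards [ht.eventually (h1.and h3)] with z hz
    simpa using hz
  obtain ⟨r, hr, h5⟩ := Metric.eventually_nhds_iff_ball.1 h4
  filter_upwards [Metric.ball_mem_nhds (0:E) hr] with z hz
  set k : E → ℝ := fun z => g (x + z) - ⟪P x, z⟫ - 1 / 2 * ⟪A z, z⟫ with hk
  have hkd : ∀ y ∈ Metric.ball (0:E) r, HasFDerivAt k (J (P (x + y) - P x - A y)) y := by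
    intro y hy
    have e1 : HasFDerivAt (fun z => g (x + z)) (J (P (x + y))) y := by
      have := (h5 y hy).1.comp y ((hasFDerivAt_id y).const_add x)
      rw [ContinuousLinearMap.comp_id] at this
      exact this
    have e2 : HasFDerivAt (fun z => ⟪P x, z⟫) (J (P x)) y := by
      have := (J (P x)).hasFDerivAt (x := y)
      exact this.congr_of_eventuallyEq (Eventually.of_forall fun z => (J_apply _ _).symm)
    have e3 := (A.hasFDerivAt (x := y)).inner ℝ (hasFDerivAt_id y)
    have e4 := (e1.sub e2).sub (e3.const_mul (1/2))
    refine (e4.congr_fderiv ?_)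
    ext v
    simp [J_apply]
    have := hs v y
    have h6 := real_inner_comm (A y) v
    linarith
  have hb : ‖z‖ < r := by simpa using hz
  have := (convex_closedBall (0:E) ‖z‖).norm_image_sub_le_of_norm_hasFDerivWithin_le (f := k)
    (f' := fun y => J (P (x + y) - P x - A y)) (C := η * ‖z‖) (x := 0) (y := z)
    (fun y hy => (hkd y (by simp at hy ⊢; linarith)).hasFDerivWithinAt)
    (fun y hy => by
      simp at hy
      have h7 : y ∈ Metric.ball (0:E) r := by simp; linarith
      refine ContinuousLinearMap.opNorm_le_bound _ (by positivity) fun v => ?_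
      rw [J_apply]
      refine (norm_inner_le_norm _ _).trans ?_
      gcongr
      refine (h5 y h7).2.trans ?_
      gcongr) (by simp) (by simp)
  simp only [hk, sub_zero, Real.norm_eq_abs] at this
  simp at this
  calc _ = |g (x + z) - ⟪P x, z⟫ - 2⁻¹ * ⟪A z, z⟫ - g x| := by congr 1; ring
    _ ≤ _ := this
    _ = _ := by ring

/-- at a local min of `W - quadratic`-like functions with Taylor expansion -/
theorem Tay.first {w : E → ℝ} {x p q : E} {A : E →L[ℝ] E} (h : Tay w x p A) {c : ℝ}
    (h2 : ∀ᶠ z in nhds (0 : E), w x + ⟪q, z⟫ - c * ‖z‖ ^ 2 ≤ w (x + z)) : p = q := by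
  have : ∀ v, ⟪q, v⟫ ≤ ⟪p, v⟫ := by
    intro v
    apply ray_le (c := (1 + c + ‖A‖) * ‖v‖ ^ 2)
    filter_upwards [(tendsto_ray v).eventually h2, (tendsto_ray v).eventually (h 1 one_pos),
      self_mem_nhdsWithin] with t h3 h4 ht0
    have ht0 : 0 < t := ht0
    have h5 := abs_le.1 (abs_quad_le A (t • v))
    have h6 := abs_le.1 h4
    simp only [inner_smul_right, norm_smul, Real.norm_of_nonneg ht0.le] at h3 h6 h5
    have : ‖A‖ * (t * ‖v‖) ^ 2 ≥ 0 := by positivity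
    nlinarith
  have h3 := this (q - p)
  have : ⟪q - p, q - p⟫ ≤ 0 := by rw [inner_sub_left]; linarith
  rw [real_inner_self_eq_norm_sq] at this
  have : ‖q - p‖ = 0 := by nlinarith [norm_nonneg (q - p)]
  exact (sub_eq_zero.1 (norm_eq_zero.1 this)).symm

theorem Tay.neg {w : E → ℝ} {x p : E} {A : E →L[ℝ] E} (h : Tay w x p A) :
    Tay (fun z => - w z) x (-p) (-A) := by
  intro η hη
  filter_upwards [h η hη] with z hz
  rw [← abs_neg]
  convert hz using 2
  simp; ring

theorem Tay.first' {w : E → ℝ} {x p q : E} {A : E →L[ℝ] E} (h : Tay w x p A) {c : ℝ}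
    (h2 : ∀ᶠ z in nhds (0 : E), w (x + z) ≤ w x + ⟪q, z⟫ + c * ‖z‖ ^ 2) : p = q := by
  have := h.neg.first (q := -q) (c := c) (by
    filter_upwards [h2] with z hz
    simp; linarith)
  simpa using this

/-- second order comparison -/
theorem Tay.second {w : E → ℝ} {x p : E} {A B : E →L[ℝ] E} (h : Tay w x p A)
    (h2 : ∀ η > 0, ∀ᶠ z in nhds (0 : E), w x + ⟪p, z⟫ + 1 / 2 * ⟪B z, z⟫ - η * ‖z‖ ^ 2 ≤ w (x + z)) (z : E) :
    ⟪B z, z⟫ ≤ ⟪A z, z⟫ := by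
  have key : ∀ η > 0, ⟪B z, z⟫ ≤ ⟪A z, z⟫ + (4 * η) * ‖z‖ ^ 2 := by
    intro η hη
    apply quad_of_small
    filter_upwards [h2 η hη, h η hη] with z h3 h4
    have := abs_le.1 h4
    linarith
  apply le_of_forall_pos_le_add
  intro ε hε
  have := key (ε / (4 * (‖z‖ ^ 2 + 1))) (by positivity)
  refine this.trans ?_
  gcongr
  field_simp
  nlinarith [norm_nonneg z]

theorem Tay.second' {w : E → ℝ} {x p : E} {A B : E →L[ℝ] E} (h : Tay w x p A)
    (h2 : ∀ η > 0, ∀ᶠ z in nhds (0 : E), w (x + z) ≤ w x + ⟪p, z⟫ + 1 / 2 * ⟪B z, z⟫ + η * ‖z‖ ^ 2) (z : E) :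
    ⟪A z, z⟫ ≤ ⟪B z, z⟫ := by
  have := h.neg.second (B := -B) (fun η hη => by
    filter_upwards [h2 η hη] with z hz
    simp; linarith) z
  simpa using this

end Tay
end CE

namespace CE

section Growth
variable {E : Type*} [NormedAddCommGroup E] [InnerProductSpace ℝ E] [FiniteDimensional ℝ E]

theorem exists_min_on {k : E → ℝ} {s : Set E} (hs : IsClosed s) (hne : s.Nonempty)
    (hk : Continuous k) {a b : ℝ} (ha : 0 < a) (h : ∀ x ∈ s, a * ‖x‖ - b ≤ k x) :
    ∃ x ∈ s, ∀ y ∈ s, k x ≤ k y := by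
  have : ProperSpace E := FiniteDimensional.proper ℝ E
  obtain ⟨x₀, hx₀⟩ := hne
  have hc : ∀ᶠ x in cocompact E ⊓ Filter.principal s, k x₀ ≤ k x := by
    rw [Filter.eventually_inf_principal]
    have := (tendsto_norm_cocompact_atTop (E := E)).eventually (eventually_ge_atTop ((k x₀ + b) / a))
    filter_upwards [this] with x hx hxs
    have h1 := h x hxs
    rw [div_le_iff₀ ha] at hx
    linarith
  obtain ⟨x, hx, hmin⟩ := hk.continuousOn.exists_isMinOn' hs hx₀ hc
  exact ⟨x, hx, fun y hy => hmin hy⟩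

theorem exists_min {k : E → ℝ} (hk : Continuous k) {a b : ℝ} (ha : 0 < a)
    (h : ∀ x, a * ‖x‖ - b ≤ k x) : ∃ x, ∀ y, k x ≤ k y := by
  obtain ⟨x, -, hx⟩ := exists_min_on isClosed_univ Set.univ_nonempty hk ha (fun x _ => h x)
  exact ⟨x, fun y => hx y trivial⟩

theorem growth_of_tendsto {H ℓ u : E → ℝ} {R : ℝ} (hG : Gau H ℓ R) (hu : Continuous u)
    (h : Tendsto (fun x => u x / ℓ x) (cocompact E) (nhds 1)) (η : ℝ) (hη : 0 < η) :
    ∃ C, ∀ x, |u x - ℓ x| ≤ η * ℓ x + C := by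
  obtain ⟨c, hc, hlow⟩ := hG.lower
  have h1 : ∀ᶠ x in cocompact E, |u x / ℓ x - 1| < η := by
    have := Metric.tendsto_nhds.1 h η hη
    simpa [Real.dist_eq] using this
  obtain ⟨r, hr⟩ := (Filter.hasBasis_cocompact.eventually_iff).1 h1
  obtain ⟨hr1, hr2⟩ := hr
  obtain ⟨C, hC⟩ := ((hr1.insert 0).image (f := fun x => |u x - ℓ x|)
    ((hu.sub (hG.kl_cont hG.kl_self)).abs)).bddAbove
  refine ⟨max C 0, fun x => ?_⟩
  have hn := hG.nonneg x
  by_cases hx : x ∈ insert 0 r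
  · have := hC (Set.mem_image_of_mem _ hx)
    have h2 := le_max_left C 0
    have : 0 ≤ η * ℓ x := by positivity
    linarith
  · rcases hn.eq_or_lt with h0 | h0
    · have hx0 : x = 0 := by
        have := hlow x
        rw [← h0] at this
        have : ‖x‖ ≤ 0 := by nlinarith [norm_nonneg x]
        exact norm_le_zero_iff.1 this
      exact absurd (Set.mem_insert_iff.2 (Or.inl hx0)) hx
    · have h3 := hr2 (fun h => hx (Set.mem_insert_of_mem _ h))
      have : |u x - ℓ x| = |u x / ℓ x - 1| * ℓ x := by
        rw [← abs_of_pos h0, ← abs_mul, abs_of_pos h0]; congr 1; field_simp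
      rw [this]
      have := le_max_right C 0
      nlinarith

theorem kl_of_sub {H ℓ u : E → ℝ} {R : ℝ} (hG : Gau H ℓ R) (hu : Continuous u)
    (hgr : ∀ η > 0, ∃ C, ∀ x, u x ≤ (1 + η) * ℓ x + C)
    (hT : ∀ x p A, Sy A → TA u x p A → H p ≤ 0) : KL ℓ u := by
  intro x v
  by_cases hv : v = 0
  · subst hv; simp [hG.nonneg]
  have hv0 : 0 < ‖v‖ := norm_pos_iff.2 hv
  apply le_of_forall_pos_le_add
  intro δ hδ
  have hlv := hG.nonneg v
  have hR := hG.R0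
  obtain ⟨η, hη, hη1, hη2⟩ : ∃ η > 0, η ≤ 1 ∧ η * ℓ v ≤ δ / 4 := by
    refine ⟨min 1 (δ / (4 * (ℓ v + 1))), by positivity, min_le_left _ _, ?_⟩
    calc min 1 (δ / (4 * (ℓ v + 1))) * ℓ v ≤ δ / (4 * (ℓ v + 1)) * ℓ v := by
          gcongr; exact min_le_right _ _
      _ ≤ δ / 4 := by field_simp; nlinarith
  obtain ⟨C, hC⟩ := hgr η hη
  set a := ℓ v + δ / 2 with ha
  -- choose A
  obtain ⟨r, hr, hur⟩ : ∃ r > 0, ∀ z : E, ‖z‖ ≤ r → u (x + z) ≤ u x + δ / 2 := by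
    have hc : Continuous fun z => u (x + z) := hu.comp (by fun_prop)
    have : ∀ᶠ z in nhds (0:E), u (x + z) < u x + δ / 2 := by
      refine hc.continuousAt.eventually_lt_const ?_
      simp; linarith
    obtain ⟨r, hr, h⟩ := Metric.eventually_nhds_iff_ball.1 this
    exact ⟨r / 2, by positivity, fun z hz => (h z (by simp; linarith)).le⟩
  set D := |C| + 2 * ℓ x + |u x| with hD
  have hD0 : 0 ≤ D := by have := hG.nonneg x; positivity
  set A := D / r ^ 2 + 2 * R / r + 1 with hA
  have hA0 : 0 < A := by positivity
  have hub : ∀ (t : ℝ) (z : E), 0 ≤ t → u (x + (t • v + z)) ≤ D - |u x| + t * (ℓ v + δ / 4) + 2 * R * ‖z‖ := by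
    intro t z ht
    have h1 := hC (x + (t • v + z))
    have h2 := hG.subadd x (t • v + z)
    have h3 := hG.subadd (t • v) z
    have h4 := hG.smul_le ht v
    have h5 := hG.le z
    have h6 : (1 + η) * ℓ (x + (t • v + z)) ≤ (1 + η) * (ℓ x + (t * ℓ v + R * ‖z‖)) := by
      gcongr; linarith
    have h7 : (1 + η) * ℓ x ≤ 2 * ℓ x := by have := hG.nonneg x; nlinarith
    have h8 : (1 + η) * (R * ‖z‖) ≤ 2 * (R * ‖z‖) := by gcongr; linarith
    have h9 : t * (η * ℓ v) ≤ t * (δ / 4) := by gcongr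
    have := le_abs_self C
    rw [hD]
    nlinarith
  have hbig : ∀ z : E, u (x + z) - A * ‖z‖ ^ 2 ≤ u x + δ / 2 := by
    intro z
    by_cases hz : ‖z‖ ≤ r
    · have := hur z hz
      have : 0 ≤ A * ‖z‖ ^ 2 := by positivity
      linarith
    · push Not at hz
      have h1 := hub 0 z le_rfl
      simp only [zero_smul, zero_add, zero_mul, add_zero] at h1
      have h2 : D ≤ D / r ^ 2 * ‖z‖ ^ 2 := by
        calc D = D / r ^ 2 * r ^ 2 := by field_simp
          _ ≤ _ := by gcongr
      have h3 : 2 * R * ‖z‖ ≤ 2 * R / r * ‖z‖ ^ 2 := by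
        calc 2 * R * ‖z‖ = 2 * R / r * (r * ‖z‖) := by field_simp
          _ ≤ 2 * R / r * (‖z‖ * ‖z‖) := by gcongr
          _ = _ := by ring
      have h4 : A * ‖z‖ ^ 2 = D / r ^ 2 * ‖z‖ ^ 2 + 2 * R / r * ‖z‖ ^ 2 + ‖z‖ ^ 2 := by rw [hA]; ring
      have h5 := neg_abs_le (u x)
      have : 0 ≤ ‖z‖ ^ 2 := by positivity
      have := abs_nonneg (u x)
      linarith
  -- the test function
  set k : E → ℝ := fun w => a * (⟪w, v⟫ / ‖v‖ ^ 2) + A * (‖w‖ ^ 2 - ⟪w, v⟫ ^ 2 / ‖v‖ ^ 2) - u (x + w) with hk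
  have hkc : Continuous k := by
    have : Continuous fun z => u (x + z) := hu.comp (by fun_prop)
    simp only [hk]; fun_prop
  have hdec : ∀ w : E, ∃ z : E, w = (⟪w, v⟫ / ‖v‖ ^ 2) • v + z ∧ ‖z‖ ^ 2 = ‖w‖ ^ 2 - ⟪w, v⟫ ^ 2 / ‖v‖ ^ 2 := by
    intro w
    refine ⟨w - (⟪w, v⟫ / ‖v‖ ^ 2) • v, by abel, ?_⟩
    rw [@norm_sub_sq_real, inner_smul_right, norm_smul, mul_pow, Real.norm_eq_abs, sq_abs]
    field_simp
    ring
  obtain ⟨w0, hw0s, hw0⟩ := exists_min_on (k := k) (s := {w | 0 ≤ ⟪w, v⟫})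
    (isClosed_le continuous_const (by fun_prop)) ⟨0, by simp⟩ hkc
    (a := min (δ / (4 * ‖v‖)) 1) (b := D + (2 * R + 1) ^ 2 / A) (by positivity) (by
      intro w hw
      have hw : 0 ≤ ⟪w, v⟫ := hw
      obtain ⟨z, hz1, hz2⟩ := hdec w
      set t := ⟪w, v⟫ / ‖v‖ ^ 2 with ht
      have ht0 : 0 ≤ t := by positivity
      have h1 := hub t z ht0
      rw [← hz1] at h1
      simp only [hk, ← hz2]
      rw [← ht]
      have h2 : ‖w‖ ≤ t * ‖v‖ + ‖z‖ := by
        calc ‖w‖ = ‖t • v + z‖ := by rw [← hz1]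
          _ ≤ ‖t • v‖ + ‖z‖ := norm_add_le _ _
          _ = _ := by rw [norm_smul, Real.norm_of_nonneg ht0]
      have h3 : min (δ / (4 * ‖v‖)) 1 * ‖w‖ ≤ t * (δ / 4) + ‖z‖ := by
        calc min (δ / (4 * ‖v‖)) 1 * ‖w‖ ≤ min (δ / (4 * ‖v‖)) 1 * (t * ‖v‖ + ‖z‖) := by gcongr
          _ = min (δ / (4 * ‖v‖)) 1 * (t * ‖v‖) + min (δ / (4 * ‖v‖)) 1 * ‖z‖ := by ring
          _ ≤ (δ / (4 * ‖v‖)) * (t * ‖v‖) + 1 * ‖z‖ := by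
              gcongr
              · exact min_le_left _ _
              · exact min_le_right _ _
          _ = _ := by field_simp
      have h4 : (2 * R + 1) * ‖z‖ ≤ A * ‖z‖ ^ 2 + (2 * R + 1) ^ 2 / A := by
        have : 0 ≤ (A * ‖z‖ - (2 * R + 1)) ^ 2 / A + (2 * R + 1) * ‖z‖ := by positivity
        have h5 : (A * ‖z‖ - (2 * R + 1)) ^ 2 / A = A * ‖z‖ ^ 2 - 2 * (2 * R + 1) * ‖z‖ + (2 * R + 1) ^ 2 / A := by
          field_simp; ring
        linarith
      have := abs_nonneg (u x)
      rw [ha]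
      nlinarith)
  have hw0s : 0 ≤ ⟪w0, v⟫ := hw0s
  have hzero : ⟪w0, v⟫ = 0 := by
    by_contra hne
    have hpos : 0 < ⟪w0, v⟫ := lt_of_le_of_ne hw0s (Ne.symm hne)
    set p : E := (a / ‖v‖ ^ 2) • v + (2 * A) • (w0 - (⟪w0, v⟫ / ‖v‖ ^ 2) • v) with hp
    have hTA : TA u (x + w0) p ((2 * A) • ContinuousLinearMap.id ℝ E) := by
      have : ∀ᶠ z in nhds (0:E), 0 < ⟪w0 + z, v⟫ := by
        have hc : Continuous fun z : E => ⟪w0 + z, v⟫ := by fun_prop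
        exact hc.continuousAt.eventually_const_lt (by simpa using hpos)
      filter_upwards [this] with z hz
      have h1 := hw0 (w0 + z) hz.le
      simp only [hk] at h1
      have h2 : ‖w0 + z‖ ^ 2 = ‖w0‖ ^ 2 + 2 * ⟪w0, z⟫ + ‖z‖ ^ 2 := norm_add_sq_real _ _
      rw [h2, inner_add_left, ← add_assoc] at h1
      have h3 : ⟪p, z⟫ = a * (⟪z, v⟫ / ‖v‖ ^ 2) + 2 * A * (⟪w0, z⟫ - ⟪w0, v⟫ * ⟪z, v⟫ / ‖v‖ ^ 2) := by
        rw [hp, inner_add_left, real_inner_smul_left, real_inner_smul_left, inner_sub_left,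
          real_inner_smul_left, real_inner_comm z v]
        ring
      have h4 : 0 ≤ A * (⟪z, v⟫ ^ 2 / ‖v‖ ^ 2) := by positivity
      rw [h3]
      simp only [smul_apply, ContinuousLinearMap.id_apply, real_inner_smul_left,
        real_inner_self_eq_norm_sq]
      have h5 : a * ((⟪w0, v⟫ + ⟪z, v⟫) / ‖v‖ ^ 2) = a * (⟪w0, v⟫ / ‖v‖ ^ 2) + a * (⟪z, v⟫ / ‖v‖ ^ 2) := by ring
      have h6 : A * (‖w0‖ ^ 2 + 2 * ⟪w0, z⟫ + ‖z‖ ^ 2 - (⟪w0, v⟫ + ⟪z, v⟫) ^ 2 / ‖v‖ ^ 2) =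
         A * (‖w0‖ ^ 2 - ⟪w0, v⟫ ^ 2 / ‖v‖ ^ 2) + 2 * A * (⟪w0, z⟫ - ⟪w0, v⟫ * ⟪z, v⟫ / ‖v‖ ^ 2) + A * ‖z‖ ^ 2
          - A * (⟪z, v⟫ ^ 2 / ‖v‖ ^ 2) := by ring
      linarith
    have h1 := hG.ge (hT _ _ _ (Sy.id.smul _) hTA) v
    have h2 : ⟪p, v⟫ = a := by
      rw [hp, inner_add_left, real_inner_smul_left, real_inner_smul_left, inner_sub_left,
          real_inner_smul_left, real_inner_self_eq_norm_sq]
      field_simp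
      ring
    rw [h2, ha] at h1
    linarith
  have h1 := hw0 v (by simp)
  simp only [hk, hzero] at h1
  rw [real_inner_self_eq_norm_sq] at h1
  have h2 : ‖v‖ ^ 2 / ‖v‖ ^ 2 = 1 := by field_simp
  have h3 : (‖v‖ ^ 2) ^ 2 / ‖v‖ ^ 2 = ‖v‖ ^ 2 := by field_simp
  rw [h2, h3] at h1
  have h4 := hbig w0
  simp at h1
  rw [ha] at h1
  linarith

theorem lower_growth {F : (E →L[ℝ] E) → ℝ} {θ CF : ℝ} (hF : EllF F θ CF) {H ℓ u g : E → ℝ} {R : ℝ}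
    (hG : Gau H ℓ R) (hu : Continuous u)
    (hgr : ∀ η > 0, ∃ C, ∀ x, (1 - η) * ℓ x - C ≤ u x)
    (hS : Sup F H g u) {r : ℝ} (hr : ∀ x, g x ≤ 0 → ‖x‖ ≤ r) : ∃ C, ∀ x, ℓ x - C ≤ u x := by
  have : ProperSpace E := FiniteDimensional.proper ℝ E
  obtain ⟨c, hc, hlow⟩ := hG.lower
  obtain ⟨C1, hC1⟩ := ((isCompact_closedBall (0:E) r).image (f := fun x => |u x|) hu.abs).bddAbove
  refine ⟨C1 + R * r, fun y => ?_⟩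
  have key : ∀ ρ : ℝ, 0 ≤ ρ → ρ < 1 → ρ * ℓ y - (C1 + R * r) ≤ u y := by
    intro ρ h0 h1
    obtain ⟨C, hC⟩ := hgr ((1 - ρ) / 2) (by linarith)
    obtain ⟨x, hx⟩ := exists_min (k := fun x => u x - ρ * ℓ x)
      (hu.sub (continuous_const.mul (hG.kl_cont hG.kl_self))) (a := (1 - ρ) / 2 * c) (b := C)
      (mul_pos (by linarith) hc) (fun x => by
        have h2 := hC x
        have h3 := mul_le_mul_of_nonneg_left (hlow x) (show 0 ≤ (1 - ρ) / 2 by linarith)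
        nlinarith)
    obtain ⟨p, hp, hpx⟩ := hG.att x
    have h2 : g x ≤ F 0 := hS x (ρ • p) 0 Sy.zero (Eventually.of_forall fun z => by
      have h3 := hx (x + z)
      have h4 := hG.ge hp (x + z)
      rw [inner_add_right, hpx] at h4
      simp only [real_inner_smul_left, zero_apply, inner_zero_left] at h3 ⊢
      nlinarith) (by
      have := hG.scale hp h0 h1.le
      have := hG.neg0
      nlinarith)
    rw [hF.zero] at h2
    have h3 := hr x h2
    have h4 := hx y
    have h5 := hC1 (Set.mem_image_of_mem _ (show x ∈ Metric.closedBall (0:E) r by simpa using h3))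
    have h6 := (abs_le.1 h5).1
    have h7 := hG.le x
    have h8 : R * ‖x‖ ≤ R * r := by gcongr; exact hG.R0.le
    have h9 := hG.nonneg x
    nlinarith
  have hl : Tendsto (fun ρ : ℝ => ρ * ℓ y - (C1 + R * r)) (nhdsWithin 1 (Set.Iio 1)) (nhds (1 * ℓ y - (C1 + R * r))) := by
    have : Continuous fun ρ : ℝ => ρ * ℓ y - (C1 + R * r) := by fun_prop
    exact (this.tendsto 1).mono_left nhdsWithin_le_nhds
  rw [one_mul] at hl
  refine le_of_tendsto hl ?_
  filter_upwards [Ioo_mem_nhdsLT (show (0:ℝ) < 1 by norm_num)] with ρ hρ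
  exact key ρ hρ.1.le hρ.2

end Growth
end CE

namespace CE

section Reg
variable {E : Type*} [NormedAddCommGroup E] [InnerProductSpace ℝ E]

theorem infconv [FiniteDimensional ℝ E] {w : E → ℝ} {R c : ℝ} (hw : ∀ x y, w x - w y ≤ R * ‖x - y‖)
    (hR : 0 < R) (hc : 0 < c) :
    ∃ (q : E → ℝ) (Z : E → E), (∀ y, q y = w (Z y) + c * ‖y - Z y‖ ^ 2) ∧
      ∀ y z, q y ≤ w z + c * ‖y - z‖ ^ 2 := by
  have hwc : Continuous w := by
    have : LipschitzWith R.toNNReal w := LipschitzWith.of_dist_le_mul fun x y => by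
      rw [Real.dist_eq, dist_eq_norm, Real.coe_toNNReal _ hR.le, abs_le]
      have h1 := hw x y
      have h2 := hw y x
      rw [norm_sub_rev] at h2
      constructor <;> linarith
    exact this.continuous
  have : ∀ y, ∃ z, ∀ z', w z + c * ‖y - z‖ ^ 2 ≤ w z' + c * ‖y - z'‖ ^ 2 := by
    intro y
    refine exists_min (k := fun z => w z + c * ‖y - z‖ ^ 2) (by fun_prop) (a := 1)
      (b := ‖y‖ + (R + 1) ^ 2 / c - w y) one_pos fun z => ?_
    have h1 := hw y z
    have h2 : ‖z‖ ≤ ‖y‖ + ‖y - z‖ := by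
      have := norm_sub_le y (y - z)
      simpa using this
    have h4 : (R + 1) * ‖y - z‖ ≤ c * ‖y - z‖ ^ 2 + (R + 1) ^ 2 / c := by
      have : 0 ≤ (c * ‖y - z‖ - (R + 1)) ^ 2 / c + (R + 1) * ‖y - z‖ := by positivity
      have h5 : (c * ‖y - z‖ - (R + 1)) ^ 2 / c = c * ‖y - z‖ ^ 2 - 2 * (R + 1) * ‖y - z‖ + (R + 1) ^ 2 / c := by
        field_simp; ring
      linarith
    linarith
  choose Z hZ using this
  exact ⟨fun y => w (Z y) + c * ‖y - Z y‖ ^ 2, Z, fun y => rfl, fun y z => hZ y z⟩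

theorem cs_ineq (a b : E) {ε δ : ℝ} (hε : 0 < ε) (hδ : 0 < δ) :
    1 / (2 * (ε + δ)) * ‖a + b‖ ^ 2 ≤ 1 / (2 * ε) * ‖a‖ ^ 2 + 1 / (2 * δ) * ‖b‖ ^ 2 := by
  have h : 0 ≤ ‖δ • a - ε • b‖ ^ 2 := by positivity
  rw [@norm_sub_sq_real, real_inner_smul_left, real_inner_smul_right, norm_smul, norm_smul,
    Real.norm_of_nonneg hε.le, Real.norm_of_nonneg hδ.le] at h
  rw [@norm_add_sq_real]
  have : 1 / (2 * ε) * ‖a‖ ^ 2 + 1 / (2 * δ) * ‖b‖ ^ 2 - 1 / (2 * (ε + δ)) * (‖a‖ ^ 2 + 2 * ⟪a, b⟫ + ‖b‖ ^ 2)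
    = ((δ * ‖a‖) ^ 2 - 2 * (δ * (ε * ⟪a, b⟫)) + (ε * ‖b‖) ^ 2) / (2 * ε * δ * (ε + δ)) := by
    field_simp; ring
  have h2 : 0 ≤ ((δ * ‖a‖) ^ 2 - 2 * (δ * (ε * ⟪a, b⟫)) + (ε * ‖b‖) ^ 2) / (2 * ε * δ * (ε + δ)) := by
    positivity
  linarith

theorem fderiv_of_quad {G : E → ℝ} {P : E → E} {C : ℝ}
    (h : ∀ x h, |G (x + h) - G x - ⟪P x, h⟫| ≤ C * ‖h‖ ^ 2) (x : E) : HasFDerivAt G (J (P x)) x := by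
  rw [hasFDerivAt_iff_isLittleO_nhds_zero]
  have h1 : (fun z => G (x + z) - G x - J (P x) z) =O[nhds 0] fun z => ‖z‖ ^ 2 := by
    refine Asymptotics.IsBigO.of_bound C (Eventually.of_forall fun z => ?_)
    rw [J_apply]
    simpa using h x z
  refine h1.trans_isLittleO ?_
  have : (fun z : E => ‖z‖ ^ 2) =o[nhds 0] fun z : E => ‖z‖ ^ 1 := by
    have h2 : (fun t : ℝ => t ^ 2) =o[nhds 0] fun t : ℝ => t ^ 1 := Asymptotics.isLittleO_pow_pow (by norm_num)
    exact h2.comp_tendsto (k := fun z : E => ‖z‖) (by simpa using (continuous_norm (E := E)).tendsto 0)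
  simp only [pow_one] at this
  exact this.of_norm_right

theorem lip_of_quad {G : E → ℝ} {P : E → E} {C : ℝ}
    (h : ∀ x h, |G (x + h) - G x - ⟪P x, h⟫| ≤ C * ‖h‖ ^ 2) (hC : 0 ≤ C) (x y : E) :
    ‖P y - P x‖ ≤ 6 * C * ‖y - x‖ := by
  by_cases hz : P y - P x = 0
  · rw [hz]; simp; positivity
  set d := y - x with hd
  by_cases hd0 : d = 0
  · rw [sub_eq_zero.1 hd0] at hz; simp at hz
  have hd1 : 0 < ‖d‖ := norm_pos_iff.2 hd0
  have hz1 : 0 < ‖P y - P x‖ := norm_pos_iff.2 hz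
  set k : E := (‖d‖ / ‖P y - P x‖) • (P y - P x) with hk
  have hkn : ‖k‖ = ‖d‖ := by
    rw [hk, norm_smul, Real.norm_of_nonneg (by positivity)]; field_simp
  have h1 := abs_le.1 (h x (d + k))
  have h2 := abs_le.1 (h y k)
  have h3 := abs_le.1 (h x d)
  have e1 : x + (d + k) = y + k := by rw [hd]; abel
  have e2 : x + d = y := by rw [hd]; abel
  rw [e1] at h1
  rw [e2] at h3
  have h4 : ‖d + k‖ ≤ 2 * ‖d‖ := (norm_add_le _ _).trans (by linarith)
  have h5 : ‖d + k‖ ^ 2 ≤ (2 * ‖d‖) ^ 2 := by gcongr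
  have h6 : ⟪P y - P x, k⟫ = ‖d‖ * ‖P y - P x‖ := by
    rw [hk, inner_smul_right, real_inner_self_eq_norm_sq]; field_simp
  rw [inner_add_right] at h1
  rw [inner_sub_left] at h6
  have h7 : C * ‖d + k‖ ^ 2 ≤ C * (2 * ‖d‖) ^ 2 := by gcongr
  rw [hkn] at h2
  have : ‖d‖ * ‖P y - P x‖ ≤ ‖d‖ * (6 * C * ‖d‖) := by nlinarith
  exact le_of_mul_le_mul_left this hd1

theorem reg [FiniteDimensional ℝ E] {F : (E →L[ℝ] E) → ℝ} {θ CF : ℝ} (hF : EllF F θ CF) {H ℓ w g : E → ℝ} {R : ℝ}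
    (hG : Gau H ℓ R) (hw : KL ℓ w) (hS : Sup F H g w) {ε δ : ℝ} (hε : 0 < ε) (hδ : 0 < δ) :
    ∃ (G : E → ℝ) (P : E → E), KL ℓ G ∧ (∀ x, G x ≤ w x ∧ w x - R ^ 2 * (ε + δ) / 2 ≤ G x) ∧
      (∀ x h, |G (x + h) - G x - ⟪P x, h⟫| ≤ (1 / ε + 1 / (2 * δ)) * ‖h‖ ^ 2) ∧
      ∀ x A, Sy A → Tay G x (P x) A → H (P x) < 0 →
        (∃ z, ‖x - z‖ ≤ 2 * ε * R ∧ g z ≤ F A) ∨ -CF * (1 / ε) + θ * (1 / δ) ≤ F A := by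
  have hR := hG.R0
  have hwl : ∀ x y, w x - w y ≤ R * ‖x - y‖ := fun x y => (le_abs_self _).trans (hG.kl_abs hw x y)
  obtain ⟨q, Z, hq, hq'⟩ := infconv hwl hR (show 0 < 1 / (2 * (ε + δ)) by positivity)
  have hqK : KL ℓ q := by
    intro x v
    have h1 := hq' (x + v) (Z x + v)
    rw [add_sub_add_right_eq_sub] at h1
    have h2 := hw (Z x) v
    rw [hq x]; linarith
  have hql : ∀ x y, -q x - -q y ≤ R * ‖x - y‖ := fun x y => by
    have := (le_abs_self _).trans (hG.kl_abs hqK y x)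
    rw [norm_sub_rev] at this
    linarith
  obtain ⟨G', Y, hY, hY'⟩ := infconv hql hR (show 0 < 1 / (2 * δ) by positivity)
  set G : E → ℝ := fun x => - G' x with hGdef
  have hg1 : ∀ x, G x = q (Y x) - 1 / (2 * δ) * ‖x - Y x‖ ^ 2 := fun x => by
    simp only [hGdef]; rw [hY]; ring
  have hg2 : ∀ x y, q y - 1 / (2 * δ) * ‖x - y‖ ^ 2 ≤ G x := fun x y => by
    have := hY' x y
    simp only [hGdef]; linarith
  set P : E → E := fun x => (1 / δ) • (Y x - x) with hP
  have hGK : KL ℓ G := by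
    intro x v
    have h1 := hg2 x (Y (x + v) - v)
    have e : x - (Y (x + v) - v) = x + v - Y (x + v) := by abel
    rw [e] at h1
    have h2 := hqK (Y (x + v) - v) v
    rw [sub_add_cancel] at h2
    have h3 := hg1 (x + v)
    linarith
  have hii : ∀ x z, G x ≤ w z + 1 / (2 * ε) * ‖x - z‖ ^ 2 := by
    intro x z
    have h1 := hg1 x
    have h2 := hq' (Y x) z
    have h3 := cs_ineq (x - z) (Y x - x) hε hδ
    have e : x - z + (Y x - x) = Y x - z := by abel
    rw [e, norm_sub_rev (Y x) x] at h3
    linarith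
  have hiv : ∀ x h, G x + ⟪P x, h⟫ - 1 / (2 * δ) * ‖h‖ ^ 2 ≤ G (x + h) := by
    intro x h
    have h1 := hg1 x
    have h2 := hg2 (x + h) (Y x)
    have e : x + h - Y x = (x - Y x) + h := by abel
    rw [e, @norm_add_sq_real] at h2
    have e2 : ⟪P x, h⟫ = - (1 / δ * ⟪x - Y x, h⟫) := by
      rw [hP, real_inner_smul_left, ← neg_sub, inner_neg_left]; ring
    rw [e2]
    have e3 : 1 / (2 * δ) * (‖x - Y x‖ ^ 2 + 2 * ⟪x - Y x, h⟫ + ‖h‖ ^ 2)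
      = 1 / (2 * δ) * ‖x - Y x‖ ^ 2 + 1 / δ * ⟪x - Y x, h⟫ + 1 / (2 * δ) * ‖h‖ ^ 2 := by
      field_simp
    linarith
  have hv : ∀ x h, G (x + h) + G (x - h) - 2 * G x ≤ 1 / ε * ‖h‖ ^ 2 := by
    intro x h
    set y0 := (1 / 2 : ℝ) • (Y (x + h) + Y (x - h)) with hy0
    set k := (1 / 2 : ℝ) • (Y (x + h) - Y (x - h)) with hk
    have ep : Y (x + h) = y0 + k := by rw [hy0, hk]; module
    have em : Y (x - h) = y0 - k := by rw [hy0, hk]; module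
    have h1 := hg1 (x + h)
    have h2 := hg1 (x - h)
    have h3 := hg2 x y0
    have h4 := hq' (y0 + k) (Z y0)
    have h5 := hq' (y0 - k) (Z y0)
    have h6 := hq y0
    rw [ep] at h1
    rw [em] at h2
    have e1 : x + h - (y0 + k) = (x - y0) + (h - k) := by abel
    have e2 : x - h - (y0 - k) = (x - y0) - (h - k) := by abel
    have e3 : y0 + k - Z y0 = (y0 - Z y0) + k := by abel
    have e4 : y0 - k - Z y0 = (y0 - Z y0) - k := by abel
    rw [e1, @norm_add_sq_real] at h1
    rw [e2, @norm_sub_sq_real] at h2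
    rw [e3, @norm_add_sq_real] at h4
    rw [e4, @norm_sub_sq_real] at h5
    have h7 := cs_ineq h (k - h) hε hδ
    rw [add_sub_cancel, norm_sub_rev] at h7
    have e5 : 1 / ε * ‖h‖ ^ 2 = 2 * (1 / (2 * ε) * ‖h‖ ^ 2) := by field_simp
    rw [e5]
    linarith
  have hquad : ∀ x h, |G (x + h) - G x - ⟪P x, h⟫| ≤ (1 / ε + 1 / (2 * δ)) * ‖h‖ ^ 2 := by
    intro x h
    have h1 := hiv x h
    have h2 := hiv x (-h)
    have h3 := hv x h
    rw [inner_neg_right, norm_neg, ← sub_eq_add_neg x h] at h2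
    have h4 : 0 ≤ 1 / ε * ‖h‖ ^ 2 := by positivity
    rw [abs_le, add_mul]
    constructor <;> linarith
  refine ⟨G, P, hGK, fun x => ⟨?_, ?_⟩, hquad, ?_⟩
  · have := hii x x
    simpa using this
  · have h1 := hg2 x x
    have h2 := hq x
    have h3 := hwl x (Z x)
    simp only [sub_self, norm_zero] at h1
    have h4 : R * ‖x - Z x‖ ≤ 1 / (2 * (ε + δ)) * ‖x - Z x‖ ^ 2 + R ^ 2 * (ε + δ) / 2 := by
      have : 0 ≤ (‖x - Z x‖ - R * (ε + δ)) ^ 2 / (2 * (ε + δ)) := by positivity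
      have h5 : (‖x - Z x‖ - R * (ε + δ)) ^ 2 / (2 * (ε + δ)) =
        1 / (2 * (ε + δ)) * ‖x - Z x‖ ^ 2 - R * ‖x - Z x‖ + R ^ 2 * (ε + δ) / 2 := by
        field_simp; ring
      linarith
    norm_num at h1
    linarith
  · intro x A hA hT hHP
    set z := Z (Y x) with hz
    have hgx : G x = w z + 1 / (2 * (ε + δ)) * ‖Y x - z‖ ^ 2 - 1 / (2 * δ) * ‖x - Y x‖ ^ 2 := by
      rw [hg1 x, hq (Y x)]
    set v : E := (1 / (ε + δ)) • (ε • (Y x - x) + δ • (z - x)) with hvdef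
    by_cases hv0 : v = 0
    · left
      have h0 : ε • (Y x - x) + δ • (z - x) = 0 := by
        rw [hvdef, smul_eq_zero] at hv0
        rcases hv0 with h | h
        · exact absurd h (by positivity)
        · exact h
      have e1 : Y x - x = (δ / ε) • (x - z) := by
        have : ε • (Y x - x) = δ • (x - z) := by
          rw [← sub_eq_zero, ← h0]; module
        rw [div_eq_inv_mul, mul_smul, ← this, smul_smul, inv_mul_cancel₀ hε.ne', one_smul]
      have e2 : Y x - z = ((ε + δ) / ε) • (x - z) := by
        have : Y x - z = (Y x - x) + (x - z) := by abel
        rw [this, e1, add_div, div_self hε.ne', add_smul, one_smul, add_comm]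
      have hnb : ‖Y x - z‖ ≤ 2 * (ε + δ) * R := by
        have h1 := hq (Y x)
        have h2 := hq' (Y x) (Y x)
        have h3 := hwl (Y x) z
        simp only [sub_self, norm_zero] at h2
        norm_num at h2
        rw [← hz] at h1
        by_contra hcon
        push Not at hcon
        have hpos : 0 < ‖Y x - z‖ := lt_of_le_of_lt (by positivity) hcon
        have : R * ‖Y x - z‖ < 1 / (2 * (ε + δ)) * ‖Y x - z‖ ^ 2 := by
          rw [div_mul_eq_mul_div, lt_div_iff₀ (by positivity)]
          nlinarith
        linarith
      refine ⟨z, ?_, ?_⟩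
      · rw [e2, norm_smul, Real.norm_of_nonneg (by positivity)] at hnb
        have : (ε + δ) / ε * ‖x - z‖ ≤ (ε + δ) / ε * (2 * ε * R) := by
          refine hnb.trans (le_of_eq ?_)
          field_simp
        exact le_of_mul_le_mul_left this (by positivity)
      · have hgx' : G x = w z + 1 / (2 * ε) * ‖x - z‖ ^ 2 := by
          rw [hgx, e2, norm_sub_rev x (Y x), e1, norm_smul, norm_smul, Real.norm_of_nonneg (by positivity),
            Real.norm_of_nonneg (by positivity)]
          field_simp
          ring
        refine hS.jet hF hA (fun η hη => ?_) hHP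
        filter_upwards [hT η hη] with h hh
        have h1 := hii (x + h) (z + h)
        rw [add_sub_add_right_eq_sub] at h1
        have h2 := (abs_le.1 hh).1
        linarith
    · right
      have hA1 : ∀ h, ⟪A h, h⟫ ≤ 1 / ε * ‖h‖ ^ 2 := by
        intro h
        have key : ∀ η > 0, ⟪A h, h⟫ ≤ ⟪((1 / ε) • ContinuousLinearMap.id ℝ E) h, h⟫ + (2 * η) * ‖h‖ ^ 2 := by
          intro η hη
          apply quad_of_small
          have ht : Tendsto (fun z : E => -z) (nhds 0) (nhds 0) := by
            simpa using (continuous_neg (G := E)).tendsto 0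
          filter_upwards [hT η hη, ht.eventually (hT η hη)] with h h1 h2
          have h3 := (abs_le.1 h1).1
          have h4 := (abs_le.1 h2).1
          simp only [map_neg, inner_neg_left, inner_neg_right, neg_neg, norm_neg, ← sub_eq_add_neg] at h4
          have h5 := hv x h
          simp only [smul_apply, ContinuousLinearMap.id_apply, real_inner_smul_left,
            real_inner_self_eq_norm_sq]
          linarith
        apply le_of_forall_pos_le_add
        intro ε' hε'
        have := key (ε' / (2 * (‖h‖ ^ 2 + 1))) (by positivity)
        simp only [smul_apply, ContinuousLinearMap.id_apply, real_inner_smul_left,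
            real_inner_self_eq_norm_sq] at this
        refine this.trans ?_
        gcongr
        field_simp
        nlinarith [norm_nonneg h]
      refine hF.neg A hA (1 / ε) (1 / δ) (by positivity) hA1 v hv0 ?_
      have hvn : 0 < ‖v‖ := norm_pos_iff.2 hv0
      -- G at x + v
      have e1 : x + v - z = (ε / (ε + δ)) • (Y x - z) := by
        rw [hvdef]
        have h1 : (ε + δ) ≠ 0 := by positivity
        have : x - z = (1 / (ε + δ)) • ((ε + δ) • (x - z)) := by
          rw [smul_smul, one_div, inv_mul_cancel₀ h1, one_smul]
        have h2 : x + (1 / (ε + δ)) • (ε • (Y x - x) + δ • (z - x)) - z =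
          (x - z) + (1 / (ε + δ)) • (ε • (Y x - x) + δ • (z - x)) := by abel
        rw [h2, this, ← smul_add, div_eq_mul_one_div ε, mul_comm ε, mul_smul]
        congr 1
        module
      have e2 : x + v - Y x = (-(δ / (ε + δ))) • (Y x - z) := by
        have h1 : (ε + δ) ≠ 0 := by positivity
        have h2 : x + v - Y x = (x + v - z) - (1 : ℝ) • (Y x - z) := by module
        have h3 : (-(δ / (ε + δ))) = ε / (ε + δ) - 1 := by field_simp; ring
        rw [h2, e1, h3, sub_smul]
      have hGv : G (x + v) ≤ G x + ⟪P x, v⟫ - 1 / (2 * δ) * ‖v‖ ^ 2 := by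
        have h1 := hii (x + v) z
        have h2 : w z + 1 / (2 * ε) * ‖x + v - z‖ ^ 2 =
          w z + 1 / (2 * (ε + δ)) * ‖Y x - z‖ ^ 2 - 1 / (2 * δ) * ‖x + v - Y x‖ ^ 2 := by
          rw [e1, e2, norm_smul, norm_smul, norm_neg, Real.norm_of_nonneg (by positivity),
            Real.norm_of_nonneg (by positivity)]
          field_simp
          ring
        rw [h2] at h1
        have e : x + v - Y x = (x - Y x) + v := by abel
        rw [e, @norm_add_sq_real] at h1
        have e2 : ⟪P x, v⟫ = - (1 / δ * ⟪x - Y x, v⟫) := by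
          rw [hP, real_inner_smul_left, ← neg_sub, inner_neg_left]; ring
        rw [e2, hgx]
        have e3 : 1 / (2 * δ) * (‖x - Y x‖ ^ 2 + 2 * ⟪x - Y x, v⟫ + ‖v‖ ^ 2)
          = 1 / (2 * δ) * ‖x - Y x‖ ^ 2 + 1 / δ * ⟪x - Y x, v⟫ + 1 / (2 * δ) * ‖v‖ ^ 2 := by
          field_simp
        linarith
      have hray : ∀ s : ℝ, 0 ≤ s → s ≤ 1 → G (x + s • v) ≤ G x + s * ⟪P x, v⟫ - s ^ 2 * (1 / (2 * δ) * ‖v‖ ^ 2) := by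
        intro s hs0 hs1
        have h1 := hiv (x + s • v) (-(s • v))
        have h2 := hiv (x + s • v) ((1 - s) • v)
        have e1 : x + s • v + -(s • v) = x := by abel
        have e2 : x + s • v + (1 - s) • v = x + v := by module
        rw [e1, inner_neg_right, inner_smul_right, norm_neg, norm_smul, Real.norm_of_nonneg hs0] at h1
        rw [e2, inner_smul_right, norm_smul, Real.norm_of_nonneg (sub_nonneg.2 hs1)] at h2
        have h3 := mul_le_mul_of_nonneg_left h1 (sub_nonneg.2 hs1)
        have h4 := mul_le_mul_of_nonneg_left h2 hs0
        have h5 := mul_le_mul_of_nonneg_left hGv hs0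
        set X := ⟪P (x + s • v), v⟫
        set m := 1 / (2 * δ) * ‖v‖ ^ 2 with hm
        have e3 : 1 / (2 * δ) * (s * ‖v‖) ^ 2 = s ^ 2 * m := by rw [hm]; ring
        have e4 : 1 / (2 * δ) * ((1 - s) * ‖v‖) ^ 2 = (1 - s) ^ 2 * m := by rw [hm]; ring
        rw [e3] at h3
        rw [e4] at h4
        nlinarith
      have hfin : ∀ η > 0, ⟪A v, v⟫ ≤ -(1 / δ) * ‖v‖ ^ 2 + 2 * η * ‖v‖ ^ 2 := by
        intro η hη
        have h1 := (tendsto_ray v).eventually (hT η hη)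
        obtain ⟨s, hs, hs01⟩ := (h1.and (Ioo_mem_nhdsGT (show (0:ℝ) < 1 by norm_num))).exists
        have h2 := hray s hs01.1.le hs01.2.le
        have h3 := (abs_le.1 hs).1
        simp only [map_smul, real_inner_smul_left, inner_smul_right, norm_smul, Real.norm_of_nonneg hs01.1.le] at h3
        have e : s ^ 2 * (1 / (2 * δ) * ‖v‖ ^ 2) = s ^ 2 * (1 / 2 * (1 / δ * ‖v‖ ^ 2)) := by field_simp
        have h4 : s ^ 2 * ⟪A v, v⟫ ≤ s ^ 2 * (-(1 / δ) * ‖v‖ ^ 2 + 2 * η * ‖v‖ ^ 2) := by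
          rw [e] at h2
          linarith
        exact le_of_mul_le_mul_left h4 (by have := hs01.1; positivity)
      apply le_of_forall_pos_le_add
      intro ε' hε'
      have := hfin (ε' / (2 * ‖v‖ ^ 2)) (by positivity)
      refine this.trans (le_of_eq ?_)
      field_simp

end Reg
end CE

namespace CE

section Avg
variable {E : Type*} [NormedAddCommGroup E] [InnerProductSpace ℝ E] [FiniteDimensional ℝ E]

theorem closed_sup {F : (E →L[ℝ] E) → ℝ} {θ CF : ℝ} (hF : EllF F θ CF) (c : ℝ) :
    IsClosed {A : E →L[ℝ] E | Sy A ∧ c ≤ F A} := by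
  apply IsSeqClosed.isClosed
  intro A B hA hlim
  have hB : Sy B := by
    intro x y
    have h1 : Tendsto (fun k => ⟪A k x, y⟫) atTop (nhds ⟪B x, y⟫) := by
      have : Continuous fun T : E →L[ℝ] E => ⟪T x, y⟫ := by fun_prop
      exact (this.tendsto B).comp hlim
    have h2 : Tendsto (fun k => ⟪x, A k y⟫) atTop (nhds ⟪x, B y⟫) := by
      have : Continuous fun T : E →L[ℝ] E => ⟪x, T y⟫ := by fun_prop
      exact (this.tendsto B).comp hlim
    exact tendsto_nhds_unique h1 (by simpa only [(hA _).1 x y] using h2)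
  refine ⟨hB, ?_⟩
  have h3 : Tendsto (fun k => c - CF * ‖B - A k‖) atTop (nhds (c - CF * ‖B - B‖)) := by
    have : Continuous fun T : E →L[ℝ] E => c - CF * ‖B - T‖ := by fun_prop
    exact (this.tendsto B).comp hlim
  simp only [sub_self, norm_zero, mul_zero, sub_zero] at h3
  refine le_of_tendsto h3 (Eventually.of_forall fun k => ?_)
  have h4 := hF.lip hB (hA k).1 (c := ‖B - A k‖) (norm_nonneg _) (fun z => by
    have := (abs_le.1 (abs_quad_le (B - A k) z)).2
    simp only [sub_apply, inner_sub_left] at this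
    linarith)
  have := (hA k).2
  linarith

theorem convex_sup {F : (E →L[ℝ] E) → ℝ} {θ CF : ℝ} (hF : EllF F θ CF) (c : ℝ) :
    Convex ℝ {A : E →L[ℝ] E | Sy A ∧ c ≤ F A} := by
  intro A hA B hB s t hs ht hst
  refine ⟨(hA.1.smul s).add (hB.1.smul t), ?_⟩
  have h1 := hF.conc A B hA.1 hB.1 s t hs ht
  have h2 := mul_le_mul_of_nonneg_left hA.2 hs
  have h3 := mul_le_mul_of_nonneg_left hB.2 ht
  have : c = s * c + t * c := by rw [← add_mul, hst, one_mul]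
  linarith

open MeasureTheory in
theorem exists_avg_measure [MeasurableSpace E] [BorelSpace E] {τ : ℝ} (hτ : 0 < τ) :
    ∃ ν : Measure E, IsProbabilityMeasure ν ∧ ν ≪ volume ∧ ∀ᵐ y ∂ν, ‖y‖ ≤ τ := by
  have h0 : volume (Metric.ball (0:E) τ) ≠ 0 := (Metric.measure_ball_pos volume (0:E) hτ).ne'
  have h1 : volume (Metric.ball (0:E) τ) ≠ ⊤ := measure_ball_lt_top.ne
  refine ⟨ProbabilityTheory.cond volume (Metric.ball (0:E) τ),
    ProbabilityTheory.cond_isProbabilityMeasure_of_finite h0 h1,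
    ProbabilityTheory.cond_absolutelyContinuous, ?_⟩
  have := ProbabilityTheory.ae_cond_mem (μ := (volume : Measure E)) (s := Metric.ball (0:E) τ) measurableSet_ball
  filter_upwards [this] with y hy
  simpa using (mem_ball_zero_iff.1 hy).le

open MeasureTheory in
theorem int_of_cont [MeasurableSpace E] [BorelSpace E] {V : Type*} [NormedAddCommGroup V]
    {ν : Measure E} [IsFiniteMeasure ν] {τ : ℝ} (hν : ∀ᵐ y ∂ν, ‖y‖ ≤ τ) {k : E → V} (hk : Continuous k) :
    Integrable k ν := by
  obtain ⟨C, hC⟩ := ((isCompact_closedBall (0:E) τ).image (f := fun x => ‖k x‖) hk.norm).bddAbove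
  refine Integrable.of_bound hk.aestronglyMeasurable C ?_
  filter_upwards [hν] with y hy
  exact hC (Set.mem_image_of_mem _ (by simpa using hy))

open MeasureTheory in
theorem avg [MeasurableSpace E] [BorelSpace E] {ν : Measure E} [IsProbabilityMeasure ν]
    (hac : ν ≪ volume) {τ : ℝ} (hν : ∀ᵐ y ∂ν, ‖y‖ ≤ τ) {G : E → ℝ} {P : E → E} {C : ℝ} (hC : 0 ≤ C)
    (hq : ∀ x h, |G (x + h) - G x - ⟪P x, h⟫| ≤ C * ‖h‖ ^ 2) (x : E) :
    (∀ᵐ y ∂ν, Sy (fderiv ℝ P (x + y)) ∧ Tay G (x + y) (P (x + y)) (fderiv ℝ P (x + y))) ∧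
    Integrable (fun y => fderiv ℝ P (x + y)) ν ∧
    Tay (fun x => ∫ y, G (x + y) ∂ν) x (∫ y, P (x + y) ∂ν) (∫ y, fderiv ℝ P (x + y) ∂ν) := by
  have hL : LipschitzWith (6 * C).toNNReal P := LipschitzWith.of_dist_le_mul fun x y => by
    rw [dist_eq_norm, dist_eq_norm, Real.coe_toNNReal _ (by positivity)]
    exact lip_of_quad hq hC y x
  have hd : ∀ x, HasFDerivAt G (J (P x)) x := fderiv_of_quad hq
  have hGc : Continuous G := continuous_iff_continuousAt.2 fun x => (hd x).continuousAt
  have h1 : ∀ᵐ y ∂ν, DifferentiableAt ℝ P (x + y) := by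
    apply hac.ae_le
    exact (measurePreserving_add_left volume x).quasiMeasurePreserving.ae hL.ae_differentiableAt
  have h2 : ∀ᵐ y ∂ν, Sy (fderiv ℝ P (x + y)) ∧ Tay G (x + y) (P (x + y)) (fderiv ℝ P (x + y)) := by
    filter_upwards [h1] with y hy
    exact taylor (Eventually.of_forall hd) hy.hasFDerivAt
  have hDb : ∀ p, ‖fderiv ℝ P p‖ ≤ 6 * C := fun p => by
    have := norm_fderiv_le_of_lipschitz ℝ hL (x₀ := p)
    rwa [Real.coe_toNNReal _ (by positivity)] at this
  have hDm : AEStronglyMeasurable (fun y => fderiv ℝ P (x + y)) ν :=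
    ((measurable_fderiv ℝ P).comp (measurable_const_add x)).aestronglyMeasurable
  have hDi : Integrable (fun y => fderiv ℝ P (x + y)) ν :=
    Integrable.of_bound hDm (6 * C) (Eventually.of_forall fun y => hDb _)
  refine ⟨h2, hDi, ?_⟩
  have hPi : Integrable (fun y => P (x + y)) ν := int_of_cont hν (hL.continuous.comp (by fun_prop))
  have hGi : ∀ x, Integrable (fun y => G (x + y)) ν := fun x => int_of_cont hν (hGc.comp (by fun_prop))
  set r : E → E → ℝ := fun z y => G (x + z + y) - G (x + y) - ⟪z, P (x + y)⟫
    - 1 / 2 * ⟪z, fderiv ℝ P (x + y) z⟫ with hr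
  have hri : ∀ z, Integrable (fun y => ⟪z, fderiv ℝ P (x + y) z⟫) ν ∧
      ∫ y, ⟪z, fderiv ℝ P (x + y) z⟫ ∂ν = ⟪z, (∫ y, fderiv ℝ P (x + y) ∂ν) z⟫ := by
    intro z
    have h3 := ((J z).comp (ContinuousLinearMap.apply ℝ E z)).integral_comp_comm hDi
    have h4 := ((J z).comp (ContinuousLinearMap.apply ℝ E z)).integrable_comp hDi
    simp only [ContinuousLinearMap.comp_apply, ContinuousLinearMap.apply_apply, J_apply] at h3 h4
    exact ⟨h4, h3⟩
  have hrI : ∀ z, ∫ y, r z y ∂ν = (∫ y, G (x + z + y) ∂ν) - (∫ y, G (x + y) ∂ν) - ⟪∫ y, P (x + y) ∂ν, z⟫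
      - 1 / 2 * ⟪(∫ y, fderiv ℝ P (x + y) ∂ν) z, z⟫ := by
    intro z
    simp only [hr]
    rw [integral_sub, integral_sub, integral_sub, integral_const_mul, (hri z).2, integral_inner hPi,
      real_inner_comm _ z, real_inner_comm _ z]
    · exact hGi _
    · exact hGi _
    · exact (hGi _).sub (hGi _)
    · exact hPi.const_inner z
    · exact ((hGi _).sub (hGi _)).sub (hPi.const_inner z)
    · exact (hri z).1.const_mul _
  have hlim : Tendsto (fun z => ∫ y, r z y / ‖z‖ ^ 2 ∂ν) (nhds 0) (nhds (∫ y, (0:ℝ) ∂ν)) := by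
    refine tendsto_integral_filter_of_dominated_convergence (fun _ => C + 3 * C) ?_ ?_ (integrable_const _) ?_
    · refine Eventually.of_forall fun z => ?_
      refine Integrable.aestronglyMeasurable (Integrable.div_const ?_ _)
      exact (((hGi _).sub (hGi _)).sub (hPi.const_inner z)).sub ((hri z).1.const_mul _)
    · refine Eventually.of_forall fun z => Eventually.of_forall fun y => ?_
      rw [norm_div, norm_pow, norm_norm]
      apply div_le_of_le_mul₀ (by positivity) (by positivity)
      have h3 := hq (x + y) z
      have e : x + y + z = x + z + y := by abel
      rw [e, real_inner_comm] at h3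
      have h4 := abs_quad_le (fderiv ℝ P (x + y)) z
      rw [real_inner_comm] at h4
      have h5 : ‖fderiv ℝ P (x + y)‖ * ‖z‖ ^ 2 ≤ 6 * C * ‖z‖ ^ 2 := by gcongr; exact hDb _
      simp only [hr, Real.norm_eq_abs]
      have h6 := abs_le.1 h3
      have h7 := abs_le.1 h4
      rw [abs_le]
      constructor <;> linarith
    · filter_upwards [h2] with y hy
      rw [Metric.tendsto_nhds]
      intro η hη
      filter_upwards [hy.2 (η / 2) (by positivity)] with z hz
      rw [dist_zero_right, norm_div, norm_pow, norm_norm]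
      have e : x + y + z = x + z + y := by abel
      rw [e, real_inner_comm, real_inner_comm z] at hz
      have : ‖r z y‖ / ‖z‖ ^ 2 ≤ η / 2 := by
        apply div_le_of_le_mul₀ (by positivity) (by positivity)
        exact hz
      linarith
  simp only [integral_zero] at hlim
  intro η hη
  filter_upwards [(Metric.tendsto_nhds.1 hlim) η hη] with z hz
  rw [dist_zero_right, integral_div, norm_div, norm_pow, norm_norm, hrI] at hz
  by_cases hz0 : z = 0
  · subst hz0; simp
  have : 0 < ‖z‖ := norm_pos_iff.2 hz0
  rw [div_lt_iff₀ (by positivity)] at hz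
  exact hz.le

open MeasureTheory in
/-- Smoothing of supersolutions. -/
theorem smooth [MeasurableSpace E] [BorelSpace E] {F : (E →L[ℝ] E) → ℝ} {θ CF : ℝ} (hF : EllF F θ CF)
    {H ℓ w g : E → ℝ} {R : ℝ} (hG : Gau H ℓ R) (hw : KL ℓ w) (hS : Sup F H g w) (hg : Continuous g)
    {κ : ℝ} (hκ : 0 < κ) (Rad : ℝ) :
    ∃ (W : E → ℝ) (P : E → E) (AA : E → (E →L[ℝ] E)), KL ℓ W ∧ (∀ x, |W x - w x| ≤ κ) ∧
      (∀ x, Sy (AA x) ∧ Tay W x (P x) (AA x)) ∧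
      ∀ x, ‖x‖ ≤ Rad → H (P x) < -κ → g x - κ ≤ F (AA x) := by
  have hR := hG.R0
  have hθ := hF.hθ
  have hCF := hF.hC
  -- modulus of g
  obtain ⟨ρ, hρ, hρ1, hgu⟩ : ∃ ρ > 0, ρ ≤ 1 ∧ ∀ x z : E, ‖x‖ ≤ Rad → ‖x - z‖ ≤ ρ → g x - κ ≤ g z := by
    have hu := (isCompact_closedBall (0:E) (Rad + 1)).uniformContinuousOn_of_continuous hg.continuousOn
    obtain ⟨ρ, hρ, h⟩ := Metric.uniformContinuousOn_iff.1 hu κ hκ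
    refine ⟨min (ρ / 2) 1, by positivity, min_le_right _ _, fun x z hx hxz => ?_⟩
    have h1 : ‖z‖ ≤ Rad + 1 := by
      have : ‖z‖ ≤ ‖x‖ + ‖x - z‖ := by
        have := norm_sub_le x (x - z)
        simpa using this
      have := min_le_right (ρ / 2) 1
      linarith
    have h2 := h x (by simp; linarith) z (by simpa using h1) (by
      rw [dist_eq_norm]
      have := min_le_left (ρ / 2) 1
      linarith)
    rw [Real.dist_eq] at h2
    have := (abs_lt.1 h2).2
    linarith
  obtain ⟨M, hM⟩ := ((isCompact_closedBall (0:E) Rad).image (f := g) hg).bddAbove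
  obtain ⟨ρ', hρ', hHu⟩ : ∃ ρ > 0, ∀ p q : E, ‖p‖ ≤ R → ‖q‖ ≤ R → ‖p - q‖ ≤ ρ → H p < H q + κ := by
    have hu := (isCompact_closedBall (0:E) R).uniformContinuousOn_of_continuous hG.cont.continuousOn
    obtain ⟨ρ, hρ, h⟩ := Metric.uniformContinuousOn_iff.1 hu κ hκ
    refine ⟨ρ / 2, by positivity, fun p q hp hq hpq => ?_⟩
    have h2 := h p (by simpa using hp) q (by simpa using hq) (by rw [dist_eq_norm]; linarith)
    rw [Real.dist_eq] at h2
    have := (abs_lt.1 h2).2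
    linarith
  -- choice of ε
  set ε := min (ρ / (4 * R)) (κ / (2 * R ^ 2)) with hεdef
  have hε : 0 < ε := by positivity
  have hε1 : 2 * ε * R ≤ ρ / 2 := by
    have : ε ≤ ρ / (4 * R) := min_le_left _ _
    calc 2 * ε * R ≤ 2 * (ρ / (4 * R)) * R := by gcongr
      _ = ρ / 2 := by field_simp; norm_num
  have hε2 : R ^ 2 * ε / 2 ≤ κ / 4 := by
    have : ε ≤ κ / (2 * R ^ 2) := min_le_right _ _
    calc R ^ 2 * ε / 2 ≤ R ^ 2 * (κ / (2 * R ^ 2)) / 2 := by gcongr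
      _ = κ / 4 := by field_simp; norm_num
  set δ := min (κ / (2 * R ^ 2)) (θ / (|M| + CF * (1 / ε) + 1)) with hδdef
  have hδ : 0 < δ := by positivity
  have hδ2 : R ^ 2 * δ / 2 ≤ κ / 4 := by
    have : δ ≤ κ / (2 * R ^ 2) := min_le_left _ _
    calc R ^ 2 * δ / 2 ≤ R ^ 2 * (κ / (2 * R ^ 2)) / 2 := by gcongr
      _ = κ / 4 := by field_simp; norm_num
  have hδ1 : M ≤ -CF * (1 / ε) + θ * (1 / δ) := by
    have h1 : δ ≤ θ / (|M| + CF * (1 / ε) + 1) := min_le_right _ _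
    rw [le_div_iff₀ (by positivity)] at h1
    have h2 : |M| + CF * (1 / ε) + 1 ≤ θ * (1 / δ) := by
      rw [mul_one_div θ δ, le_div_iff₀ hδ]; linarith
    have := le_abs_self M
    linarith
  obtain ⟨G, P, hGK, hGw, hquad, hvi⟩ := reg hF hG hw hS hε hδ
  set C := 1 / ε + 1 / (2 * δ) with hC
  have hC0 : 0 < C := by positivity
  have hPL := lip_of_quad hquad hC0.le
  have hPK : ∀ x, H (P x) ≤ 0 := fun x => by
    refine KL.grad_TB hG hGK (x := x) (A := (-(2 * C)) • ContinuousLinearMap.id ℝ E)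
      (Eventually.of_forall fun z => ?_)
    have := (abs_le.1 (hquad x z)).1
    simp only [smul_apply, ContinuousLinearMap.id_apply, real_inner_smul_left,
      real_inner_self_eq_norm_sq]
    linarith
  have hPR : ∀ x, ‖P x‖ ≤ R := fun x => hG.bdd _ (hPK x)
  have hPc : Continuous P := by
    have : LipschitzWith (6 * C).toNNReal P := LipschitzWith.of_dist_le_mul fun x y => by
      rw [dist_eq_norm, dist_eq_norm, Real.coe_toNNReal _ (by positivity)]
      exact hPL y x
    exact this.continuous
  set τ := min (ρ / 2) (min (κ / (4 * R)) (ρ' / (12 * C))) with hτdef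
  have hτ : 0 < τ := by positivity
  have hτ1 : τ ≤ ρ / 2 := min_le_left _ _
  have hτ2 : R * τ ≤ κ / 4 := by
    have : τ ≤ κ / (4 * R) := (min_le_right _ _).trans (min_le_left _ _)
    calc R * τ ≤ R * (κ / (4 * R)) := by gcongr
      _ = _ := by field_simp
  have hτ3 : 6 * C * τ ≤ ρ' / 2 := by
    have : τ ≤ ρ' / (12 * C) := (min_le_right _ _).trans (min_le_right _ _)
    calc 6 * C * τ ≤ 6 * C * (ρ' / (12 * C)) := by gcongr
      _ = _ := by field_simp; norm_num
  obtain ⟨ν, hν1, hac, hν⟩ := exists_avg_measure (E := E) hτ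
  have hGc : Continuous G := hG.kl_cont hGK
  have hGi : ∀ x, Integrable (fun y => G (x + y)) ν := fun x => int_of_cont hν (hGc.comp (by fun_prop))
  have hPi : ∀ x, Integrable (fun y => P (x + y)) ν := fun x => int_of_cont hν (hPc.comp (by fun_prop))
  have hav := fun x => avg hac hν hC0.le hquad x
  refine ⟨fun x => ∫ y, G (x + y) ∂ν, fun x => ∫ y, P (x + y) ∂ν, fun x => ∫ y, fderiv ℝ P (x + y) ∂ν,
    ?_, ?_, ?_, ?_⟩
  · intro x v
    have h1 : ∫ y, G (x + v + y) ∂ν ≤ ∫ y, (G (x + y) + ℓ v) ∂ν := by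
      refine integral_mono (hGi _) ((hGi _).add (integrable_const _)) fun y => ?_
      have := hGK (x + y) v
      have e : x + y + v = x + v + y := by abel
      rwa [e] at this
    rw [integral_add (hGi _) (integrable_const _)] at h1
    simpa using h1
  · intro x
    have h1 : ‖(∫ y, (G (x + y) - w x) ∂ν)‖ ≤ κ := by
      have := norm_integral_le_of_norm_le_const (μ := ν) (f := fun y => G (x + y) - w x) (C := κ) (by
        filter_upwards [hν] with y hy
        have h1 := hG.kl_abs hGK (x + y) x
        simp only [add_sub_cancel_left] at h1
        have h2 : R * ‖y‖ ≤ R * τ := by gcongr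
        have h3 := hGw x
        have h4 := abs_le.1 h1
        rw [Real.norm_eq_abs, abs_le]
        have h5 : R ^ 2 * (ε + δ) / 2 = R ^ 2 * ε / 2 + R ^ 2 * δ / 2 := by ring
        constructor <;> linarith)
      simpa using this
    rw [integral_sub (hGi x) (integrable_const _)] at h1
    simpa using h1
  · intro x
    refine ⟨?_, (hav x).2.2⟩
    have hconv : Convex ℝ {A : E →L[ℝ] E | Sy A} := fun A hA B hB s t _ _ _ => (hA.smul s).add (hB.smul t)
    have hcl : IsClosed {A : E →L[ℝ] E | Sy A} := by
      have : {A : E →L[ℝ] E | Sy A} = ⋂ x : E, ⋂ y : E, {A | ⟪A x, y⟫ = ⟪x, A y⟫} := by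
        ext A; simp [Sy]
      rw [this]
      exact isClosed_iInter fun x => isClosed_iInter fun y => isClosed_eq (by fun_prop) (by fun_prop)
    exact hconv.integral_mem hcl ((hav x).1.mono fun y hy => hy.1) (hav x).2.1
  · intro x hx hH
    have hclose : ∀ y, ‖y‖ ≤ τ → ‖P (x + y) - P x‖ ≤ ρ' / 2 := fun y hy => by
      have := hPL x (x + y)
      rw [add_sub_cancel_left] at this
      have h2 : 6 * C * ‖y‖ ≤ 6 * C * τ := by gcongr
      linarith
    have hR' : ‖∫ y, P (x + y) ∂ν‖ ≤ R := by
      have := norm_integral_le_of_norm_le_const (μ := ν) (f := fun y => P (x + y)) (C := R)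
        (Eventually.of_forall fun y => hPR _)
      simpa using this
    have hc2 : ‖(∫ y, P (x + y) ∂ν) - P x‖ ≤ ρ' / 2 := by
      have := norm_integral_le_of_norm_le_const (μ := ν) (f := fun y => P (x + y) - P x) (C := ρ' / 2)
        (hν.mono fun y hy => hclose y hy)
      rw [integral_sub (hPi x) (integrable_const _)] at this
      simpa using this
    have hmem : ∀ᵐ y ∂ν, fderiv ℝ P (x + y) ∈ {A : E →L[ℝ] E | Sy A ∧ g x - κ ≤ F A} := by
      filter_upwards [hν, (hav x).1] with y hy hT
      refine ⟨hT.1, ?_⟩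
      have hneg : H (P (x + y)) < 0 := by
        have h1 := hHu (P (x + y)) (∫ y, P (x + y) ∂ν) (hPR _) hR' (by
          have h3 := hclose y hy
          have : P (x + y) - (∫ y, P (x + y) ∂ν) = (P (x + y) - P x) - ((∫ y, P (x + y) ∂ν) - P x) := by abel
          rw [this]
          refine (norm_sub_le _ _).trans ?_
          linarith)
        linarith
      rcases hvi (x + y) _ hT.1 hT.2 hneg with ⟨z, hz, hgz⟩ | h
      · have h1 : ‖x - z‖ ≤ ρ := by
          have : x - z = (x + y - z) - y := by abel
          rw [this]
          refine (norm_sub_le _ _).trans ?_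
          linarith
        exact (hgu x z hx h1).trans hgz
      · have := hM (Set.mem_image_of_mem _ (show x ∈ Metric.closedBall (0:E) Rad by simpa using hx))
        linarith
    exact ((convex_sup hF _).integral_mem (closed_sup hF _) hmem (hav x).2.1).2

end Avg
end CE

namespace CE

section Quad
variable {E : Type*} [NormedAddCommGroup E] [InnerProductSpace ℝ E]

theorem quad_expand {B : E →L[ℝ] E} (hB : Sy B) (x h : E) :
    ⟪B (x + h), x + h⟫ = ⟪B x, x⟫ + 2 * ⟪B x, h⟫ + ⟪B h, h⟫ := by
  have h1 := hB h x
  rw [real_inner_comm] at h1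
  have h2 := real_inner_comm (B h) x
  rw [map_add, inner_add_left, inner_add_right, inner_add_right]
  have h3 : ⟪B h, x⟫ = ⟪B x, h⟫ := by rw [hB h x, real_inner_comm]
  rw [h3]; ring

theorem sq_expand (z h : E) : ‖z + h‖ ^ 2 = ‖z‖ ^ 2 + 2 * ⟪z, h⟫ + ‖h‖ ^ 2 := norm_add_sq_real z h

end Quad

section Comb
variable {E : Type*} [NormedAddCommGroup E] [InnerProductSpace ℝ E] [FiniteDimensional ℝ E]
  [MeasurableSpace E] [BorelSpace E]

set_option maxHeartbeats 1000000 in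
theorem comb {F : (E →L[ℝ] E) → ℝ} {θ CF : ℝ} (hF : EllF F θ CF) {H ℓ w g : E → ℝ} {R : ℝ}
    (hG : Gau H ℓ R) (hw : KL ℓ w) (hS : Sup F H g w) (hg : Continuous g) {s t : ℝ} (hs : 0 < s)
    (ht : 0 < t) (hst : s + t = 1) {a b p : E} {B : E →L[ℝ] E} (hB : Sy B) (hp : H p < 0) {r : ℝ} (hr : 0 < r)
    (htouch : ∀ z1 z2 : E, ‖z1‖ ≤ r → ‖z2‖ ≤ r →
      s * w a + t * w b + ⟪p, s • z1 + t • z2⟫ + 1 / 2 * ⟪B (s • z1 + t • z2), s • z1 + t • z2⟫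
        ≤ s * w (a + z1) + t * w (b + z2)) :
    s * g a + t * g b ≤ F B := by
  have hCF := hF.hC
  have key : ∀ η > 0, s * g a + t * g b ≤ F B + (2 + 6 * CF) * η := by
    intro η hη
    obtain ⟨ρ, hρ, hHρ⟩ : ∃ ρ > 0, ∀ q, ‖q - p‖ ≤ ρ → H q < H p / 2 := by
      have : ∀ᶠ q in nhds p, H q < H p / 2 := hG.cont.continuousAt.eventually_lt_const (by linarith)
      obtain ⟨ρ, hρ, h⟩ := Metric.eventually_nhds_iff_ball.1 this
      exact ⟨ρ / 2, by positivity, fun q hq => h q (by rw [mem_ball_iff_norm]; linarith)⟩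
    have hgm : ∀ a, ∃ ρ > 0, ∀ z : E, ‖z‖ ≤ ρ → g a - η ≤ g (a + z) := by
      intro a
      have hc : Continuous fun z => g (a + z) := hg.comp (by fun_prop)
      have : ∀ᶠ z in nhds (0:E), g a - η < g (a + z) :=
        hc.continuousAt.eventually_const_lt (by simp; linarith)
      obtain ⟨ρ, hρ, h⟩ := Metric.eventually_nhds_iff_ball.1 this
      exact ⟨ρ / 2, by positivity, fun q hq => (h q (by rw [mem_ball_zero_iff]; linarith)).le⟩
    obtain ⟨ρa, hρa, hga⟩ := hgm a
    obtain ⟨ρb, hρb, hgb⟩ := hgm b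
    set D := ‖B‖ + 2 * η / s + 2 * η / t + 1 with hD
    have hD0 : 0 < D := by positivity
    obtain ⟨σ, hσ, hσr, hσ1, hσD, hσa, hσb⟩ : ∃ σ > 0, σ < r ∧ σ ≤ 1 ∧ D * σ ≤ ρ ∧ σ ≤ ρa ∧ σ ≤ ρb := by
      refine ⟨min (r / 2) (min 1 (min (ρ / D) (min ρa ρb))), by positivity, ?_, ?_, ?_, ?_, ?_⟩
      · have := min_le_left (r / 2) (min 1 (min (ρ / D) (min ρa ρb)))
        linarith
      · exact (min_le_right _ _).trans (min_le_left _ _)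
      · have : min (r / 2) (min 1 (min (ρ / D) (min ρa ρb))) ≤ ρ / D :=
          (min_le_right _ _).trans ((min_le_right _ _).trans (min_le_left _ _))
        rw [le_div_iff₀ hD0] at this
        linarith
      · exact (min_le_right _ _).trans ((min_le_right _ _).trans ((min_le_right _ _).trans (min_le_left _ _)))
      · exact (min_le_right _ _).trans ((min_le_right _ _).trans ((min_le_right _ _).trans (min_le_right _ _)))
    obtain ⟨κ, hκ, hκ1, hκ2, hκ3⟩ : ∃ κ > 0, 2 * κ ≤ η * σ ^ 2 ∧ κ ≤ -(H p / 2) ∧ κ ≤ η := by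
      refine ⟨min (η * σ ^ 2 / 2) (min (-(H p / 2)) η), ?_, ?_, ?_, ?_⟩
      · have : 0 < -(H p / 2) := by linarith
        positivity
      · have := min_le_left (η * σ ^ 2 / 2) (min (-(H p / 2)) η)
        linarith
      · exact (min_le_right _ _).trans (min_le_left _ _)
      · exact (min_le_right _ _).trans (min_le_right _ _)
    obtain ⟨W, P, AA, hWK, hWw, hWT, hWF⟩ := smooth hF hG hw hS hg hκ (max ‖a‖ ‖b‖ + 1)
    have hWc := hG.kl_cont hWK
    set Q : E → ℝ := fun ζ => ⟪p, ζ⟫ + 1 / 2 * ⟪B ζ, ζ⟫ with hQ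
    set Ψ : E × E → ℝ := fun z => s * W (a + z.1) + t * W (b + z.2) - Q (s • z.1 + t • z.2)
      + η * (‖z.1‖ ^ 2 + ‖z.2‖ ^ 2) with hΨ
    have hΨc : Continuous Ψ := by
      have h1 : Continuous fun z : E × E => W (a + z.1) := hWc.comp (by fun_prop)
      have h2 : Continuous fun z : E × E => W (b + z.2) := hWc.comp (by fun_prop)
      simp only [hΨ, hQ]
      fun_prop
    obtain ⟨⟨z1, z2⟩, hzmem, hzmin⟩ := ((isCompact_closedBall (0:E) r).prod (isCompact_closedBall (0:E) r)).exists_isMinOn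
      ⟨(0, 0), by simp [hr.le]⟩ hΨc.continuousOn
    have hmin : ∀ y1 y2 : E, ‖y1‖ ≤ r → ‖y2‖ ≤ r → Ψ (z1, z2) ≤ Ψ (y1, y2) := fun y1 y2 h1 h2 =>
      hzmin (show (y1, y2) ∈ _ from ⟨by simpa using h1, by simpa using h2⟩)
    have hz1r : ‖z1‖ ≤ r := by simpa using hzmem.1
    have hz2r : ‖z2‖ ≤ r := by simpa using hzmem.2
    have hsm : η * (‖z1‖ ^ 2 + ‖z2‖ ^ 2) ≤ 2 * κ := by
      have h1 := hmin 0 0 (by simpa using hr.le) (by simpa using hr.le)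
      have h2 := htouch z1 z2 hz1r hz2r
      have hΨ0 : Ψ (0, 0) = s * W a + t * W b := by simp [hΨ, hQ]
      rw [hΨ0] at h1
      simp only [hΨ, hQ] at h1
      have h3 := abs_le.1 (hWw a)
      have h4 := abs_le.1 (hWw b)
      have h5 := abs_le.1 (hWw (a + z1))
      have h6 := abs_le.1 (hWw (b + z2))
      have e1 : s * κ + t * κ = κ := by rw [← add_mul, hst, one_mul]
      have h7 := mul_le_mul_of_nonneg_left h3.2 hs.le
      have h8 := mul_le_mul_of_nonneg_left h4.2 ht.le
      have h9 := mul_le_mul_of_nonneg_left h5.1 hs.le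
      have h10 := mul_le_mul_of_nonneg_left h6.1 ht.le
      nlinarith
    have hz1 : ‖z1‖ ≤ σ := by
      have : η * ‖z1‖ ^ 2 ≤ η * σ ^ 2 := by nlinarith [sq_nonneg ‖z2‖]
      exact le_of_sq_le_sq (le_of_mul_le_mul_left this hη) hσ.le
    have hz2 : ‖z2‖ ≤ σ := by
      have : η * ‖z2‖ ^ 2 ≤ η * σ ^ 2 := by nlinarith [sq_nonneg ‖z1‖]
      exact le_of_sq_le_sq (le_of_mul_le_mul_left this hη) hσ.le
    set ζ := s • z1 + t • z2 with hζ
    have hζn : ‖ζ‖ ≤ σ := by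
      calc ‖ζ‖ ≤ ‖s • z1‖ + ‖t • z2‖ := norm_add_le _ _
        _ = s * ‖z1‖ + t * ‖z2‖ := by
          rw [norm_smul, norm_smul, Real.norm_of_nonneg hs.le, Real.norm_of_nonneg ht.le]
        _ ≤ s * σ + t * σ := by gcongr
        _ = σ := by rw [← add_mul, hst, one_mul]
    have hnear : ∀ᶠ h in nhds (0:E), ‖z1 + h‖ ≤ r ∧ ‖z2 + h‖ ≤ r := by
      filter_upwards [Metric.ball_mem_nhds (0:E) (show 0 < r - σ by linarith)] with h hh
      rw [mem_ball_zero_iff] at hh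
      exact ⟨(norm_add_le _ _).trans (by linarith), (norm_add_le _ _).trans (by linarith)⟩
    have hQe : ∀ h, Q (ζ + h) = Q ζ + ⟪p + B ζ, h⟫ + 1 / 2 * ⟪B h, h⟫ := by
      intro h
      simp only [hQ]
      rw [quad_expand hB, inner_add_right, inner_add_left]; ring
    have hP1 : P (a + z1) = p + B ζ - (2 * η / s) • z1 := by
      refine (hWT (a + z1)).2.first (c := ‖B‖ * s + η / s) ?_
      filter_upwards [hnear] with h hh
      have h1 := hmin (z1 + h) z2 hh.1 hz2r
      simp only [hΨ] at h1
      have e : s • (z1 + h) + t • z2 = ζ + s • h := by rw [hζ]; module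
      rw [e, hQe, ← hζ, @norm_add_sq_real, ← add_assoc] at h1
      simp only [map_smul, real_inner_smul_left, inner_smul_right] at h1
      rw [inner_sub_left, real_inner_smul_left]
      have h2 := (abs_le.1 (abs_quad_le B h)).1
      have h3 : s * (W (a + z1) + (⟪p + B ζ, h⟫ - 2 * η / s * ⟪z1, h⟫) - (‖B‖ * s + η / s) * ‖h‖ ^ 2)
        = s * W (a + z1) + s * ⟪p + B ζ, h⟫ - 2 * η * ⟪z1, h⟫ - ‖B‖ * s * s * ‖h‖ ^ 2 - η * ‖h‖ ^ 2 := by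
        field_simp; ring
      have h4 : s * s * (-(‖B‖ * ‖h‖ ^ 2)) ≤ s * s * ⟪B h, h⟫ := by gcongr
      have h5 : 0 ≤ s * s * (‖B‖ * ‖h‖ ^ 2) := by positivity
      refine le_of_mul_le_mul_left ?_ hs
      rw [h3]
      linarith
    have hP2 : P (b + z2) = p + B ζ - (2 * η / t) • z2 := by
      refine (hWT (b + z2)).2.first (c := ‖B‖ * t + η / t) ?_
      filter_upwards [hnear] with h hh
      have h1 := hmin z1 (z2 + h) hz1r hh.2
      simp only [hΨ] at h1
      have e : s • z1 + t • (z2 + h) = ζ + t • h := by rw [hζ]; module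
      rw [e, hQe, ← hζ, @norm_add_sq_real, ← add_assoc] at h1
      simp only [map_smul, real_inner_smul_left, inner_smul_right] at h1
      rw [inner_sub_left, real_inner_smul_left]
      have h2 := (abs_le.1 (abs_quad_le B h)).1
      have h3 : t * (W (b + z2) + (⟪p + B ζ, h⟫ - 2 * η / t * ⟪z2, h⟫) - (‖B‖ * t + η / t) * ‖h‖ ^ 2)
        = t * W (b + z2) + t * ⟪p + B ζ, h⟫ - 2 * η * ⟪z2, h⟫ - ‖B‖ * t * t * ‖h‖ ^ 2 - η * ‖h‖ ^ 2 := by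
        field_simp; ring
      have h4 : t * t * (-(‖B‖ * ‖h‖ ^ 2)) ≤ t * t * ⟪B h, h⟫ := by gcongr
      have h5 : 0 ≤ t * t * (‖B‖ * ‖h‖ ^ 2) := by positivity
      refine le_of_mul_le_mul_left ?_ ht
      rw [h3]
      linarith
    have hgen : ∀ (τ : ℝ) (z : E), 0 < τ → ‖z‖ ≤ σ → 2 * η / τ ≤ 2 * η / s + 2 * η / t →
        H (p + B ζ - (2 * η / τ) • z) < -κ := by
      intro τ z hτ hz hle
      refine (hHρ _ ?_).trans_le (by linarith)
      have : p + B ζ - (2 * η / τ) • z - p = B ζ - (2 * η / τ) • z := by abel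
      rw [this]
      calc ‖B ζ - (2 * η / τ) • z‖ ≤ ‖B ζ‖ + ‖(2 * η / τ) • z‖ := norm_sub_le _ _
        _ ≤ ‖B‖ * ‖ζ‖ + 2 * η / τ * ‖z‖ := by
          rw [norm_smul, Real.norm_of_nonneg (by positivity)]
          gcongr
          exact B.le_opNorm ζ
        _ ≤ ‖B‖ * σ + (2 * η / s + 2 * η / t) * σ := by gcongr
        _ ≤ D * σ := by rw [hD]; nlinarith
        _ ≤ ρ := hσD
    have hF1 : g (a + z1) - κ ≤ F (AA (a + z1)) := by
      refine hWF _ ?_ ?_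
      · refine (norm_add_le _ _).trans ?_
        have := le_max_left ‖a‖ ‖b‖
        linarith
      · rw [hP1]; exact hgen s z1 hs hz1 (by have : 0 ≤ 2 * η / t := by positivity
                                             linarith)
    have hF2 : g (b + z2) - κ ≤ F (AA (b + z2)) := by
      refine hWF _ ?_ ?_
      · refine (norm_add_le _ _).trans ?_
        have := le_max_right ‖a‖ ‖b‖
        linarith
      · rw [hP2]; exact hgen t z2 ht hz2 (by have : 0 ≤ 2 * η / s := by positivity
                                             linarith)
    set A' := s • AA (a + z1) + t • AA (b + z2) with hA'
    have hA's : Sy A' := ((hWT _).1.smul s).add ((hWT _).1.smul t)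
    have hcmp : ∀ h, ⟪B h, h⟫ ≤ ⟪A' h, h⟫ + (6 * η) * ‖h‖ ^ 2 := by
      apply quad_of_small
      filter_upwards [hnear, (hWT (a + z1)).2 η hη, (hWT (b + z2)).2 η hη] with h hh h1 h2
      have h3 := hmin (z1 + h) (z2 + h) hh.1 hh.2
      simp only [hΨ] at h3
      have e : s • (z1 + h) + t • (z2 + h) = ζ + h := by
        have : s • (z1 + h) + t • (z2 + h) = ζ + (s + t) • h := by rw [hζ]; module
        rw [this, hst, one_smul]
      rw [e, hQe, ← hζ, @norm_add_sq_real _ _ _ z1, @norm_add_sq_real _ _ _ z2, ← add_assoc, ← add_assoc] at h3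
      have h4 := mul_le_mul_of_nonneg_left (abs_le.1 h1).2 hs.le
      have h5 := mul_le_mul_of_nonneg_left (abs_le.1 h2).2 ht.le
      have e2 : ⟪A' h, h⟫ = s * ⟪AA (a + z1) h, h⟫ + t * ⟪AA (b + z2) h, h⟫ := by
        simp only [hA', add_apply, smul_apply, inner_add_left, real_inner_smul_left]
      have e3 : s * ⟪P (a + z1), h⟫ + t * ⟪P (b + z2), h⟫ = ⟪p + B ζ, h⟫ - 2 * η * ⟪z1, h⟫ - 2 * η * ⟪z2, h⟫ := by
        rw [hP1, hP2, inner_sub_left, inner_sub_left, real_inner_smul_left, real_inner_smul_left]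
        have : ⟪p + B ζ, h⟫ = s * ⟪p + B ζ, h⟫ + t * ⟪p + B ζ, h⟫ := by rw [← add_mul, hst, one_mul]
        rw [mul_sub, mul_sub]
        have e4 : s * (2 * η / s * ⟪z1, h⟫) = 2 * η * ⟪z1, h⟫ := by field_simp
        have e5 : t * (2 * η / t * ⟪z2, h⟫) = 2 * η * ⟪z2, h⟫ := by field_simp
        linarith
      have e6 : s * (η * ‖h‖ ^ 2) + t * (η * ‖h‖ ^ 2) = η * ‖h‖ ^ 2 := by rw [← add_mul, hst, one_mul]
      rw [e2]
      linarith
    have h1 := hF.lip hB hA's (c := 6 * η) (by positivity) hcmp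
    have h2 := hF.conc _ _ (hWT (a + z1)).1 (hWT (b + z2)).1 s t hs.le ht.le
    rw [← hA'] at h2
    have h3 := hga z1 (hz1.trans hσa)
    have h4 := hgb z2 (hz2.trans hσb)
    have h5 : s * (g a - η - κ) ≤ s * F (AA (a + z1)) := by gcongr; linarith
    have h6 : t * (g b - η - κ) ≤ t * F (AA (b + z2)) := by gcongr; linarith
    have e6 : s * (η + κ) + t * (η + κ) = η + κ := by rw [← add_mul, hst, one_mul]
    linarith
  apply le_of_forall_pos_le_add
  intro ε hε
  have := key (ε / (2 + 6 * CF)) (by positivity)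
  refine this.trans (le_of_eq ?_)
  field_simp

theorem comparison {F : (E →L[ℝ] E) → ℝ} {θ CF : ℝ} (hF : EllF F θ CF) {H ℓ w u v f : E → ℝ} {R : ℝ}
    (hG : Gau H ℓ R) (hf : Continuous f) (hv : Continuous v)
    (hu : KL ℓ u) (huS : Sub F f u) (hw : KL ℓ w) (hS : Sup F H (fun x => f x + v x - w x) w)
    {m C3 Cu Cw : ℝ} (hm : ∀ x, -m ≤ f x) (hvu : ∀ x, u x - C3 ≤ v x) (hul : ∀ x, -Cu ≤ u x - C3)
    (hwl : ∀ x, ℓ x - Cw ≤ w x) (x : E) : u x - C3 ≤ w x := by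
  obtain ⟨c, hc, hlow⟩ := hG.lower
  have hwc := hG.kl_cont hw
  have huc := hG.kl_cont hu
  have key : ∀ ρ : ℝ, 0 < ρ → ρ < 1 → ρ * (u x - C3) - w x ≤ (1 - ρ) * (3 + m + Cu) := by
    intro ρ h0 h1
    have hH0 := hG.neg0
    obtain ⟨κ, hκ, hκ1, hκ2⟩ : ∃ κ > 0, κ ≤ 1 - ρ ∧ (1 - ρ) * H 0 < -κ := by
      refine ⟨min (1 - ρ) ((1 - ρ) * (-H 0) / 2), ?_, min_le_left _ _, ?_⟩
      · have : 0 < 1 - ρ := by linarith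
        have : 0 < -H 0 := by linarith
        positivity
      · have := min_le_right (1 - ρ) ((1 - ρ) * (-H 0) / 2)
        nlinarith
    set K := |u 0| + |C3| + Cw + 1 with hK
    set Rad := (K + |ρ * (u 0 - C3)| + |w 0| + 1) / ((1 - ρ) * c) with hRad
    obtain ⟨W, P, AA, hWK, hWw, hWT, hWF⟩ := smooth hF hG hw hS ((hf.add hv).sub hwc) hκ Rad
    have hWc := hG.kl_cont hWK
    have hco : ∀ y, (1 - ρ) * c * ‖y‖ - K ≤ W y - ρ * (u y - C3) := by
      intro y
      have h2 := hu 0 y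
      rw [zero_add] at h2
      have h3 := hwl y
      have h4 := (abs_le.1 (hWw y)).1
      have h5 := mul_le_mul_of_nonneg_left (hlow y) (show 0 ≤ 1 - ρ by linarith)
      have h6 : ρ * (u y - C3) ≤ ρ * ℓ y + (|u 0| + |C3|) := by
        have h7 : ρ * (u y - C3) ≤ ρ * (ℓ y + (|u 0| + |C3|)) := by
          gcongr
          have := le_abs_self (u 0)
          have := neg_abs_le C3
          linarith
        have h8 : ρ * (|u 0| + |C3|) ≤ 1 * (|u 0| + |C3|) := by gcongr
        linarith
      rw [hK]
      nlinarith
    obtain ⟨y, hy⟩ := exists_min (k := fun y => W y - ρ * (u y - C3)) (by fun_prop)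
      (mul_pos (show 0 < 1 - ρ by linarith) hc) hco
    have hyR : ‖y‖ ≤ Rad := by
      have h2 := hco y
      have h3 := hy 0
      have h4 := (abs_le.1 (hWw 0)).2
      have h5 := le_abs_self (w 0)
      have h6 := neg_abs_le (ρ * (u 0 - C3))
      rw [hRad, le_div_iff₀ (mul_pos (show 0 < 1 - ρ by linarith) hc)]
      nlinarith
    have hup : ∀ z, u (y + z) ≤ u y + ρ⁻¹ * (W (y + z) - W y) := by
      intro z
      have h2 := hy (y + z)
      have : ρ * u (y + z) ≤ ρ * (u y + ρ⁻¹ * (W (y + z) - W y)) := by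
        rw [mul_add, ← mul_assoc, mul_inv_cancel₀ h0.ne']; linarith
      exact le_of_mul_le_mul_left this h0
    have hjet : ∀ η > 0, ∀ᶠ z in nhds (0:E), u (y + z) ≤ u y + ⟪ρ⁻¹ • P y, z⟫ +
        1 / 2 * ⟪(ρ⁻¹ • AA y) z, z⟫ + η * ‖z‖ ^ 2 := by
      intro η hη
      filter_upwards [(hWT y).2 (ρ * η) (by positivity)] with z hz
      have h2 := (abs_le.1 hz).2
      have h3 := hup z
      have h4 : ρ⁻¹ * (W (y + z) - W y) ≤ ρ⁻¹ * (⟪P y, z⟫ + 1 / 2 * ⟪AA y z, z⟫ + ρ * η * ‖z‖ ^ 2) := by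
        gcongr; linarith
      have e : ρ⁻¹ * (⟪P y, z⟫ + 1 / 2 * ⟪AA y z, z⟫ + ρ * η * ‖z‖ ^ 2) =
        ρ⁻¹ * ⟪P y, z⟫ + 1 / 2 * (ρ⁻¹ * ⟪AA y z, z⟫) + η * ‖z‖ ^ 2 := by field_simp
      rw [e] at h4
      simp only [smul_apply, real_inner_smul_left]
      linarith
    have hFs : F (ρ⁻¹ • AA y) ≤ f y := huS.jet hF ((hWT y).1.smul _) hjet
    have hFc := hF.conc (AA y) 0 (hWT y).1 Sy.zero ρ⁻¹ 0 (by positivity) le_rfl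
    simp only [zero_mul, zero_smul, add_zero] at hFc
    have hFle : F (AA y) ≤ ρ * f y := by
      have : ρ * (ρ⁻¹ * F (AA y)) ≤ ρ * f y := by gcongr; linarith
      rwa [← mul_assoc, mul_inv_cancel₀ h0.ne', one_mul] at this
    have hHP : H (ρ⁻¹ • P y) ≤ 0 := by
      refine KL.grad_TA hG hu (x := y) (A := ρ⁻¹ • AA y + (2:ℝ) • ContinuousLinearMap.id ℝ E) ?_
      filter_upwards [hjet 1 one_pos] with z hz
      rw [inner_shift]; linarith
    have hHP2 := hG.scale hHP h0.le h1.le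
    rw [smul_smul, mul_inv_cancel₀ h0.ne', one_smul] at hHP2
    have h2 := hWF y hyR (by linarith)
    have h3 := hy x
    have h4 := (abs_le.1 (hWw y))
    have h5 := (abs_le.1 (hWw x))
    have h6 := hvu y
    have h7 := mul_le_mul_of_nonneg_left (hm y) (show 0 ≤ 1 - ρ by linarith)
    have h8 := mul_le_mul_of_nonneg_left (hul y) (show 0 ≤ 1 - ρ by linarith)
    nlinarith
  have hl : Tendsto (fun ρ : ℝ => ρ * (u x - C3) - w x - (1 - ρ) * (3 + m + Cu)) (nhdsWithin 1 (Set.Iio 1))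
      (nhds (1 * (u x - C3) - w x - (1 - 1) * (3 + m + Cu))) := by
    have : Continuous fun ρ : ℝ => ρ * (u x - C3) - w x - (1 - ρ) * (3 + m + Cu) := by fun_prop
    exact (this.tendsto 1).mono_left nhdsWithin_le_nhds
  have := le_of_tendsto hl (b := 0) (by
    filter_upwards [Ioo_mem_nhdsLT (show (0:ℝ) < 1 by norm_num)] with ρ hρ
    have := key ρ hρ.1 hρ.2
    linarith)
  linarith

end Comb
end CE

namespace CE

section Perron
variable {E : Type*} [NormedAddCommGroup E] [InnerProductSpace ℝ E] [FiniteDimensional ℝ E]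

theorem approx_touch {w : E → ℝ} (hw : Continuous w) {x p : E} {A : E →L[ℝ] E} (hA : Sy A) {r η κ σ : ℝ}
    (hσ : 0 < σ) (hσr : σ < r) (hη : 0 < η) (hκ : κ ≤ η * σ ^ 2)
    (h : ∀ z, ‖z‖ ≤ r → w x + ⟪p, z⟫ + 1 / 2 * ⟪A z, z⟫ - κ ≤ w (x + z)) :
    ∃ z, ‖z‖ ≤ σ ∧ TB w (x + z) (p + A z - (2 * η) • z) (A + (-(2 * η)) • ContinuousLinearMap.id ℝ E) := by
  have hr : 0 < r := hσ.trans hσr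
  set k : E → ℝ := fun z => w (x + z) - ⟪p, z⟫ - 1 / 2 * ⟪A z, z⟫ + η * ‖z‖ ^ 2 with hk
  have hkc : Continuous k := by
    have h1 : Continuous fun z : E => w (x + z) := hw.comp (by fun_prop)
    simp only [hk]; fun_prop
  obtain ⟨z, hz, hmin⟩ := exists_min_on (k := k) (s := Metric.closedBall 0 r) Metric.isClosed_closedBall
    ⟨0, by simp [hr.le]⟩ hkc one_pos (b := r - (w x - κ)) (fun z hz => by
      have hz' : ‖z‖ ≤ r := by simpa using hz
      have := h z hz'
      have : 0 ≤ η * ‖z‖ ^ 2 := by positivity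
      simp only [hk]; linarith)
  have hzr : ‖z‖ ≤ r := by simpa using hz
  have h0 := hmin 0 (by simp [hr.le])
  have hk0 : k 0 = w x := by simp [hk]
  rw [hk0] at h0
  have hzσ : ‖z‖ ≤ σ := by
    have h1 := h z hzr
    simp only [hk] at h0
    have : η * ‖z‖ ^ 2 ≤ η * σ ^ 2 := by linarith
    exact le_of_sq_le_sq (le_of_mul_le_mul_left this hη) hσ.le
  refine ⟨z, hzσ, ?_⟩
  filter_upwards [Metric.ball_mem_nhds (0:E) (show 0 < r - σ by linarith)] with h hh
  rw [mem_ball_zero_iff] at hh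
  have h1 := hmin (z + h) (by
    rw [mem_closedBall_zero_iff]; exact (norm_add_le _ _).trans (by linarith))
  simp only [hk] at h1
  rw [quad_expand hA, sq_expand, inner_add_right, ← add_assoc x] at h1
  rw [inner_shift, inner_sub_left, inner_add_left, real_inner_smul_left]
  linarith

theorem sup_inf {F : (E →L[ℝ] E) → ℝ} {θ CF : ℝ} (hF : EllF F θ CF) {H ℓ f L : E → ℝ} {R : ℝ}
    (hG : Gau H ℓ R) (hf : Continuous f) {δ : ℝ} (hδ : 0 ≤ δ) {S : Set (E → ℝ)} (hne : S.Nonempty)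
    (hL : ∀ w ∈ S, ∀ x, L x ≤ w x) (hK : ∀ w ∈ S, KL ℓ w)
    (hS : ∀ w ∈ S, Sup F H (fun x => f x - δ * w x) w) :
    ∃ W : E → ℝ, (∀ w ∈ S, ∀ x, W x ≤ w x) ∧ (∀ x c, (∀ w ∈ S, c ≤ w x) → c ≤ W x) ∧ KL ℓ W ∧
      Sup F H (fun x => f x - δ * W x) W := by
  have hbdd : ∀ x, BddBelow ((fun w : E → ℝ => w x) '' S) := fun x =>
    ⟨L x, by rintro _ ⟨w, hw, rfl⟩; exact hL w hw x⟩
  set W : E → ℝ := fun x => sInf ((fun w : E → ℝ => w x) '' S) with hW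
  have h1 : ∀ w ∈ S, ∀ x, W x ≤ w x := fun w hw x => csInf_le (hbdd x) ⟨w, hw, rfl⟩
  have h2 : ∀ x c, (∀ w ∈ S, c ≤ w x) → c ≤ W x := fun x c hc =>
    le_csInf (hne.image _) (by rintro _ ⟨w, hw, rfl⟩; exact hc w hw)
  have hnear : ∀ x, ∀ κ > 0, ∃ w ∈ S, w x < W x + κ := by
    intro x κ hκ
    by_contra hcon
    push Not at hcon
    have := h2 x _ hcon
    linarith
  refine ⟨W, h1, h2, ?_, ?_⟩
  · intro x v
    have : W (x + v) - ℓ v ≤ W x := h2 x _ fun w hw => by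
      have := h1 w hw (x + v)
      have := hK w hw x v
      linarith
    linarith
  intro x p A hA hTB hp
  have hCF := hF.hC
  have hR := hG.R0
  obtain ⟨r, hr, hTB⟩ := Metric.eventually_nhds_iff_ball.1 hTB
  apply le_of_forall_pos_le_add
  intro ε hε
  have key : ∀ η > 0, f x - δ * W x ≤ F A + (1 + δ * (1 + R) + 2 * CF) * η := by
    intro η hη
    obtain ⟨σ, hσ, hσr, hση, hσ1, hprop⟩ : ∃ σ > 0, σ < r / 2 ∧ σ ≤ η ∧ σ ≤ 1 ∧ ∀ z : E, ‖z‖ ≤ σ →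
        H (p + A z - (2 * η) • z) < 0 ∧ f x - η < f (x + z) := by
      have c1 : Continuous fun z => H (p + A z - (2 * η) • z) := hG.cont.comp (by fun_prop)
      have c2 : Continuous fun z => f (x + z) := hf.comp (by fun_prop)
      have e1 : ∀ᶠ z in nhds (0:E), H (p + A z - (2 * η) • z) < 0 :=
        c1.continuousAt.eventually_lt_const (by simpa using hp)
      have e2 : ∀ᶠ z in nhds (0:E), f x - η < f (x + z) :=
        c2.continuousAt.eventually_const_lt (by simp; linarith)
      obtain ⟨ρ, hρ, h⟩ := Metric.eventually_nhds_iff_ball.1 (e1.and e2)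
      refine ⟨min (ρ / 2) (min (r / 4) (min η 1)), by positivity, ?_, ?_, ?_, fun z hz => h z ?_⟩
      · have := (min_le_right (ρ / 2) (min (r / 4) (min η 1))).trans (min_le_left _ _)
        linarith
      · exact (min_le_right _ _).trans ((min_le_right _ _).trans (min_le_left _ _))
      · exact (min_le_right _ _).trans ((min_le_right _ _).trans (min_le_right _ _))
      · rw [mem_ball_zero_iff]
        have := min_le_left (ρ / 2) (min (r / 4) (min η 1))
        linarith
    obtain ⟨w, hw, hwx⟩ := hnear x (η * σ ^ 2) (by positivity)
    obtain ⟨z, hz, hT⟩ := approx_touch (hG.kl_cont (hK w hw)) hA (x := x) (p := p) (r := r / 2) hσ hσr hη le_rfl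
      (fun z hz => by
        have h3 := hTB z (by rw [mem_ball_zero_iff]; linarith)
        have := h1 w hw (x + z)
        linarith)
    obtain ⟨h3, h4⟩ := hprop z hz
    have h5 := hS w hw _ _ _ (hA.add (Sy.id.smul _)) hT h3
    have h6 := hF.lip hA (hA.add (Sy.id.smul (-(2 * η)))) (c := 2 * η) (by positivity) (fun v => by
      rw [inner_shift]; linarith)
    have h7 := (abs_le.1 (hG.kl_abs (hK w hw) (x + z) x)).2
    rw [add_sub_cancel_left] at h7
    have h8 : R * ‖z‖ ≤ R * η := by gcongr; linarith
    have h9 : η * σ ^ 2 ≤ η * 1 := by gcongr; nlinarith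
    have h10 : δ * w (x + z) ≤ δ * (W x + η + R * η) := by gcongr; linarith
    simp only at h5
    nlinarith
  have hp2 : 0 < 1 + δ * (1 + R) + 2 * CF := by positivity
  have := key (ε / (1 + δ * (1 + R) + 2 * CF)) (by positivity)
  refine this.trans (le_of_eq ?_)
  field_simp

theorem minav [MeasurableSpace E] [BorelSpace E] {F : (E →L[ℝ] E) → ℝ} {θ CF : ℝ} (hF : EllF F θ CF) {H ℓ f w : E → ℝ} {R : ℝ}
    (hG : Gau H ℓ R) (hf : Continuous f) (hfc : ConvexOn ℝ Set.univ f) {δ : ℝ}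
    (hw : KL ℓ w) (hS : Sup F H (fun x => f x - δ * w x) w) {C : ℝ} (hC : ∀ x, ℓ x - C ≤ w x)
    {s t : ℝ} (hs : 0 < s) (ht : 0 < t) (hst : s + t = 1) :
    ∃ m : E → ℝ, KL ℓ m ∧ (∀ x, ∃ h : E, m x = s * w (x + t • h) + t * w (x - s • h)) ∧
      (∀ x h, m x ≤ s * w (x + t • h) + t * w (x - s • h)) ∧ Sup F H (fun x => f x - δ * m x) m := by
  obtain ⟨c, hc, hlow⟩ := hG.lower
  have hwc := hG.kl_cont hw
  have hex : ∀ x, ∃ h, ∀ h', s * w (x + t • h) + t * w (x - s • h) ≤ s * w (x + t • h') + t * w (x - s • h') := by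
    intro x
    refine exists_min (k := fun h => s * w (x + t • h) + t * w (x - s • h)) ?_
      (a := c * (2 * s * t)) (b := c * ‖x‖ + C) (by positivity) ?_
    · have c1 : Continuous fun h => w (x + t • h) := hwc.comp (by fun_prop)
      have c2 : Continuous fun h => w (x - s • h) := hwc.comp (by fun_prop)
      fun_prop
    · intro h
      have h1 := hC (x + t • h)
      have h2 := hC (x - s • h)
      have h3 := hlow (x + t • h)
      have h4 := hlow (x - s • h)
      have h5 : t * ‖h‖ - ‖x‖ ≤ ‖x + t • h‖ := by
        have := norm_sub_le (x + t • h) x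
        rw [add_sub_cancel_left, norm_smul, Real.norm_of_nonneg ht.le] at this
        linarith
      have h6 : s * ‖h‖ - ‖x‖ ≤ ‖x - s • h‖ := by
        have := norm_sub_le x (x - s • h)
        rw [sub_sub_cancel, norm_smul, Real.norm_of_nonneg hs.le] at this
        linarith
      have h7 : s * (c * (t * ‖h‖ - ‖x‖) - C) ≤ s * w (x + t • h) := by
        gcongr
        have : c * (t * ‖h‖ - ‖x‖) ≤ c * ‖x + t • h‖ := by gcongr
        linarith
      have h8 : t * (c * (s * ‖h‖ - ‖x‖) - C) ≤ t * w (x - s • h) := by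
        gcongr
        have : c * (s * ‖h‖ - ‖x‖) ≤ c * ‖x - s • h‖ := by gcongr
        linarith
      have e : s * (c * (t * ‖h‖ - ‖x‖) - C) + t * (c * (s * ‖h‖ - ‖x‖) - C) =
        c * (2 * s * t) * ‖h‖ - (s + t) * (c * ‖x‖ + C) := by ring
      rw [hst, one_mul] at e
      linarith
  choose hh hmin using hex
  refine ⟨fun x => s * w (x + t • hh x) + t * w (x - s • hh x), ?_, fun x => ⟨hh x, rfl⟩, hmin, ?_⟩
  · intro x v
    have h1 := hmin (x + v) (hh x)
    have h2 := hw (x + t • hh x) v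
    have h3 := hw (x - s • hh x) v
    rw [show x + v + t • hh x = x + t • hh x + v by abel, show x + v - s • hh x = x - s • hh x + v by abel] at h1
    have h4 := mul_le_mul_of_nonneg_left h2 hs.le
    have h5 := mul_le_mul_of_nonneg_left h3 ht.le
    have e : s * ℓ v + t * ℓ v = ℓ v := by rw [← add_mul, hst, one_mul]
    simp only
    linarith
  · intro x p B hB hTB hp
    obtain ⟨r, hr, hTB⟩ := Metric.eventually_nhds_iff_ball.1 hTB
    set a := x + t • hh x with ha
    set b := x - s • hh x with hb
    have hxab : s • a + t • b = x := by
      have : s • a + t • b = (s + t) • x := by rw [ha, hb]; module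
      rw [this, hst, one_smul]
    have hcm := comb hF hG hw hS (hf.sub (continuous_const.mul hwc)) hs ht hst (a := a) (b := b) hB hp
      (r := r / 2) (by positivity) (fun z1 z2 h1 h2 => by
        have hn : ‖s • z1 + t • z2‖ < r := by
          calc ‖s • z1 + t • z2‖ ≤ ‖s • z1‖ + ‖t • z2‖ := norm_add_le _ _
            _ = s * ‖z1‖ + t * ‖z2‖ := by
              rw [norm_smul, norm_smul, Real.norm_of_nonneg hs.le, Real.norm_of_nonneg ht.le]
            _ ≤ s * (r / 2) + t * (r / 2) := by gcongr
            _ = r / 2 := by rw [← add_mul, hst, one_mul]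
            _ < r := by linarith
        have h3 := hTB _ (mem_ball_zero_iff.2 hn)
        have h4 := hmin (x + (s • z1 + t • z2)) (hh x + z1 - z2)
        have e1 : x + (s • z1 + t • z2) + t • (hh x + z1 - z2) = a + z1 := by
          have : x + (s • z1 + t • z2) + t • (hh x + z1 - z2) = a + (s + t) • z1 := by rw [ha]; module
          rw [this, hst, one_smul]
        have e2 : x + (s • z1 + t • z2) - s • (hh x + z1 - z2) = b + z2 := by
          have : x + (s • z1 + t • z2) - s • (hh x + z1 - z2) = b + (s + t) • z2 := by rw [hb]; module
          rw [this, hst, one_smul]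
        rw [e1, e2] at h4
        exact h3.trans h4)
    have h1 := hfc.2 (Set.mem_univ a) (Set.mem_univ b) hs.le ht.le hst
    rw [hxab] at h1
    simp only [smul_eq_mul] at h1 hcm ⊢
    nlinarith

end Perron
end CE

namespace CE

section Bump
variable {E : Type*} [NormedAddCommGroup E] [InnerProductSpace ℝ E] [FiniteDimensional ℝ E]

theorem tay_quad {A : E →L[ℝ] E} (hA : Sy A) (a : ℝ) (x0 p x : E) :
    Tay (fun y => a + ⟪p, y - x0⟫ + 1 / 2 * ⟪A (y - x0), y - x0⟫) x (p + A (x - x0)) A := by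
  intro η hη
  filter_upwards with z
  rw [show x + z - x0 = (x - x0) + z by abel, quad_expand hA, inner_add_right, inner_add_left]
  have e : a + (⟪p, x - x0⟫ + ⟪p, z⟫) + 1 / 2 * (⟪A (x - x0), x - x0⟫ + 2 * ⟪A (x - x0), z⟫ + ⟪A z, z⟫) -
      (a + ⟪p, x - x0⟫ + 1 / 2 * ⟪A (x - x0), x - x0⟫) - (⟪p, z⟫ + ⟪A (x - x0), z⟫) - 1 / 2 * ⟪A z, z⟫ = 0 := by
    ring
  rw [e, abs_zero]; positivity

/-- local lowering of a supersolution that is not a subsolution -/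
theorem bump {F : (E →L[ℝ] E) → ℝ} {θ CF : ℝ} (hF : EllF F θ CF) {H ℓ f ψ w : E → ℝ} {R : ℝ}
    (hG : Gau H ℓ R) (hf : Continuous f) {δ : ℝ} (hψ : KL ℓ ψ)
    (hw : KL ℓ w) (hS : Sup F H (fun x => f x - δ * w x) w) (hψw : ∀ x, ψ x ≤ w x)
    {x0 p : E} {A : E →L[ℝ] E} (hA : Sy A) (hTA : TA w x0 p A) (hlt : ψ x0 < w x0)
    (hFA : f x0 - δ * w x0 < F A) :
    ∃ w' : E → ℝ, KL ℓ w' ∧ Sup F H (fun x => f x - δ * w' x) w' ∧ (∀ x, ψ x ≤ w' x) ∧ w' x0 < w x0 := by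
  have hCF := hF.hC
  have hwc := hG.kl_cont hw
  have hψc := hG.kl_cont hψ
  obtain ⟨r0, hr0, hTA⟩ := Metric.eventually_nhds_iff_ball.1 hTA
  set gap := F A - (f x0 - δ * w x0) with hgap
  have hgap0 : 0 < gap := by linarith
  set η := gap / (4 * (CF + 1)) with hη
  have hη0 : 0 < η := by positivity
  have hηC : 2 * η * CF ≤ gap / 2 := by
    have : η * (4 * (CF + 1)) = gap := by rw [hη]; field_simp
    nlinarith
  set A' := A + (2 * η) • ContinuousLinearMap.id ℝ E with hA'
  have hA's : Sy A' := hA.add (Sy.id.smul _)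
  have hFA' : f x0 - δ * w x0 + gap / 2 ≤ F A' := by
    have := hF.shift A hA (2 * η) (by positivity)
    rw [← hA'] at this
    linarith
  set φ : E → ℝ := fun y => w x0 + ⟪p, y - x0⟫ + 1 / 2 * ⟪A' (y - x0), y - x0⟫ with hφ
  have hφc : Continuous φ := by simp only [hφ]; fun_prop
  have hφ0 : φ x0 = w x0 := by simp [hφ]
  have hφT : ∀ x, Tay φ x (p + A' (x - x0)) A' := fun x => tay_quad hA's _ _ _ _
  clear_value φ A' η gap
  set d := w x0 - ψ x0 with hd
  have hd0 : 0 < d := by linarith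
  obtain ⟨r, hr, hrr0, hprop⟩ : ∃ r > 0, r < r0 ∧ ∀ y, ‖y - x0‖ ≤ r → d / 2 < φ y - ψ y ∧
      f y - δ * φ y < f x0 - δ * w x0 + gap / 4 := by
    have c1 : Continuous fun y => φ y - ψ y := hφc.sub hψc
    have c2 : Continuous fun y => f y - δ * φ y := hf.sub (continuous_const.mul hφc)
    have e1 : ∀ᶠ y in nhds x0, d / 2 < φ y - ψ y :=
      c1.continuousAt.eventually_const_lt (by simp only [hφ0]; linarith)
    have e2 : ∀ᶠ y in nhds x0, f y - δ * φ y < f x0 - δ * w x0 + gap / 4 :=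
      c2.continuousAt.eventually_lt_const (by simp only [hφ0]; linarith)
    obtain ⟨ρ, hρ, h⟩ := Metric.eventually_nhds_iff_ball.1 (e1.and e2)
    refine ⟨min (ρ / 2) (r0 / 2), by positivity, ?_, fun y hy => h y ?_⟩
    · have := min_le_right (ρ / 2) (r0 / 2); linarith
    · rw [mem_ball_iff_norm]
      have := min_le_left (ρ / 2) (r0 / 2); linarith
  obtain ⟨κ, hκ, hκd, hκr, hκδ⟩ : ∃ κ > 0, κ ≤ d / 2 ∧ κ ≤ η * r ^ 2 ∧ |δ| * κ ≤ gap / 4 := by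
    refine ⟨min (d / 2) (min (η * r ^ 2) (gap / 4 / (|δ| + 1))), by positivity, min_le_left _ _, ?_, ?_⟩
    · exact (min_le_right _ _).trans (min_le_left _ _)
    · have h1 : min (d / 2) (min (η * r ^ 2) (gap / 4 / (|δ| + 1))) ≤ gap / 4 / (|δ| + 1) :=
        (min_le_right _ _).trans (min_le_right _ _)
      have h2 : 0 < min (d / 2) (min (η * r ^ 2) (gap / 4 / (|δ| + 1))) := by positivity
      rw [le_div_iff₀ (by positivity)] at h1
      linarith
  have hwφ : ∀ y, ‖y - x0‖ ≤ r → w y ≤ φ y - η * ‖y - x0‖ ^ 2 := by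
    intro y hy
    have h1 := hTA (y - x0) (by rw [mem_ball_zero_iff]; linarith)
    rw [add_sub_cancel] at h1
    have : φ y = w x0 + ⟪p, y - x0⟫ + 1 / 2 * ⟪A' (y - x0), y - x0⟫ := by rw [hφ]
    rw [this, hA', inner_shift]
    linarith
  -- the inf-convolution with the support function
  have hℓc : Continuous ℓ := hG.kl_cont hG.kl_self
  have hex : ∀ x, ∃ y ∈ Metric.closedBall x0 r, ∀ y' ∈ Metric.closedBall x0 r,
      φ y - κ + ℓ (x - y) ≤ φ y' - κ + ℓ (x - y') := by
    intro x
    have : ProperSpace E := FiniteDimensional.proper ℝ E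
    have c1 : Continuous fun y => ℓ (x - y) := hℓc.comp (by fun_prop)
    obtain ⟨y, hy, hmin⟩ := (isCompact_closedBall x0 r).exists_isMinOn ⟨x0, by simp [hr.le]⟩
      (f := fun y => φ y - κ + ℓ (x - y)) (by fun_prop)
    exact ⟨y, hy, fun y' hy' => hmin hy'⟩
  choose Y hY hYmin using hex
  set ζ : E → ℝ := fun x => φ (Y x) - κ + ℓ (x - Y x) with hζ
  have hYr : ∀ x, ‖Y x - x0‖ ≤ r := fun x => mem_closedBall_iff_norm.1 (hY x)
  have hζle : ∀ x y, ‖y - x0‖ ≤ r → ζ x ≤ φ y - κ + ℓ (x - y) := fun x y hy =>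
    hYmin x y (mem_closedBall_iff_norm.2 hy)
  have hζe : ∀ x, ζ x = φ (Y x) - κ + ℓ (x - Y x) := fun x => rfl
  clear_value ζ
  have hζK : KL ℓ ζ := by
    intro x v
    have h1 := hζle (x + v) (Y x) (hYr x)
    have h2 := hG.subadd (x - Y x) v
    rw [show x - Y x + v = x + v - Y x by abel] at h2
    rw [hζe x]; linarith
  refine ⟨fun x => min (w x) (ζ x), ?_, ?_, ?_, ?_⟩
  · intro x v
    have h1 := hw x v
    have h2 := hζK x v
    simp only
    rw [← min_add_add_right]
    exact min_le_min h1 h2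
  · intro x q B hB hTB hq
    rcases le_or_gt (w x) (ζ x) with hle | hgt
    · simp only [min_eq_left hle]
      refine hS x q B hB ?_ hq
      filter_upwards [hTB] with z hz
      rw [min_eq_left hle] at hz
      exact hz.trans (min_le_left _ _)
    · simp only [min_eq_right hgt.le]
      have hTζ : TB ζ x q B := by
        filter_upwards [hTB] with z hz
        rw [min_eq_right hgt.le] at hz
        exact hz.trans (min_le_right _ _)
      by_cases hYx : Y x = x
      · have hxr : ‖x - x0‖ ≤ r := by have := hYr x; rwa [hYx] at this
        have hζx : ζ x = φ x - κ := by rw [hζe, hYx, sub_self, hG.zero, add_zero]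
        have h1 := hwφ x hxr
        have hxr' : ‖x - x0‖ < r := by
          have h2 : η * ‖x - x0‖ ^ 2 < η * r ^ 2 := by linarith
          exact lt_of_pow_lt_pow_left₀ 2 hr.le (lt_of_mul_lt_mul_left h2 hη0.le)
        have hφB : ∀ᶠ z in nhds (0:E), φ x + ⟪q, z⟫ + 1 / 2 * ⟪B z, z⟫ ≤ φ (x + z) := by
          filter_upwards [hTζ, Metric.ball_mem_nhds (0:E) (show 0 < r - ‖x - x0‖ by linarith)] with z hz hz2
          rw [mem_ball_zero_iff] at hz2
          have h2 := hζle (x + z) (x + z) (by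
            rw [show x + z - x0 = (x - x0) + z by abel]
            exact (norm_add_le _ _).trans (by linarith))
          rw [sub_self, hG.zero] at h2
          linarith
        have hpq : p + A' (x - x0) = q := by
          refine (hφT x).first (c := ‖B‖) ?_
          filter_upwards [hφB] with z hz
          have := (abs_le.1 (abs_quad_le B z)).1
          have h3 : 0 ≤ ‖B‖ * ‖z‖ ^ 2 := by positivity
          linarith
        have hBA : ∀ z, ⟪B z, z⟫ ≤ ⟪A' z, z⟫ := by
          refine (hφT x).second ?_
          intro η' hη'
          filter_upwards [hφB] with z hz
          rw [hpq]
          have : 0 ≤ η' * ‖z‖ ^ 2 := by positivity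
          linarith
        have h3 := hF.mono B A' hB hA's hBA
        have h4 := (hprop x hxr).2
        have h5 : δ * κ ≤ gap / 4 := (by
          have := mul_le_mul_of_nonneg_right (le_abs_self δ) hκ.le
          linarith)
        rw [hζx]
        linarith
      · exfalso
        have hne : x - Y x ≠ 0 := fun h => hYx (sub_eq_zero.1 h).symm
        refine absurd (hG.not_int hne (p := q) ?_) (not_le.2 hq)
        apply ray_le (c := -(1 / 2 * ⟪B (Y x - x), Y x - x⟫))
        filter_upwards [(tendsto_ray (Y x - x)).eventually hTζ, Ioo_mem_nhdsGT (show (0:ℝ) < 1 by norm_num)] with t ht ht0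
        have h1 := hζle (x + t • (Y x - x)) (Y x) (hYr x)
        rw [show x + t • (Y x - x) - Y x = (1 - t) • (x - Y x) by module] at h1
        have h2 := hG.smul_le (show 0 ≤ 1 - t by linarith [ht0.2]) (x - Y x)
        have h3 := hζe x
        simp only [map_smul, real_inner_smul_left, inner_smul_right] at ht
        have h4 : ⟪q, Y x - x⟫ = - ⟪q, x - Y x⟫ := by rw [← inner_neg_right, neg_sub]
        rw [h4] at ht
        nlinarith
  · intro x
    refine le_min (hψw x) ?_
    have h1 := (hprop (Y x) (hYr x)).1
    have h2 := hψ (Y x) (x - Y x)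
    rw [add_sub_cancel] at h2
    rw [hζe]; linarith
  · refine min_lt_of_right_lt ?_
    have := hζle x0 x0 (by simpa using hr.le)
    rw [sub_self, hG.zero, hφ0] at this
    linarith

theorem perron [MeasurableSpace E] [BorelSpace E] {F : (E →L[ℝ] E) → ℝ} {θ CF : ℝ} (hF : EllF F θ CF)
    {H ℓ f ψ w0 : E → ℝ} {R : ℝ}
    (hG : Gau H ℓ R) (hf : Continuous f) (hfc : ConvexOn ℝ Set.univ f) {δ : ℝ} (hδ : 0 ≤ δ) (hψ : KL ℓ ψ)
    (hψc : ConvexOn ℝ Set.univ ψ) {C : ℝ} (hψl : ∀ x, ℓ x - C ≤ ψ x)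
    (hw0 : KL ℓ w0) (hS0 : Sup F H (fun x => f x - δ * w0 x) w0) (hψw : ∀ x, ψ x ≤ w0 x) :
    ∃ w : E → ℝ, KL ℓ w ∧ ConvexOn ℝ Set.univ w ∧ (∀ x, ψ x ≤ w x) ∧ (∀ x, w x ≤ w0 x) ∧
      Sup F H (fun x => f x - δ * w x) w ∧
      ∀ x p A, Sy A → TA w x p A → w x = ψ x ∨ F A ≤ f x - δ * w x := by
  obtain ⟨w, hle, hge, hK, hS⟩ := sup_inf hF hG hf hδ (L := ψ)
    (S := {w | KL ℓ w ∧ Sup F H (fun x => f x - δ * w x) w ∧ ∀ x, ψ x ≤ w x}) ⟨w0, hw0, hS0, hψw⟩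
    (fun w hw => hw.2.2) (fun w hw => hw.1) (fun w hw => hw.2.1)
  have hψw' : ∀ x, ψ x ≤ w x := fun x => hge x _ fun v hv => hv.2.2 x
  refine ⟨w, hK, ?_, hψw', hle w0 ⟨hw0, hS0, hψw⟩, hS, ?_⟩
  · refine ⟨convex_univ, fun a _ b _ s t hs ht hst => ?_⟩
    rcases hs.eq_or_lt with rfl | hs
    · rw [zero_add] at hst; subst hst; simp
    rcases ht.eq_or_lt with rfl | ht
    · rw [add_zero] at hst; subst hst; simp
    obtain ⟨m, hmK, hme, hmle, hmS⟩ := minav hF hG hf hfc hK hS (C := C) (fun x => (hψl x).trans (hψw' x)) hs ht hst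
    have h1 := hle m ⟨hmK, hmS, fun x => ?_⟩ (s • a + t • b)
    · have h2 := hmle (s • a + t • b) (a - b)
      have e1 : s • a + t • b + t • (a - b) = a := by
        have : s • a + t • b + t • (a - b) = (s + t) • a := by module
        rw [this, hst, one_smul]
      have e2 : s • a + t • b - s • (a - b) = b := by
        have : s • a + t • b - s • (a - b) = (s + t) • b := by module
        rw [this, hst, one_smul]
      rw [e1, e2] at h2
      exact h1.trans h2
    · obtain ⟨h, hh⟩ := hme x
      have h2 := hψc.2 (Set.mem_univ (x + t • h)) (Set.mem_univ (x - s • h)) hs.le ht.le hst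
      have e1 : s • (x + t • h) + t • (x - s • h) = x := by
        have : s • (x + t • h) + t • (x - s • h) = (s + t) • x := by module
        rw [this, hst, one_smul]
      rw [e1] at h2
      simp only [smul_eq_mul] at h2
      have h3 := mul_le_mul_of_nonneg_left (hψw' (x + t • h)) hs.le
      have h4 := mul_le_mul_of_nonneg_left (hψw' (x - s • h)) ht.le
      rw [hh]; linarith
  · intro x p A hA hT
    by_contra hcon
    push Not at hcon
    obtain ⟨w', h1, h2, h3, h4⟩ := bump hF hG hf hψ hK hS hψw' hA hT (lt_of_le_of_ne (hψw' x) (Ne.symm hcon.1)) hcon.2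
    exact absurd (hle w' ⟨h1, h2, h3⟩ x) (not_le.2 h4)

end Bump
end CE

namespace CE

section ZornPart
variable {E : Type*} [NormedAddCommGroup E] [InnerProductSpace ℝ E] [FiniteDimensional ℝ E]
  [MeasurableSpace E] [BorelSpace E]

theorem exists_minimal {α : Type*} [PartialOrder α] (s : Set α)
    (ih : ∀ c ⊆ s, IsChain (fun a b => a ≤ b) c → ∀ y ∈ c, ∃ lb ∈ s, ∀ z ∈ c, lb ≤ z) (x : α) (hx : x ∈ s) :
    ∃ m ∈ s, ∀ y ∈ s, y ≤ m → y = m := by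
  obtain ⟨m, -, hm⟩ := zorn_le_nonempty₀ (α := αᵒᵈ) (OrderDual.ofDual ⁻¹' s) (fun c hc hch y hy => by
    obtain ⟨lb, h1, h2⟩ := ih (OrderDual.toDual ⁻¹' c) hc (fun a ha b hb hab => (hch ha hb hab).symm) y hy
    exact ⟨lb, h1, h2⟩) x hx
  exact ⟨m, hm.1, fun y hy hle => le_antisymm hle (hm.2 hy hle)⟩

theorem exists_convex {F : (E →L[ℝ] E) → ℝ} {θ CF : ℝ} (hF : EllF F θ CF)
    {H ℓ f u : E → ℝ} {R : ℝ} (hG : Gau H ℓ R) (hf : Continuous f) (hfc : ConvexOn ℝ Set.univ f)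
    {m C : ℝ} (hm : ∀ x, -m ≤ f x) (hu : KL ℓ u) (huS : Sub F f u) (huT : Sup F H f u)
    (hul : ∀ x, ℓ x - C ≤ u x) :
    ∃ v, KL ℓ v ∧ ConvexOn ℝ Set.univ v ∧ Sup F H f v ∧ Sub F f v ∧ ∃ C', ∀ x, ℓ x - C' ≤ v x := by
  set C3 := u 0 + C with hC3
  set 𝒞 : Set (E → ℝ) := {v | ConvexOn ℝ Set.univ v ∧ KL ℓ v ∧ Sup F H f v ∧ ∀ x, u x - C3 ≤ v x} with h𝒞
  have hz : ∀ w : E → ℝ, (fun x => f x - 0 * w x) = f := fun w => by simp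
  obtain ⟨v0, hv0K, hv0c, hv0ψ, hv0w, hv0S, -⟩ := perron hF hG hf hfc (δ := 0) le_rfl (ψ := fun x => ℓ x - C) (w0 := u)
    (fun x v => by have := hG.kl_self x v; simp only; linarith) (hG.convexOn.sub (concaveOn_const C convex_univ))
    (C := C) (fun x => le_rfl) hu (by rwa [hz]) hul
  rw [hz] at hv0S
  have hv0 : v0 ∈ 𝒞 := ⟨hv0c, hv0K, hv0S, fun x => by
    have h1 := hu 0 x
    rw [zero_add] at h1
    have := hv0ψ x
    linarith⟩
  obtain ⟨v, ⟨hvc, hvK, hvS, hvu⟩, hmin⟩ := exists_minimal 𝒞 (by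
    intro c hc hch y hy
    obtain ⟨W, hle, hge, hWK, hWS⟩ := sup_inf hF hG hf (δ := 0) le_rfl (L := fun x => u x - C3) (S := c) ⟨y, hy⟩
      (fun w hw => (hc hw).2.2.2) (fun w hw => (hc hw).2.1) (fun w hw => by rw [hz]; exact (hc hw).2.2.1)
    rw [hz] at hWS
    refine ⟨W, ⟨⟨convex_univ, fun a _ b _ s t hs ht hst => ?_⟩, hWK, hWS, fun x => hge x _ fun w hw => (hc hw).2.2.2 x⟩, hle⟩
    have hnear : ∀ x, ∀ κ > 0, ∃ w ∈ c, w x < W x + κ := by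
      intro x κ hκ
      by_contra hcon
      push Not at hcon
      have := hge x _ hcon
      linarith
    apply le_of_forall_pos_le_add
    intro κ hκ
    obtain ⟨w1, hw1, h1⟩ := hnear a κ hκ
    obtain ⟨w2, hw2, h2⟩ := hnear b κ hκ
    obtain ⟨w, hw, hwa, hwb⟩ : ∃ w ∈ c, w a ≤ w1 a ∧ w b ≤ w2 b := by
      rcases hch.total hw1 hw2 with h | h
      · exact ⟨w1, hw1, le_rfl, h b⟩
      · exact ⟨w2, hw2, h a, le_rfl⟩
    have h3 := (hc hw).1.2 (Set.mem_univ a) (Set.mem_univ b) hs ht hst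
    have h4 := hle w hw (s • a + t • b)
    simp only [smul_eq_mul] at h3 ⊢
    have h5 : s * w a ≤ s * (W a + κ) := by gcongr; linarith
    have h6 : t * w b ≤ t * (W b + κ) := by gcongr; linarith
    have e : s * κ + t * κ = κ := by rw [← add_mul, hst, one_mul]
    linarith) v0 hv0
  have hvcont := hG.kl_cont hvK
  set C' := |m| + 1 with hC'
  have hC'0 : 0 < C' := by positivity
  obtain ⟨w, hwK, hwc, hwψ, hwv, hwS, hwT⟩ := perron hF hG (f := fun x => f x + v x) (hf.add hvcont) (hfc.add hvc)
    (δ := 1) zero_le_one (ψ := fun x => v x - C') (w0 := v)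
    (fun x z => by have := hvK x z; simp only; linarith) (hvc.sub (concaveOn_const C' convex_univ))
    (C := C + C3 + C') (fun x => by have := hvu x; have := hul x; linarith) hvK (by simpa using hvS)
    (fun x => by linarith)
  have hwS' : Sup F H f w := by
    intro x p A hA hT hp
    have h1 := hwS x p A hA hT hp
    have := hwv x
    simp only at h1
    linarith
  have hcmp := comparison hF hG hf hvcont hu huS hwK (by simpa using hwS) hm hvu (Cu := C + C3)
    (fun x => by have := hul x; have := hG.nonneg x; linarith)
    (Cw := C + C3 + C') (fun x => by have := hwψ x; have := hvu x; have := hul x; linarith)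
  have hwv' : w = v := hmin w ⟨hwc, hwK, hwS', hcmp⟩ hwv
  subst hwv'
  refine ⟨w, hvK, hvc, hvS, ?_, C + C3, fun x => ?_⟩
  · intro x p A hA hT
    rcases hwT x p A hA hT with h | h
    · linarith
    · linarith
  · have := hvu x; have := hul x; linarith

end ZornPart
end CE

namespace CE

section Reg
open MeasureTheory
variable {E : Type*} [NormedAddCommGroup E] [InnerProductSpace ℝ E] [FiniteDimensional ℝ E]

theorem mollify [MeasurableSpace E] [BorelSpace E] {H ℓ v : E → ℝ} {R : ℝ} (hG : Gau H ℓ R) (hv : KL ℓ v)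
    (hc : ConvexOn ℝ Set.univ v) {τ : ℝ} (hτ : 0 < τ) :
    ∃ u : E → ℝ, ContDiff ℝ 2 u ∧ ConvexOn ℝ Set.univ u ∧ KL ℓ u ∧ ∀ x, |u x - v x| ≤ R * τ := by
  have hvc := hG.kl_cont hv
  let φ : ContDiffBump (0 : E) := ⟨τ / 2, τ, by positivity, by linarith⟩
  set k : E → ℝ := φ.normed volume with hk
  have hk0 : ∀ y, 0 ≤ k y := fun y => φ.nonneg_normed y
  have hkc : Continuous k := φ.continuous_normed
  have hks : HasCompactSupport k := φ.hasCompactSupport_normed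
  have hk1 : ∫ y, k y = 1 := φ.integral_normed
  have hkvi : ∀ x, Integrable (fun y => k y * v (x - y)) := fun x =>
    (hkc.mul (hvc.comp (by fun_prop))).integrable_of_hasCompactSupport hks.mul_right
  set u : E → ℝ := convolution k v (ContinuousLinearMap.lsmul ℝ ℝ) volume with hu
  have hue : ∀ x, u x = ∫ y, k y * v (x - y) := fun x => by
    simp only [hu, convolution_def, ContinuousLinearMap.lsmul_apply, smul_eq_mul]
  refine ⟨u, ?_, ?_, ?_, ?_⟩
  · have : ContDiff ℝ ((2 : ℕ∞) : WithTop ℕ∞) u := hks.contDiff_convolution_left (n := 2) _ φ.contDiff_normed hvc.locallyIntegrable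
    exact this
  · refine ⟨convex_univ, fun a _ b _ s t hs ht hst => ?_⟩
    rw [hue, hue, hue, smul_eq_mul, smul_eq_mul, ← integral_const_mul, ← integral_const_mul, ← integral_add ((hkvi a).const_mul s) ((hkvi b).const_mul t)]
    refine integral_mono (hkvi _) (((hkvi a).const_mul s).add ((hkvi b).const_mul t)) fun y => ?_
    have h1 := hc.2 (Set.mem_univ (a - y)) (Set.mem_univ (b - y)) hs ht hst
    have e : s • (a - y) + t • (b - y) = s • a + t • b - y := by
      have : s • (a - y) + t • (b - y) = s • a + t • b - (s + t) • y := by module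
      rw [this, hst, one_smul]
    rw [e] at h1
    simp only [smul_eq_mul] at h1 ⊢
    have := mul_le_mul_of_nonneg_left h1 (hk0 y)
    linarith
  · intro x z
    have e : u x + ℓ z = ∫ y, (k y * v (x - y) + k y * ℓ z) := by
      rw [integral_add (hkvi x) (φ.integrable_normed.mul_const _), integral_mul_const, hk1, one_mul, hue]
    rw [e, hue]
    refine integral_mono (hkvi _) ((hkvi x).add (φ.integrable_normed.mul_const _)) fun y => ?_
    have h1 := hv (x - y) z
    rw [show x - y + z = x + z - y by abel] at h1
    have := mul_le_mul_of_nonneg_left h1 (hk0 y)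
    simp only
    linarith
  · intro x
    have := φ.dist_normed_convolution_le (μ := volume) (g := v) (x₀ := x) (ε := R * τ) hvc.aestronglyMeasurable (fun y hy => by
      rw [Real.dist_eq]
      refine (hG.kl_abs hv y x).trans ?_
      have h1 : ‖y - x‖ < τ := mem_ball_iff_norm.1 hy
      have := hG.R0
      gcongr)
    rwa [Real.dist_eq] at this

theorem seg_deriv {V : Type*} [NormedAddCommGroup V] [NormedSpace ℝ V] {Φ : E → V}
    {Φ' : E → E →L[ℝ] V} (h : ∀ y, HasFDerivAt Φ (Φ' y) y) (hc : Continuous Φ') (e x : E) :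
    HasFDerivAt (fun x => ∫ t in (-1:ℝ)..1, Φ (x + t • e)) (∫ t in (-1:ℝ)..1, Φ' (x + t • e)) x := by
  have hΦc : Continuous Φ := continuous_iff_continuousAt.2 fun y => (h y).continuousAt
  have : ProperSpace E := FiniteDimensional.proper ℝ E
  obtain ⟨M, hM⟩ := (isCompact_closedBall x (1 + ‖e‖)).exists_bound_of_continuousOn hc.continuousOn
  refine intervalIntegral.hasFDerivAt_integral_of_dominated_of_fderiv_le (F' := fun x t => Φ' (x + t • e))
    (bound := fun _ => M) (Metric.ball_mem_nhds x one_pos) ?_ ?_ ?_ ?_ ?_ ?_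
  · exact Eventually.of_forall fun y => (hΦc.comp (by fun_prop : Continuous fun t : ℝ => y + t • e)).aestronglyMeasurable
  · exact (hΦc.comp (by fun_prop : Continuous fun t : ℝ => x + t • e)).intervalIntegrable _ _
  · exact (hc.comp (by fun_prop : Continuous fun t : ℝ => x + t • e)).aestronglyMeasurable
  · refine Eventually.of_forall fun t ht y hy => hM _ ?_
    rw [Set.uIoc_of_le (by norm_num)] at ht
    rw [mem_closedBall_iff_norm]
    rw [mem_ball_iff_norm] at hy
    rw [show y + t • e - x = (y - x) + t • e by abel]
    refine (norm_add_le _ _).trans ?_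
    rw [norm_smul, Real.norm_eq_abs]
    have h1 : |t| ≤ 1 := abs_le.2 ⟨ht.1.le, ht.2⟩
    nlinarith [norm_nonneg e]
  · exact intervalIntegrable_const
  · refine Eventually.of_forall fun t ht y hy => ?_
    have h1 : HasFDerivAt (fun y : E => y + t • e) (ContinuousLinearMap.id ℝ E) y := (hasFDerivAt_id y).add_const _
    have h2 := (h (y + t • e)).comp y h1
    rw [ContinuousLinearMap.comp_id] at h2
    exact h2

theorem segment {ℓ u : E → ℝ} (hu : ContDiff ℝ 2 u) (hcv : ConvexOn ℝ Set.univ u) (hK : KL ℓ u) (e : E) :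
    ∃ (P : E → E) (AA : E → E →L[ℝ] E), KL ℓ (fun x => 1 / 2 * ∫ t in (-1:ℝ)..1, u (x + t • e)) ∧
      ∀ x, Sy (AA x) ∧ Tay (fun x => 1 / 2 * ∫ t in (-1:ℝ)..1, u (x + t • e)) x (P x) (AA x) ∧
        (∀ z, 0 ≤ ⟪AA x z, z⟫) ∧
        (1 / 2 * ∫ t in (-1:ℝ)..1, u (x + t • e)) - u x ≤ 2 * ⟪AA x e, e⟫ := by
  have : CompleteSpace E := FiniteDimensional.complete ℝ E
  have huc := hu.continuous
  set G : E → E := fun y => gradient u y with hGdef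
  have hud : ∀ y, HasFDerivAt u (J (G y)) y := by
    intro y
    have h1 := ((hu.differentiable (by norm_num)) y).hasGradientAt.hasFDerivAt
    have e : J (G y) = (InnerProductSpace.toDual ℝ E) (gradient u y) := by
      ext z
      simp [J_apply, hGdef]
    rw [e]
    exact h1
  have hGC : ContDiff ℝ 1 G := by
    have h1 : ContDiff ℝ 1 (fderiv ℝ u) := hu.fderiv_right (by norm_num)
    exact (InnerProductSpace.toDual ℝ E).symm.contDiff.comp h1
  have hGc := hGC.continuous
  have hGd : ∀ y, HasFDerivAt G (fderiv ℝ G y) y := fun y => (hGC.differentiable (by norm_num) y).hasFDerivAt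
  have hG'c : Continuous (fderiv ℝ G) := hGC.continuous_fderiv (by norm_num)
  -- gradient inequality
  have hgi : ∀ a z, u a + ⟪G a, z⟫ ≤ u (a + z) := by
    intro a z
    have hd : HasDerivAt (fun t : ℝ => u (a + t • z)) ⟪G a, z⟫ 0 := by
      have h1 : HasDerivAt (fun t : ℝ => a + t • z) z 0 := by
        simpa using ((hasDerivAt_id (0:ℝ)).smul_const z).const_add a
      have h2 : HasFDerivAt u (J (G a)) (a + (0:ℝ) • z) := by simpa using hud a
      have := h2.comp_hasDerivAt 0 h1
      rw [J_apply] at this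
      exact this
    have h3 : ∀ᶠ t in nhdsWithin (0:ℝ) (Set.Ioi 0), t⁻¹ • (u (a + (0 + t) • z) - u (a + (0:ℝ) • z)) ≤ u (a + z) - u a := by
      filter_upwards [Ioo_mem_nhdsGT (show (0:ℝ) < 1 by norm_num)] with t ht
      have h4 := hcv.2 (Set.mem_univ (a + z)) (Set.mem_univ a) ht.1.le (show 0 ≤ 1 - t by linarith [ht.2]) (by ring)
      rw [show t • (a + z) + (1 - t) • a = a + t • z by module] at h4
      simp only [smul_eq_mul] at h4 ⊢
      rw [zero_add, zero_smul, add_zero, inv_mul_le_iff₀ ht.1]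
      linarith
    have h5 := hd.tendsto_slope_zero_right
    have := le_of_tendsto h5 h3
    linarith
  have hmono : ∀ a z, ⟪G a, z⟫ ≤ ⟪G (a + z), z⟫ := by
    intro a z
    have h1 := hgi a z
    have h2 := hgi (a + z) (-z)
    rw [add_neg_cancel_right, inner_neg_right] at h2
    linarith
  have hpc : ∀ x : E, Continuous fun t : ℝ => x + t • e := fun x => by fun_prop
  have hui : ∀ x, IntervalIntegrable (fun t : ℝ => u (x + t • e)) volume (-1) 1 := fun x =>
    (huc.comp (hpc x)).intervalIntegrable _ _
  have hGi : ∀ x, IntervalIntegrable (fun t : ℝ => G (x + t • e)) volume (-1) 1 := fun x =>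
    (hGc.comp (hpc x)).intervalIntegrable _ _
  have hG'i : ∀ x, IntervalIntegrable (fun t : ℝ => fderiv ℝ G (x + t • e)) volume (-1) 1 := fun x =>
    (hG'c.comp (hpc x)).intervalIntegrable _ _
  set P : E → E := fun x => (1 / 2 : ℝ) • ∫ t in (-1:ℝ)..1, G (x + t • e) with hP
  set AA : E → E →L[ℝ] E := fun x => (1 / 2 : ℝ) • ∫ t in (-1:ℝ)..1, fderiv ℝ G (x + t • e) with hAA
  set w : E → ℝ := fun x => 1 / 2 * ∫ t in (-1:ℝ)..1, u (x + t • e) with hw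
  have hJc : Continuous fun y => J (G y) := J.continuous.comp hGc
  have hwd : ∀ x, HasFDerivAt w (J (P x)) x := by
    intro x
    have h1 := (seg_deriv hud hJc e x).const_mul (1 / 2 : ℝ)
    have e2 : J (P x) = (1 / 2 : ℝ) • ∫ t in (-1:ℝ)..1, J (G (x + t • e)) := by
      rw [ContinuousLinearMap.intervalIntegral_comp_comm J (hGi x), ← map_smul]
    rw [e2]
    exact h1
  have hPd : ∀ x, HasFDerivAt P (AA x) x := fun x => (seg_deriv hGd hG'c e x).const_smul (1 / 2 : ℝ)
  have htay : ∀ x, Sy (AA x) ∧ Tay w x (P x) (AA x) := fun x => taylor (Eventually.of_forall hwd) (hPd x)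
  have hPin : ∀ x z, ⟪P x, z⟫ = 1 / 2 * ∫ t in (-1:ℝ)..1, ⟪G (x + t • e), z⟫ := by
    intro x z
    rw [hP]
    simp only [real_inner_smul_left]
    congr 1
    have h1 := ContinuousLinearMap.intervalIntegral_comp_comm (J z) (hGi x)
    simp only [J_apply] at h1
    rw [real_inner_comm, ← h1]
    simp only [real_inner_comm]
  refine ⟨P, AA, ?_, fun x => ⟨(htay x).1, (htay x).2, ?_, ?_⟩⟩
  · intro x z
    have h1 : ∫ t in (-1:ℝ)..1, u (x + z + t • e) ≤ ∫ t in (-1:ℝ)..1, (u (x + t • e) + ℓ z) := by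
      refine intervalIntegral.integral_mono (by norm_num) (hui _) ((hui x).add intervalIntegrable_const) fun t => ?_
      have := hK (x + t • e) z
      rwa [show x + t • e + z = x + z + t • e by abel] at this
    rw [intervalIntegral.integral_add (hui x) intervalIntegrable_const, intervalIntegral.integral_const, smul_eq_mul] at h1
    simp only [hw]
    linarith
  · intro z
    have hgz : ∀ z, IntervalIntegrable (fun t : ℝ => ⟪G (x + t • e), z⟫) volume (-1) 1 := fun z =>
      ((hGc.comp (hpc x)).inner continuous_const).intervalIntegrable _ _
    have h1 := (htay x).2.second (B := 0) (fun η hη => by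
      filter_upwards with z
      have h2 : ∫ t in (-1:ℝ)..1, (u (x + t • e) + ⟪G (x + t • e), z⟫) ≤ ∫ t in (-1:ℝ)..1, u (x + z + t • e) := by
        refine intervalIntegral.integral_mono (by norm_num) ((hui x).add ?_) (hui _) fun t => ?_
        · exact hgz z
        · have := hgi (x + t • e) z
          rwa [show x + t • e + z = x + z + t • e by abel] at this
      rw [intervalIntegral.integral_add (hui x) (hgz z)] at h2
      rw [hPin]
      simp only [hw, zero_apply, inner_zero_left]
      have : 0 ≤ η * ‖z‖ ^ 2 := by positivity
      linarith) z
    simpa using h1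
  · have hB : 2 * ⟪AA x e, e⟫ = ⟪G (x + e), e⟫ - ⟪G (x - e), e⟫ := by
      have hder : ∀ t ∈ Set.uIcc (-1:ℝ) 1, HasDerivAt (fun t : ℝ => ⟪G (x + t • e), e⟫) (⟪fderiv ℝ G (x + t • e) e, e⟫) t := by
        intro t _
        have h1 : HasDerivAt (fun t : ℝ => x + t • e) e t := by
          simpa using ((hasDerivAt_id t).smul_const e).const_add x
        have h2 := (hGd (x + t • e)).comp_hasDerivAt t h1
        have h3 := (J e).hasFDerivAt.comp_hasDerivAt t h2
        have h4 : (fun t : ℝ => ⟪G (x + t • e), e⟫) = (fun y => J e y) ∘ (G ∘ fun t : ℝ => x + t • e) := by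
          ext s; simp [J_apply, real_inner_comm]
        rw [h4, real_inner_comm, ← J_apply]
        exact h3
      have hci : Continuous fun t : ℝ => ⟪fderiv ℝ G (x + t • e) e, e⟫ := by
        have := hG'c.comp (hpc x)
        have h2 : Continuous fun t : ℝ => fderiv ℝ G (x + t • e) e := this.clm_apply continuous_const
        exact h2.inner continuous_const
      have h1 := intervalIntegral.integral_eq_sub_of_hasDerivAt hder (hci.intervalIntegrable _ _)
      rw [one_smul, neg_smul, one_smul, ← sub_eq_add_neg] at h1
      rw [← h1, hAA]
      simp only [smul_apply, real_inner_smul_left]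
      rw [ContinuousLinearMap.intervalIntegral_apply (hG'i x)]
      have hi : IntervalIntegrable (fun t : ℝ => fderiv ℝ G (x + t • e) e) volume (-1) 1 := by
        have h3 : Continuous fun t : ℝ => fderiv ℝ G (x + t • e) e := (hG'c.comp (hpc x)).clm_apply continuous_const
        exact h3.intervalIntegrable _ _
      have h2 := ContinuousLinearMap.intervalIntegral_comp_comm (J e) hi
      simp only [J_apply] at h2
      rw [real_inner_comm, ← h2]
      simp only [real_inner_comm]
      ring
    rw [hB]
    have hpt : ∀ t ∈ Set.Icc (-1:ℝ) 1, u (x + t • e) ≤ u x + t * ⟪G x, e⟫ + (⟪G (x + e), e⟫ - ⟪G (x - e), e⟫) := by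
      intro t ht
      have h1 := hgi (x + t • e) (-(t • e))
      rw [add_neg_cancel_right, inner_neg_right, inner_smul_right] at h1
      have hmon : ∀ s s' : ℝ, s ≤ s' → ⟪G (x + s • e), e⟫ ≤ ⟪G (x + s' • e), e⟫ := by
        intro s s' hss
        rcases hss.eq_or_lt with rfl | hss
        · rfl
        have h2 := hmono (x + s • e) ((s' - s) • e)
        rw [show x + s • e + (s' - s) • e = x + s' • e by module, inner_smul_right, inner_smul_right] at h2
        exact le_of_mul_le_mul_left h2 (by linarith)
      have h2 := hmon t 1 ht.2
      have h3 := hmon (-1) t ht.1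
      have h4 := hmon 0 1 (by norm_num)
      have h5 := hmon (-1) 0 (by norm_num)
      simp only [one_smul, neg_smul, zero_smul, add_zero, ← sub_eq_add_neg] at h2 h3 h4 h5
      rcases le_total 0 t with h0 | h0
      · nlinarith [ht.2, mul_nonneg h0 (sub_nonneg.2 h2), mul_nonneg h0 (sub_nonneg.2 h5), mul_nonneg (sub_nonneg.2 ht.2) (sub_nonneg.2 (h5.trans h4))]
      · have h0' : 0 ≤ -t := by linarith
        nlinarith [mul_nonneg h0' (sub_nonneg.2 h3), mul_nonneg h0' (sub_nonneg.2 h4), mul_nonneg (show 0 ≤ 1 + t by linarith [ht.1]) (sub_nonneg.2 (h5.trans h4))]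
    have hi1 : IntervalIntegrable (fun t : ℝ => u x + t * ⟪G x, e⟫ + (⟪G (x + e), e⟫ - ⟪G (x - e), e⟫)) volume (-1) 1 :=
      (by fun_prop : Continuous _).intervalIntegrable _ _
    have h1 := intervalIntegral.integral_mono_on (by norm_num) (hui x) hi1 hpt
    have h2 : ∫ t in (-1:ℝ)..1, (u x + t * ⟪G x, e⟫ + (⟪G (x + e), e⟫ - ⟪G (x - e), e⟫)) =
        2 * u x + 2 * (⟪G (x + e), e⟫ - ⟪G (x - e), e⟫) := by
      rw [intervalIntegral.integral_add ((by fun_prop : Continuous _).intervalIntegrable _ _) intervalIntegrable_const,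
        intervalIntegral.integral_add intervalIntegrable_const ((by fun_prop : Continuous _).intervalIntegrable _ _),
        intervalIntegral.integral_mul_const, integral_id]
      simp
      ring
    linarith

end Reg
end CE

namespace CE

section C11
open MeasureTheory
variable {E : Type*} [NormedAddCommGroup E] [InnerProductSpace ℝ E] [FiniteDimensional ℝ E]

theorem seg_bound {F : (E →L[ℝ] E) → ℝ} {θ CF : ℝ} (hF : EllF F θ CF)
    {H ℓ f u v : E → ℝ} {R : ℝ} (hG : Gau H ℓ R) {m C κ : ℝ} (hm0 : 0 ≤ m) (hm : ∀ x, -m ≤ f x)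
    (hv : KL ℓ v) (hS : Sup F H f v) (hl : ∀ x, ℓ x - C ≤ v x) (hu : ContDiff ℝ 2 u)
    (hcv : ConvexOn ℝ Set.univ u) (hK : KL ℓ u) (hκ0 : 0 ≤ κ) (hκ : ∀ x, |u x - v x| ≤ κ) (e x : E) :
    (1 / 2 * ∫ t in (-1:ℝ)..1, u (x + t • e)) - v x ≤ κ + 2 * m / θ * ‖e‖ ^ 2 := by
  obtain ⟨P, AA, hwK, hw⟩ := segment hu hcv hK e
  set w : E → ℝ := fun x => 1 / 2 * ∫ t in (-1:ℝ)..1, u (x + t • e) with hwdef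
  have hθ := hF.hθ
  have hwc := hG.kl_cont hwK
  have hvc := hG.kl_cont hv
  obtain ⟨c, hc, hlow⟩ := hG.lower
  have key : ∀ ρ ∈ Set.Ioo (0:ℝ) 1, ρ * w x - v x - (1 - ρ) * C ≤ κ + 2 * m / θ * ‖e‖ ^ 2 := by
    intro ρ hρ
    obtain ⟨y, hy⟩ := exists_min (k := fun x => v x - ρ * w x) (a := (1 - ρ) * c) (b := C + ρ * w 0)
      (by fun_prop) (mul_pos (by linarith [hρ.2]) hc) (fun x => by
        have h1 := hwK 0 x
        rw [zero_add] at h1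
        have h2 := hl x
        have h3 := mul_le_mul_of_nonneg_left (hlow x) (show 0 ≤ 1 - ρ by linarith [hρ.2])
        have h4 := mul_le_mul_of_nonneg_left h1 hρ.1.le
        nlinarith)
    obtain ⟨hsy, htay, hpsd, hws⟩ := hw y
    have hP : H (P y) ≤ 0 := by
      refine hwK.grad_TA hG (x := y) (A := AA y + (2:ℝ) • ContinuousLinearMap.id ℝ E) ?_
      filter_upwards [htay 1 one_pos] with z hz
      rw [inner_shift]
      have := (abs_le.1 hz).2
      linarith
    have hP2 : H (ρ • P y) < 0 := (hG.scale hP hρ.1.le hρ.2.le).trans_lt (by nlinarith [hG.neg0, hρ.2])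
    have h1 : f y ≤ F (ρ • AA y) := by
      refine hS.jet hF (x := y) (hsy.smul ρ) (fun η hη => ?_) hP2
      filter_upwards [htay η hη] with z hz
      have h2 := (abs_le.1 hz).1
      have h3 := hy (y + z)
      simp only [smul_apply, real_inner_smul_left] at h3 ⊢
      have h4 := mul_le_mul_of_nonneg_left h2 hρ.1.le
      have h5 : ρ * (η * ‖z‖ ^ 2) ≤ η * ‖z‖ ^ 2 := mul_le_of_le_one_left (by positivity) hρ.2.le
      nlinarith
    have h2 : θ * (ρ * ⟪AA y e, e⟫) ≤ m * ‖e‖ ^ 2 := by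
      by_cases he : e = 0
      · simp [he]
      have hne : ‖e‖ ≠ 0 := norm_ne_zero_iff.2 he
      have h3 := hF.up (ρ • AA y) (hsy.smul ρ) (fun z => by
        simp only [smul_apply, real_inner_smul_left]
        exact mul_nonneg hρ.1.le (hpsd z)) (‖e‖⁻¹ • e) (by rw [norm_smul, norm_inv, norm_norm, inv_mul_cancel₀ hne])
      simp only [smul_apply, real_inner_smul_left, map_smul, real_inner_smul_right] at h3
      have h4 := hm y
      have h5 : θ * (ρ * (‖e‖⁻¹ * (‖e‖⁻¹ * ⟪AA y e, e⟫))) ≤ m := by linarith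
      have h6 := mul_le_mul_of_nonneg_right h5 (sq_nonneg ‖e‖)
      have h7 : θ * (ρ * (‖e‖⁻¹ * (‖e‖⁻¹ * ⟪AA y e, e⟫))) * ‖e‖ ^ 2 = θ * (ρ * ⟪AA y e, e⟫) := by
        field_simp
      rwa [h7] at h6
    have h3 : ρ * ⟪AA y e, e⟫ ≤ m / θ * ‖e‖ ^ 2 := by
      rw [div_mul_eq_mul_div, le_div_iff₀ hθ]; linarith
    have h4 : w y ≤ v y + κ + 2 * ⟪AA y e, e⟫ := by
      have := (abs_le.1 (hκ y)).2
      have h5 : w y - u y ≤ 2 * ⟪AA y e, e⟫ := hws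
      linarith
    have h5 := mul_le_mul_of_nonneg_left h4 hρ.1.le
    have h6 := hy x
    have h7 : -C ≤ v y := by linarith [hl y, hG.nonneg y]
    have h8 := mul_le_mul_of_nonneg_left h7 (show 0 ≤ 1 - ρ by linarith [hρ.2])
    have h9 : ρ * κ ≤ κ := mul_le_of_le_one_left hκ0 hρ.2.le
    have h10 : 2 * m / θ * ‖e‖ ^ 2 = 2 * (m / θ * ‖e‖ ^ 2) := by ring
    rw [h10]
    nlinarith
  have hlim : Tendsto (fun ρ : ℝ => ρ * w x - v x - (1 - ρ) * C) (nhdsWithin 1 (Set.Iio 1)) (nhds (1 * w x - v x - (1 - 1) * C)) := by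
    have : Continuous fun ρ : ℝ => ρ * w x - v x - (1 - ρ) * C := by fun_prop
    exact (this.tendsto 1).mono_left nhdsWithin_le_nhds
  have := le_of_tendsto hlim (by
    filter_upwards [Ioo_mem_nhdsLT (show (0:ℝ) < 1 by norm_num)] with ρ hρ using key ρ hρ)
  have h0 : 1 * w x - v x - (1 - 1) * C = w x - v x := by ring
  rw [h0] at this
  exact this

theorem seg_bound' [MeasurableSpace E] [BorelSpace E] {F : (E →L[ℝ] E) → ℝ} {θ CF : ℝ} (hF : EllF F θ CF)
    {H ℓ f v : E → ℝ} {R : ℝ} (hG : Gau H ℓ R) {m C : ℝ} (hm0 : 0 ≤ m) (hm : ∀ x, -m ≤ f x)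
    (hv : KL ℓ v) (hc : ConvexOn ℝ Set.univ v) (hS : Sup F H f v) (hl : ∀ x, ℓ x - C ≤ v x) (e x : E) :
    (1 / 2 * ∫ t in (-1:ℝ)..1, v (x + t • e)) - v x ≤ 2 * m / θ * ‖e‖ ^ 2 := by
  apply le_of_forall_pos_le_add
  intro ε hε
  have hR := hG.R0
  set τ := ε / (2 * R) with hτ
  have hτ0 : 0 < τ := by positivity
  have hRτ : R * τ = ε / 2 := by rw [hτ]; field_simp
  obtain ⟨u, h1, h2, h3, h4⟩ := mollify hG hv hc hτ0
  have h5 := seg_bound hF hG hm0 hm hv hS hl h1 h2 h3 (by positivity) h4 e x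
  have hvc := hG.kl_cont hv
  have huc := hG.kl_cont h3
  have h6 : ∫ t in (-1:ℝ)..1, v (x + t • e) ≤ ∫ t in (-1:ℝ)..1, (u (x + t • e) + R * τ) := by
    refine intervalIntegral.integral_mono (by norm_num) ?_ ?_ fun t => ?_
    · exact (hvc.comp (by fun_prop : Continuous fun t : ℝ => x + t • e)).intervalIntegrable _ _
    · exact ((huc.comp (by fun_prop : Continuous fun t : ℝ => x + t • e)).add continuous_const).intervalIntegrable _ _
    · have := (abs_le.1 (h4 (x + t • e))).1
      simp only; linarith
  have hui : IntervalIntegrable (fun t : ℝ => u (x + t • e)) volume (-1) 1 :=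
    (huc.comp (by fun_prop : Continuous fun t : ℝ => x + t • e)).intervalIntegrable _ _
  rw [intervalIntegral.integral_add hui intervalIntegrable_const, intervalIntegral.integral_const, smul_eq_mul] at h6
  linarith

theorem second_diff {v : E → ℝ} (hvc : Continuous v) (hc : ConvexOn ℝ Set.univ v) {K : ℝ} (x e : E)
    (h : (1 / 2 * ∫ t in (-1:ℝ)..1, v (x + t • e)) - v x ≤ K) :
    v (x + (1 / 2 : ℝ) • e) - 2 * v x + v (x - (1 / 2 : ℝ) • e) ≤ 12 * K := by
  set D : ℝ → ℝ := fun t => v (x + t • e) + v (x + (-t) • e) - 2 * v x with hD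
  have hpc : Continuous fun t : ℝ => v (x + t • e) := hvc.comp (by fun_prop)
  have hpn : Continuous fun t : ℝ => v (x + (-t) • e) := hvc.comp (by fun_prop)
  have hD0 : ∀ t, 0 ≤ D t := by
    intro t
    have := hc.2 (Set.mem_univ (x + t • e)) (Set.mem_univ (x + (-t) • e)) (show (0:ℝ) ≤ 1 / 2 by norm_num) (show (0:ℝ) ≤ 1 / 2 by norm_num) (by norm_num)
    rw [show (1 / 2 : ℝ) • (x + t • e) + (1 / 2 : ℝ) • (x + (-t) • e) = x by module] at this
    simp only [smul_eq_mul] at this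
    simp only [hD]; linarith
  have hDe : ∀ t, D (-t) = D t := by
    intro t; simp only [hD, neg_neg]; ring
  have hDt : ∀ t, 1 / 2 ≤ t → 2 * t * D (1 / 2) ≤ D t := by
    intro t ht
    have ht0 : 0 < t := by linarith
    have key : ∀ e' : E, v (x + (1 / 2 : ℝ) • e') ≤ (1 / (2 * t)) * v (x + t • e') + (1 - 1 / (2 * t)) * v x := by
      intro e'
      have h1 : 1 / (2 * t) ≤ 1 := by rw [div_le_one (by positivity)]; linarith
      have := hc.2 (Set.mem_univ (x + t • e')) (Set.mem_univ x) (show (0:ℝ) ≤ 1 / (2 * t) by positivity) (sub_nonneg.2 h1) (by ring)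
      have e2 : (1 / (2 * t)) • (x + t • e') + (1 - 1 / (2 * t)) • x = x + (1 / 2 : ℝ) • e' := by
        have : (1 / (2 * t)) • (t • e') = (1 / 2 : ℝ) • e' := by
          rw [smul_smul]; congr 1; field_simp
        rw [smul_add, this]; module
      rw [e2] at this
      simpa using this
    have h1 := key e
    have h2 := key (-e)
    simp only [smul_neg, ← neg_smul] at h2
    have h3 : D (1 / 2) ≤ (1 / (2 * t)) * D t := by
      simp only [hD]; linarith
    have h4 := mul_le_mul_of_nonneg_left h3 (show 0 ≤ 2 * t by positivity)
    have h5 : 2 * t * (1 / (2 * t) * D t) = D t := by field_simp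
    linarith
  have hpt : ∀ t ∈ Set.Icc (-1:ℝ) 1, (2 * t ^ 2 - 1 / 2) * D (1 / 2) ≤ D t := by
    have hd := hD0 (1 / 2)
    have aux : ∀ t : ℝ, 0 ≤ t → t ≤ 1 → (2 * t ^ 2 - 1 / 2) * D (1 / 2) ≤ D t := by
      intro t h0 h1
      rcases le_total t (1 / 2) with h2 | h2
      · have : (2 * t ^ 2 - 1 / 2) * D (1 / 2) ≤ 0 := mul_nonpos_of_nonpos_of_nonneg (by nlinarith) hd
        linarith [hD0 t]
      · have : (2 * t ^ 2 - 1 / 2) * D (1 / 2) ≤ 2 * t * D (1 / 2) := mul_le_mul_of_nonneg_right (by nlinarith) hd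
        linarith [hDt t h2]
    intro t ht
    rcases le_total 0 t with h0 | h0
    · exact aux t h0 ht.2
    · have := aux (-t) (by linarith) (by linarith [ht.1])
      rwa [hDe, neg_sq] at this
  have hDi : IntervalIntegrable D volume (-1) 1 := ((hpc.add hpn).sub continuous_const).intervalIntegrable _ _
  have h1 := intervalIntegral.integral_mono_on (by norm_num) ((by fun_prop : Continuous fun t : ℝ => (2 * t ^ 2 - 1 / 2) * D (1 / 2)).intervalIntegrable (-1) 1) hDi hpt
  have h2 : ∫ t in (-1:ℝ)..1, (2 * t ^ 2 - 1 / 2) * D (1 / 2) = 1 / 3 * D (1 / 2) := by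
    rw [intervalIntegral.integral_mul_const, intervalIntegral.integral_sub ((by fun_prop : Continuous fun t : ℝ => 2 * t ^ 2).intervalIntegrable _ _) intervalIntegrable_const, intervalIntegral.integral_const_mul, integral_pow, intervalIntegral.integral_const]
    norm_num
  have hneg : ∫ t in (-1:ℝ)..1, v (x + (-t) • e) = ∫ t in (-1:ℝ)..1, v (x + t • e) := by
    have := intervalIntegral.integral_comp_neg (a := -1) (b := 1) (fun t : ℝ => v (x + t • e))
    rwa [neg_neg] at this
  have h3 : ∫ t in (-1:ℝ)..1, D t = 2 * (∫ t in (-1:ℝ)..1, v (x + t • e)) - 4 * v x := by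
    simp only [hD]
    have hi : IntervalIntegrable (fun t : ℝ => v (x + t • e) + v (x + (-t) • e)) volume (-1) 1 :=
      (hpc.add hpn).intervalIntegrable _ _
    rw [intervalIntegral.integral_sub hi intervalIntegrable_const,
      intervalIntegral.integral_add (hpc.intervalIntegrable _ _) (hpn.intervalIntegrable _ _), hneg, intervalIntegral.integral_const]
    simp only [smul_eq_mul]
    ring
  rw [h2, h3] at h1
  have h4 : D (1 / 2) = v (x + (1 / 2 : ℝ) • e) - 2 * v x + v (x - (1 / 2 : ℝ) • e) := by
    simp only [hD, neg_smul, sub_eq_add_neg]; ring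
  rw [← h4]
  linarith

theorem c11 [MeasurableSpace E] [BorelSpace E] {F : (E →L[ℝ] E) → ℝ} {θ CF : ℝ} (hF : EllF F θ CF)
    {H ℓ f v : E → ℝ} {R : ℝ} (hG : Gau H ℓ R) {m C : ℝ} (hm0 : 0 ≤ m) (hm : ∀ x, -m ≤ f x)
    (hv : KL ℓ v) (hc : ConvexOn ℝ Set.univ v) (hS : Sup F H f v) (hl : ∀ x, ℓ x - C ≤ v x) (x h : E) :
    0 ≤ v (x + h) - 2 * v x + v (x - h) ∧ v (x + h) - 2 * v x + v (x - h) ≤ 96 * m / θ * ‖h‖ ^ 2 := by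
  constructor
  · have := hc.2 (Set.mem_univ (x + h)) (Set.mem_univ (x - h)) (show (0:ℝ) ≤ 1 / 2 by norm_num) (show (0:ℝ) ≤ 1 / 2 by norm_num) (by norm_num)
    rw [show (1 / 2 : ℝ) • (x + h) + (1 / 2 : ℝ) • (x - h) = x by module] at this
    simp only [smul_eq_mul] at this
    linarith
  · have h1 := seg_bound' hF hG hm0 hm hv hc hS hl ((2:ℝ) • h) x
    have h2 := second_diff (hG.kl_cont hv) hc x ((2:ℝ) • h) h1
    rw [smul_smul, show (1 / 2 : ℝ) * 2 = 1 by norm_num, one_smul, norm_smul, Real.norm_ofNat] at h2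
    have : 12 * (2 * m / θ * (2 * ‖h‖) ^ 2) = 96 * m / θ * ‖h‖ ^ 2 := by ring
    linarith

end C11
end CE

namespace CE

section Conv
variable {n : ℕ}

/-- matrix of a continuous linear map in the standard basis -/
noncomputable def Mat (A : EuclideanSpace ℝ (Fin n) →L[ℝ] EuclideanSpace ℝ (Fin n)) : Matrix (Fin n) (Fin n) ℝ :=
  Matrix.of fun i j => ⟪A (EuclideanSpace.single i (1:ℝ)), EuclideanSpace.single j (1:ℝ)⟫

theorem Mat_apply (A : (EuclideanSpace ℝ (Fin n)) →L[ℝ] (EuclideanSpace ℝ (Fin n))) (i j : Fin n) :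
    Mat A i j = ⟪A (EuclideanSpace.single i (1:ℝ)), EuclideanSpace.single j (1:ℝ)⟫ := rfl

theorem Mat_add (A B : (EuclideanSpace ℝ (Fin n)) →L[ℝ] (EuclideanSpace ℝ (Fin n))) : Mat (A + B) = Mat A + Mat B := by
  ext i j
  simp only [Matrix.add_apply, Mat_apply, add_apply, inner_add_left]

theorem Mat_smul (c : ℝ) (A : (EuclideanSpace ℝ (Fin n)) →L[ℝ] (EuclideanSpace ℝ (Fin n))) : Mat (c • A) = c • Mat A := by
  ext i j
  simp only [Matrix.smul_apply, Mat_apply, smul_apply, real_inner_smul_left, smul_eq_mul]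

theorem Mat_zero : Mat (0 : (EuclideanSpace ℝ (Fin n)) →L[ℝ] (EuclideanSpace ℝ (Fin n))) = 0 := by
  ext i j
  simp only [Matrix.zero_apply, Mat_apply, zero_apply, inner_zero_left]

theorem Mat_symm {A : (EuclideanSpace ℝ (Fin n)) →L[ℝ] (EuclideanSpace ℝ (Fin n))} (hA : Sy A) : (Mat A).IsSymm := by
  ext i j
  simp only [Matrix.transpose_apply, Mat_apply]
  rw [hA, real_inner_comm]

theorem Mat_quad (A : (EuclideanSpace ℝ (Fin n)) →L[ℝ] (EuclideanSpace ℝ (Fin n))) (x : Fin n → ℝ) :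
    x ⬝ᵥ (Mat A).mulVec x = ⟪A (WithLp.toLp 2 x), WithLp.toLp 2 x⟫ := by
  have h1 : (WithLp.toLp 2 x : (EuclideanSpace ℝ (Fin n))) = ∑ i, x i • EuclideanSpace.single i (1:ℝ) := by
    ext j
    simp [Finset.sum_apply, Pi.single_apply]
  rw [h1, map_sum, sum_inner]
  simp only [inner_sum, map_smul, real_inner_smul_left, real_inner_smul_right]
  simp only [dotProduct, Matrix.mulVec, Mat_apply, Finset.mul_sum]
  refine Finset.sum_congr rfl fun i _ => Finset.sum_congr rfl fun j _ => ?_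
  ring

theorem Mat_psd {A : (EuclideanSpace ℝ (Fin n)) →L[ℝ] (EuclideanSpace ℝ (Fin n))} (hA : Sy A) (h : ∀ z, 0 ≤ ⟪A z, z⟫) : (Mat A).PosSemidef := by
  refine Matrix.PosSemidef.of_dotProduct_mulVec_nonneg ?_ fun x => ?_
  · have := Mat_symm hA
    rw [Matrix.IsHermitian, Matrix.conjTranspose_eq_transpose_of_trivial]
    exact this
  · rw [star_trivial, Mat_quad]; exact h _

theorem Mat_trace (A : (EuclideanSpace ℝ (Fin n)) →L[ℝ] (EuclideanSpace ℝ (Fin n))) : (Mat A).trace = ∑ i, ⟪A (EuclideanSpace.single i (1:ℝ)), EuclideanSpace.single i (1:ℝ)⟫ := rfl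

theorem Mat_trace_id (c : ℝ) : (Mat (c • ContinuousLinearMap.id ℝ (EuclideanSpace ℝ (Fin n)))).trace = c * n := by
  rw [Mat_trace]
  simp [real_inner_smul_left, mul_comm]

theorem psd_cs {A : (EuclideanSpace ℝ (Fin n)) →L[ℝ] (EuclideanSpace ℝ (Fin n))} (hA : Sy A) (h : ∀ z, 0 ≤ ⟪A z, z⟫) (x y : (EuclideanSpace ℝ (Fin n))) :
    ⟪A x, y⟫ ^ 2 ≤ ⟪A x, x⟫ * ⟪A y, y⟫ := by
  have h1 : ∀ t : ℝ, 0 ≤ ⟪A y, y⟫ * (t * t) + (2 * ⟪A x, y⟫) * t + ⟪A x, x⟫ := by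
    intro t
    have h2 := h (x + t • y)
    simp only [map_add, map_smul, inner_add_left, inner_add_right, real_inner_smul_left, real_inner_smul_right] at h2
    have h3 : ⟪A y, x⟫ = ⟪A x, y⟫ := by rw [hA, real_inner_comm]
    rw [h3] at h2
    linarith
  have h2 := discrim_le_zero h1
  unfold discrim at h2
  linarith

theorem trace_ge {A : (EuclideanSpace ℝ (Fin n)) →L[ℝ] (EuclideanSpace ℝ (Fin n))} (hA : Sy A) (h : ∀ z, 0 ≤ ⟪A z, z⟫) {ξ : (EuclideanSpace ℝ (Fin n))} (hξ : ‖ξ‖ = 1) :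
    ⟪A ξ, ξ⟫ ≤ (Mat A).trace := by
  have h0 : 0 ≤ (Mat A).trace := by
    rw [Mat_trace]; exact Finset.sum_nonneg fun i _ => h _
  have h1 : ‖A ξ‖ ^ 2 ≤ (Mat A).trace * ⟪A ξ, ξ⟫ := by
    rw [EuclideanSpace.norm_sq_eq, Mat_trace, Finset.sum_mul]
    refine Finset.sum_le_sum fun i _ => ?_
    have h2 := psd_cs hA h (EuclideanSpace.single i (1:ℝ)) ξ
    have h3 : ⟪A (EuclideanSpace.single i (1:ℝ)), ξ⟫ = A ξ i := by
      rw [hA]; simp [EuclideanSpace.inner_single_left]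
    rw [h3] at h2
    rwa [Real.norm_eq_abs, sq_abs]
  have h2 : ⟪A ξ, ξ⟫ ≤ ‖A ξ‖ := by
    have := real_inner_le_norm (A ξ) ξ
    rwa [hξ, mul_one] at this
  rcases (h ξ).eq_or_lt with h3 | h3
  · rw [← h3]; exact h0
  · have h4 : ⟪A ξ, ξ⟫ * ⟪A ξ, ξ⟫ ≤ (Mat A).trace * ⟪A ξ, ξ⟫ := by nlinarith
    exact le_of_mul_le_mul_right h4 h3

theorem ellF {θ Θ : ℝ} (hθ : 0 < θ) (hθΘ : θ ≤ Θ)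
    {F : Matrix (Fin n) (Fin n) ℝ → ℝ}
    (hFell : ∀ M N : Matrix (Fin n) (Fin n) ℝ, M.IsSymm → N.PosSemidef →
      -Θ * N.trace ≤ F (M + N) - F M ∧ F (M + N) - F M ≤ -θ * N.trace)
    (hFhom : ∀ t : ℝ, 0 ≤ t → ∀ M : Matrix (Fin n) (Fin n) ℝ, M.IsSymm →
      F (t • M) = t * F M)
    (hFsadd : ∀ M N : Matrix (Fin n) (Fin n) ℝ, M.IsSymm → N.IsSymm →
      F M + F N ≤ F (M + N)) : EllF (fun A : (EuclideanSpace ℝ (Fin n)) →L[ℝ] (EuclideanSpace ℝ (Fin n)) => F (Mat A)) θ (Θ * n) := by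
  have hz : F (Mat (0 : (EuclideanSpace ℝ (Fin n)) →L[ℝ] (EuclideanSpace ℝ (Fin n)))) = 0 := by
    have := hFhom 0 le_rfl (Mat (0 : (EuclideanSpace ℝ (Fin n)) →L[ℝ] (EuclideanSpace ℝ (Fin n)))) (Mat_symm Sy.zero)
    rw [zero_smul, zero_mul] at this
    rw [Mat_zero, this]
  have key : ∀ A B : (EuclideanSpace ℝ (Fin n)) →L[ℝ] (EuclideanSpace ℝ (Fin n)), Sy A → Sy B → (∀ z, 0 ≤ ⟪B z, z⟫) →
      -Θ * (Mat B).trace ≤ F (Mat (A + B)) - F (Mat A) ∧ F (Mat (A + B)) - F (Mat A) ≤ -θ * (Mat B).trace := by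
    intro A B hA hB h
    rw [Mat_add]
    exact hFell _ _ (Mat_symm hA) (Mat_psd hB h)
  have htr : ∀ B : (EuclideanSpace ℝ (Fin n)) →L[ℝ] (EuclideanSpace ℝ (Fin n)), (∀ z, 0 ≤ ⟪B z, z⟫) → 0 ≤ (Mat B).trace := fun B h => by
    rw [Mat_trace]; exact Finset.sum_nonneg fun i _ => h _
  have hcid : ∀ c : ℝ, 0 ≤ c → ∀ z : (EuclideanSpace ℝ (Fin n)), 0 ≤ ⟪(c • ContinuousLinearMap.id ℝ (EuclideanSpace ℝ (Fin n))) z, z⟫ := by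
    intro c hc z
    simp only [smul_apply, ContinuousLinearMap.id_apply, real_inner_smul_left, real_inner_self_eq_norm_sq]
    positivity
  refine ⟨hθ, by have : 0 < Θ := by linarith
                 positivity, hz, ?_, ?_, ?_, ?_, ?_⟩
  · intro A B hA hB h
    have hs : Sy (B + (-1:ℝ) • A) := hB.add (hA.smul _)
    have hp : ∀ z, 0 ≤ ⟪(B + (-1:ℝ) • A) z, z⟫ := fun z => by
      simp only [add_apply, smul_apply, inner_add_left, real_inner_smul_left]
      linarith [h z]
    have h1 := (key A _ hA hs hp).2
    rw [show A + (B + (-1:ℝ) • A) = B by module] at h1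
    have := mul_nonneg hθ.le (htr _ hp)
    linarith
  · intro A hA c hc
    have h1 := (key A _ hA (Sy.id.smul c) (hcid c hc)).1
    rw [Mat_trace_id] at h1
    linarith
  · intro A B hA hB s t hs ht
    have h1 := hFsadd _ _ (Mat_symm (hA.smul s)) (Mat_symm (hB.smul t))
    rw [← Mat_add, Mat_smul, Mat_smul, hFhom s hs _ (Mat_symm hA), hFhom t ht _ (Mat_symm hB)] at h1
    exact h1
  · intro A hA c d hc h v hv hd
    have hs : Sy (c • ContinuousLinearMap.id ℝ (EuclideanSpace ℝ (Fin n)) + (-1:ℝ) • A) := (Sy.id.smul c).add (hA.smul _)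
    have hq : ∀ z, ⟪(c • ContinuousLinearMap.id ℝ (EuclideanSpace ℝ (Fin n)) + (-1:ℝ) • A) z, z⟫ = c * ‖z‖ ^ 2 - ⟪A z, z⟫ := fun z => by
      simp only [add_apply, smul_apply, inner_add_left, real_inner_smul_left, ContinuousLinearMap.id_apply, real_inner_self_eq_norm_sq]
      ring
    have hp : ∀ z, 0 ≤ ⟪(c • ContinuousLinearMap.id ℝ (EuclideanSpace ℝ (Fin n)) + (-1:ℝ) • A) z, z⟫ := fun z => by
      rw [hq]; linarith [h z]
    have h1 := (key A _ hA hs hp).2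
    rw [show A + (c • ContinuousLinearMap.id ℝ (EuclideanSpace ℝ (Fin n)) + (-1:ℝ) • A) = c • ContinuousLinearMap.id ℝ (EuclideanSpace ℝ (Fin n)) by module] at h1
    have h2 := (key 0 _ Sy.zero (Sy.id.smul c) (hcid c hc)).1
    rw [zero_add, hz, Mat_trace_id] at h2
    have hne : ‖v‖ ≠ 0 := norm_ne_zero_iff.2 hv
    have hn1 : ‖‖v‖⁻¹ • v‖ = 1 := by rw [norm_smul, norm_inv, norm_norm, inv_mul_cancel₀ hne]
    have h3 := trace_ge hs hp hn1
    rw [hq, hn1] at h3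
    simp only [map_smul, real_inner_smul_left, real_inner_smul_right] at h3
    have h4 : ‖v‖⁻¹ * (‖v‖⁻¹ * ⟪A v, v⟫) ≤ -d := by
      have h5 := mul_le_mul_of_nonneg_left hd (show 0 ≤ ‖v‖⁻¹ * ‖v‖⁻¹ by positivity)
      have h6 : ‖v‖⁻¹ * ‖v‖⁻¹ * (-d * ‖v‖ ^ 2) = -d := by field_simp
      linarith
    have h5 : d ≤ (Mat (c • ContinuousLinearMap.id ℝ (EuclideanSpace ℝ (Fin n)) + (-1:ℝ) • A)).trace := by linarith
    have h6 := mul_le_mul_of_nonneg_left h5 hθ.le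
    linarith
  · intro A hA h ξ hξ
    have h1 := (key 0 A Sy.zero hA h).2
    rw [zero_add, hz] at h1
    have h2 := mul_le_mul_of_nonneg_left (trace_ge hA h hξ) hθ.le
    linarith

theorem c2_jet {φ : (EuclideanSpace ℝ (Fin n)) → ℝ} (hφ : ContDiff ℝ 2 φ) (x : (EuclideanSpace ℝ (Fin n))) :
    ∃ A : (EuclideanSpace ℝ (Fin n)) →L[ℝ] (EuclideanSpace ℝ (Fin n)), Sy A ∧ Tay φ x (gradient φ x) A ∧ hessianMatrix φ x = Mat A := by
  set G : (EuclideanSpace ℝ (Fin n)) → (EuclideanSpace ℝ (Fin n)) := fun y => gradient φ y with hGdef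
  have hud : ∀ y, HasFDerivAt φ (J (G y)) y := by
    intro y
    have h1 := ((hφ.differentiable (by norm_num)) y).hasGradientAt.hasFDerivAt
    have e : J (G y) = (InnerProductSpace.toDual ℝ (EuclideanSpace ℝ (Fin n))) (gradient φ y) := by
      ext z
      simp [J_apply, hGdef]
    rw [e]
    exact h1
  have hGC : ContDiff ℝ 1 G := by
    have h1 : ContDiff ℝ 1 (fderiv ℝ φ) := hφ.fderiv_right (by norm_num)
    exact (InnerProductSpace.toDual ℝ (EuclideanSpace ℝ (Fin n))).symm.contDiff.comp h1
  have hGd : HasFDerivAt G (fderiv ℝ G x) x := (hGC.differentiable (by norm_num) x).hasFDerivAt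
  obtain ⟨h1, h2⟩ := taylor (Eventually.of_forall hud) hGd
  refine ⟨fderiv ℝ G x, h1, h2, ?_⟩
  have h3 : HasFDerivAt (fderiv ℝ φ) ((J (E := (EuclideanSpace ℝ (Fin n)))).comp (fderiv ℝ G x)) x := by
    have e : fderiv ℝ φ = fun y => J (G y) := by
      ext1 y; exact (hud y).fderiv
    rw [e]
    exact (J (E := (EuclideanSpace ℝ (Fin n)))).hasFDerivAt.comp x hGd
  ext i j
  rw [hessianMatrix, Matrix.of_apply, Mat_apply, iteratedFDeriv_two_apply, h3.fderiv]
  simp only [Matrix.cons_val_zero, Matrix.cons_val_one, ContinuousLinearMap.comp_apply, J_apply]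

theorem quad_jet {F : Matrix (Fin n) (Fin n) ℝ → ℝ} {θ CF : ℝ}
    (hF : EllF (fun A : (EuclideanSpace ℝ (Fin n)) →L[ℝ] (EuclideanSpace ℝ (Fin n)) => F (Mat A)) θ CF) (a : ℝ) (x p : (EuclideanSpace ℝ (Fin n))) {A : (EuclideanSpace ℝ (Fin n)) →L[ℝ] (EuclideanSpace ℝ (Fin n))} (hA : Sy A) :
    let φ := fun y => a + ⟪p, y - x⟫ + 1 / 2 * ⟪A (y - x), y - x⟫
    ContDiff ℝ 2 φ ∧ gradient φ x = p ∧ F (hessianMatrix φ x) = F (Mat A) := by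
  intro φ
  have hc : ContDiff ℝ 2 φ := by
    have h1 : ContDiff ℝ 2 fun y : (EuclideanSpace ℝ (Fin n)) => y - x := contDiff_id.sub contDiff_const
    exact (contDiff_const.add (contDiff_const.inner ℝ h1)).add (contDiff_const.mul ((A.contDiff.comp h1).inner ℝ h1))
  obtain ⟨B, hB, hT, hh⟩ := c2_jet hc x
  have hQ := tay_quad hA a x p x
  rw [sub_self, map_zero, add_zero] at hQ
  have hlo : ∀ η > 0, ∀ᶠ z in nhds (0 : (EuclideanSpace ℝ (Fin n))), φ x + ⟪p, z⟫ + 1 / 2 * ⟪A z, z⟫ - η * ‖z‖ ^ 2 ≤ φ (x + z) := by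
    intro η hη
    filter_upwards [hQ η hη] with z hz
    have h1 : -(η * ‖z‖ ^ 2) ≤ φ (x + z) - φ x - ⟪p, z⟫ - 1 / 2 * ⟪A z, z⟫ := (abs_le.1 hz).1
    linarith
  have hup : ∀ η > 0, ∀ᶠ z in nhds (0 : (EuclideanSpace ℝ (Fin n))), φ (x + z) ≤ φ x + ⟪p, z⟫ + 1 / 2 * ⟪A z, z⟫ + η * ‖z‖ ^ 2 := by
    intro η hη
    filter_upwards [hQ η hη] with z hz
    have h1 : φ (x + z) - φ x - ⟪p, z⟫ - 1 / 2 * ⟪A z, z⟫ ≤ η * ‖z‖ ^ 2 := (abs_le.1 hz).2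
    linarith
  have hg : gradient φ x = p := by
    refine hT.first (c := ‖A‖ + 1) ?_
    filter_upwards [hlo 1 one_pos] with z hz
    have := (abs_le.1 (abs_quad_le A z)).1
    have h0 : 0 ≤ ‖A‖ * ‖z‖ ^ 2 := by positivity
    linarith
  refine ⟨hc, hg, ?_⟩
  rw [hg] at hT
  rw [hh]
  have h1 := hT.second hlo
  have h2 := hT.second' hup
  exact le_antisymm (hF.mono A B hA hB h1) (hF.mono B A hB hA h2)

theorem sup_of {F : Matrix (Fin n) (Fin n) ℝ → ℝ} {θ CF lam : ℝ} {H f u : (EuclideanSpace ℝ (Fin n)) → ℝ}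
    (hF : EllF (fun A : (EuclideanSpace ℝ (Fin n)) →L[ℝ] (EuclideanSpace ℝ (Fin n)) => F (Mat A)) θ CF) (h : IsSupersolutionEig F H f lam u) :
    Sup (fun A : (EuclideanSpace ℝ (Fin n)) →L[ℝ] (EuclideanSpace ℝ (Fin n)) => F (Mat A)) H (fun x => f x - lam) u := by
  intro x p A hA hT hp
  obtain ⟨h1, h2, h3⟩ := quad_jet hF (u x) x p hA
  have h4 := h _ h1 x (by
    have h5 : Tendsto (fun y => y - x) (nhds x) (nhds (0:(EuclideanSpace ℝ (Fin n)))) := by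
      have : Continuous fun y : (EuclideanSpace ℝ (Fin n)) => y - x := by fun_prop
      simpa using this.tendsto x
    filter_upwards [h5.eventually hT] with y hy
    rw [add_sub_cancel] at hy
    simp only [sub_self, map_zero, inner_zero_right, mul_zero, add_zero]
    linarith)
  rw [h2, h3] at h4
  rcases le_max_iff.1 h4 with h5 | h5
  · simp only; linarith
  · linarith

theorem sub_of {F : Matrix (Fin n) (Fin n) ℝ → ℝ} {θ CF lam : ℝ} {H f u : (EuclideanSpace ℝ (Fin n)) → ℝ}
    (hF : EllF (fun A : (EuclideanSpace ℝ (Fin n)) →L[ℝ] (EuclideanSpace ℝ (Fin n)) => F (Mat A)) θ CF) (h : IsSubsolutionEig F H f lam u) :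
    Sub (fun A : (EuclideanSpace ℝ (Fin n)) →L[ℝ] (EuclideanSpace ℝ (Fin n)) => F (Mat A)) (fun x => f x - lam) u ∧ ∀ x p A, Sy A → TA u x p A → H p ≤ 0 := by
  have key : ∀ x p A, Sy A → TA u x p A → F (Mat A) ≤ f x - lam ∧ H p ≤ 0 := by
    intro x p A hA hT
    obtain ⟨h1, h2, h3⟩ := quad_jet hF (u x) x p hA
    have h4 := h _ h1 x (by
      have h5 : Tendsto (fun y => y - x) (nhds x) (nhds (0:(EuclideanSpace ℝ (Fin n)))) := by
        have : Continuous fun y : (EuclideanSpace ℝ (Fin n)) => y - x := by fun_prop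
        simpa using this.tendsto x
      filter_upwards [h5.eventually hT] with y hy
      rw [add_sub_cancel] at hy
      simp only [sub_self, map_zero, inner_zero_right, mul_zero, add_zero]
      linarith)
    rw [h2, h3] at h4
    obtain ⟨h5, h6⟩ := max_le_iff.1 h4
    exact ⟨by linarith, h6⟩
  exact ⟨fun x p A hA hT => (key x p A hA hT).1, fun x p A hA hT => (key x p A hA hT).2⟩

theorem of_sup {F : Matrix (Fin n) (Fin n) ℝ → ℝ} {θ CF lam : ℝ} {H f u : (EuclideanSpace ℝ (Fin n)) → ℝ}
    (hF : EllF (fun A : (EuclideanSpace ℝ (Fin n)) →L[ℝ] (EuclideanSpace ℝ (Fin n)) => F (Mat A)) θ CF)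
    (h : Sup (fun A : (EuclideanSpace ℝ (Fin n)) →L[ℝ] (EuclideanSpace ℝ (Fin n)) => F (Mat A)) H (fun x => f x - lam) u) : IsSupersolutionEig F H f lam u := by
  intro φ hφ x hx
  obtain ⟨A, hA, hT, hh⟩ := c2_jet hφ x
  rw [le_max_iff]
  by_cases hp : 0 ≤ H (gradient φ x)
  · exact Or.inr hp
  left
  have h5 : Tendsto (fun z => x + z) (nhds (0:(EuclideanSpace ℝ (Fin n)))) (nhds x) := by
    have : Continuous fun z : (EuclideanSpace ℝ (Fin n)) => x + z := by fun_prop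
    simpa using this.tendsto 0
  have h1 := h.jet hF (x := x) (p := gradient φ x) hA (fun η hη => by
    filter_upwards [hT η hη, h5.eventually hx] with z hz hz2
    have := (abs_le.1 hz).1
    linarith) (not_le.1 hp)
  rw [hh]; linarith

theorem of_sub {F : Matrix (Fin n) (Fin n) ℝ → ℝ} {θ CF lam R : ℝ} {H f u ℓ : (EuclideanSpace ℝ (Fin n)) → ℝ}
    (hF : EllF (fun A : (EuclideanSpace ℝ (Fin n)) →L[ℝ] (EuclideanSpace ℝ (Fin n)) => F (Mat A)) θ CF) (hG : Gau H ℓ R) (hK : KL ℓ u)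
    (h : Sub (fun A : (EuclideanSpace ℝ (Fin n)) →L[ℝ] (EuclideanSpace ℝ (Fin n)) => F (Mat A)) (fun x => f x - lam) u) : IsSubsolutionEig F H f lam u := by
  intro φ hφ x hx
  obtain ⟨A, hA, hT, hh⟩ := c2_jet hφ x
  have h5 : Tendsto (fun z => x + z) (nhds (0:(EuclideanSpace ℝ (Fin n)))) (nhds x) := by
    have : Continuous fun z : (EuclideanSpace ℝ (Fin n)) => x + z := by fun_prop
    simpa using this.tendsto 0
  have h0 : ∀ η > 0, ∀ᶠ z in nhds (0 : (EuclideanSpace ℝ (Fin n))), u (x + z) ≤ u x + ⟪gradient φ x, z⟫ + 1 / 2 * ⟪A z, z⟫ + η * ‖z‖ ^ 2 := by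
    intro η hη
    filter_upwards [hT η hη, h5.eventually hx] with z hz hz2
    have := (abs_le.1 hz).2
    linarith
  have h1 := h.jet hF (x := x) (p := gradient φ x) hA h0
  refine max_le ?_ ?_
  · rw [hh]; linarith
  · refine hK.grad_TA hG (x := x) (A := A + (2:ℝ) • ContinuousLinearMap.id ℝ (EuclideanSpace ℝ (Fin n))) ?_
    filter_upwards [h0 1 one_pos] with z hz
    rw [inner_shift]
    linarith

end Conv
end CE

theorem convex_eigenfunction_with_bounded_hessian
    {n : ℕ} (hn : 0 < n)
    (θ Θ : ℝ) (hθ : 0 < θ) (hθΘ : θ ≤ Θ)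
    (F : Matrix (Fin n) (Fin n) ℝ → ℝ)
    (hFell : ∀ M N : Matrix (Fin n) (Fin n) ℝ, M.IsSymm → N.PosSemidef →
      -Θ * N.trace ≤ F (M + N) - F M ∧ F (M + N) - F M ≤ -θ * N.trace)
    (hFhom : ∀ t : ℝ, 0 ≤ t → ∀ M : Matrix (Fin n) (Fin n) ℝ, M.IsSymm →
      F (t • M) = t * F M)
    (hFsadd : ∀ M N : Matrix (Fin n) (Fin n) ℝ, M.IsSymm → N.IsSymm →
      F M + F N ≤ F (M + N))
    (H ℓ : EuclideanSpace ℝ (Fin n) → ℝ)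
    (hH : Continuous H) (hH0 : H 0 < 0)
    (hKcpt : IsCompact {p : EuclideanSpace ℝ (Fin n) | H p ≤ 0})
    (hKconv : StrictConvex ℝ {p : EuclideanSpace ℝ (Fin n) | H p ≤ 0})
    (hHconv : ConvexOn ℝ Set.univ H)
    (σ Sig : ℝ) (hσ : 0 < σ) (hSig : 0 < Sig)
    (hHsc : ConvexOn ℝ Set.univ fun p => H p - σ / 2 * ‖p‖ ^ 2)
    (hHSc : ConvexOn ℝ Set.univ fun p => Sig / 2 * ‖p‖ ^ 2 - H p)
    (hℓ : ∀ v, IsGreatest {r : ℝ | ∃ p, H p ≤ 0 ∧ ⟪p, v⟫ = r} (ℓ v))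
    (f : EuclideanSpace ℝ (Fin n) → ℝ)
    (hf : ConvexOn ℝ Set.univ f)
    (hfsl : Tendsto (fun x => f x / ‖x‖) (cocompact (EuclideanSpace ℝ (Fin n))) atTop)
    (lamStar : ℝ)
    (hlam : ∃ u : EuclideanSpace ℝ (Fin n) → ℝ, Continuous u ∧
      IsSubsolutionEig F H f lamStar u ∧ IsSupersolutionEig F H f lamStar u ∧
      Tendsto (fun x => u x / ℓ x) (cocompact (EuclideanSpace ℝ (Fin n))) (nhds 1)) :
    ∃ (uStar : EuclideanSpace ℝ (Fin n) → ℝ) (C : ℝ), 0 ≤ C ∧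
      ConvexOn ℝ Set.univ uStar ∧ Continuous uStar ∧
      IsSubsolutionEig F H f lamStar uStar ∧ IsSupersolutionEig F H f lamStar uStar ∧
      Tendsto (fun x => uStar x / ℓ x) (cocompact (EuclideanSpace ℝ (Fin n))) (nhds 1) ∧
      ∀ x h : EuclideanSpace ℝ (Fin n),
        0 ≤ uStar (x + h) - 2 * uStar x + uStar (x - h) ∧
        uStar (x + h) - 2 * uStar x + uStar (x - h) ≤ C * ‖h‖ ^ 2 := by
  have : Nonempty (Fin n) := ⟨⟨0, hn⟩⟩
  have hF := CE.ellF hθ hθΘ hFell hFhom hFsadd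
  obtain ⟨R0, hR0⟩ := hKcpt.isBounded.exists_norm_le
  have hG : CE.Gau H ℓ (max R0 1) :=
    ⟨hH, hHconv, hH0, lt_max_of_lt_right one_pos, fun p hp => (hR0 p hp).trans (le_max_left _ _), hℓ⟩
  obtain ⟨u, huc, hsub, hsup, hut⟩ := hlam
  have huS := CE.sup_of hF hsup
  obtain ⟨huT, huH⟩ := CE.sub_of hF hsub
  have hgr := CE.growth_of_tendsto hG huc hut
  have huK : CE.KL ℓ u := CE.kl_of_sub hG huc (fun η hη => by
    obtain ⟨C, hC⟩ := hgr η hη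
    exact ⟨C, fun x => by have := (abs_le.1 (hC x)).2; linarith⟩) huH
  have hfc : Continuous f := by
    rw [← continuousOn_univ]
    exact hf.continuousOn isOpen_univ
  -- coercivity of `f`
  have hco : ∀ᶠ x in cocompact (EuclideanSpace ℝ (Fin n)), |lamStar| < f x := by
    filter_upwards [hfsl.eventually_ge_atTop (|lamStar| + 1), (tendsto_norm_cocompact_atTop (E := EuclideanSpace ℝ (Fin n))).eventually_ge_atTop 1] with x h1 h2
    have h3 : 0 < ‖x‖ := by linarith
    rw [le_div_iff₀ h3] at h1
    nlinarith [abs_nonneg lamStar]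
  obtain ⟨r, hr⟩ : ∃ r : ℝ, ∀ x, f x - lamStar ≤ 0 → ‖x‖ ≤ r := by
    obtain ⟨K, hK, hK2⟩ := mem_cocompact.1 hco
    obtain ⟨r, hr⟩ := hK.isBounded.exists_norm_le
    refine ⟨r, fun x hx => hr x ?_⟩
    by_contra hxK
    have h1 : |lamStar| < f x := hK2 hxK
    linarith [le_abs_self lamStar]
  obtain ⟨m, hm0, hm⟩ : ∃ m : ℝ, 0 ≤ m ∧ ∀ x, -m ≤ f x - lamStar := by
    obtain ⟨M, hM⟩ := (isCompact_closedBall (0 : EuclideanSpace ℝ (Fin n)) r).exists_bound_of_continuousOn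
      (f := fun x => f x - lamStar) (by fun_prop)
    refine ⟨|M|, abs_nonneg _, fun x => ?_⟩
    by_cases hx : f x - lamStar ≤ 0
    · have := hM x (by simpa using hr x hx)
      rw [Real.norm_eq_abs] at this
      linarith [neg_abs_le (f x - lamStar), le_abs_self M]
    · linarith [abs_nonneg M]
  obtain ⟨C1, hC1⟩ := CE.lower_growth hF hG huc (fun η hη => by
    obtain ⟨C, hC⟩ := hgr η hη
    exact ⟨C, fun x => by have := (abs_le.1 (hC x)).1; linarith⟩) huS hr
  have hgc : ConvexOn ℝ Set.univ fun x => f x - lamStar := hf.sub (concaveOn_const _ convex_univ)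
  obtain ⟨v, hvK, hvc, hvS, hvT, C2, hC2⟩ := CE.exists_convex hF hG (by fun_prop : Continuous fun x => f x - lamStar) hgc hm huK huT huS hC1
  refine ⟨v, 96 * m / θ, by positivity, hvc, hG.kl_cont hvK, CE.of_sub hF hG hvK hvT, CE.of_sup hF hvS, ?_,
    fun x h => CE.c11 hF hG hm0 hm hvK hvc hvS hC2 x h⟩
  obtain ⟨c, hc, hlow⟩ := hG.lower
  have hℓt : Tendsto ℓ (cocompact (EuclideanSpace ℝ (Fin n))) atTop :=
    tendsto_atTop_mono hlow (tendsto_norm_cocompact_atTop.const_mul_atTop hc)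
  have hinv : ∀ a : ℝ, Tendsto (fun x => 1 + a / ℓ x) (cocompact (EuclideanSpace ℝ (Fin n))) (nhds 1) := fun a => by
    simpa using (hℓt.const_div_atTop a).const_add 1
  refine tendsto_of_tendsto_of_tendsto_of_le_of_le' (hinv (-C2)) (hinv (v 0)) ?_ ?_
  · filter_upwards [hℓt.eventually_gt_atTop 0] with x hx
    rw [le_div_iff₀ hx, add_mul, div_mul_cancel₀ _ hx.ne']
    linarith [hC2 x]
  · filter_upwards [hℓt.eventually_gt_atTop 0] with x hx
    rw [div_le_iff₀ hx, add_mul, div_mul_cancel₀ _ hx.ne']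
    have := hvK 0 x
    rw [zero_add] at this
    linarith
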